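/- Let A_2, A_3, A_4, … be a sequence of abelian groups indexed by the integers n ≥ 2. Then there exists a strongly torsion generated group G such that H_n(G) is isomorphic to A_n for all n ≥ 2 (and H_1(G) = 0). -/

import Mathlib

open CategoryTheory AlgebraicTopology

/-- The chain complex (over `ℤ`) associated to the nerve of the one-object groupoid on a
group `G`, i.e. the simplicial chain complex of the classifying space `BG`; its homology in
positive degrees is the integral group homology of `G`. -/
noncomputable def classifyingComplex (G : Type) [Group G] : ChainComplex (ModuleCat ℤ) ℕ :=
  (alternatingFaceMapComplex (ModuleCat ℤ)).obj
    (((SimplicialObject.whiskering (Type) (ModuleCat ℤ)).obj (ModuleCat.free ℤ)).obj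
      (nerve (SingleObj G)))

/-- The integral group homology `H_n(G; ℤ)` of a group `G`. -/
noncomputable def grpHomology (G : Type) [Group G] (n : ℕ) : ModuleCat ℤ :=
  (classifyingComplex G).homology n

/-- A group `G` is strongly torsion generated if for every `n ≥ 2` there is an element of
order exactly `n` whose normal closure is all of `G`. -/
def StronglyTorsionGenerated (G : Type*) [Group G] : Prop :=
  ∀ n : ℕ, 2 ≤ n → ∃ g : G, orderOf g = n ∧ Subgroup.normalClosure {g} = ⊤

namespace BDM
open Finsupp

/-! ### Tuples and the simplicial boundary -/

/-- Chains on `n`-tuples of elements of `S`. -/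
abbrev Tup (S : Type) (n : ℕ) : Type := (Fin n → S) →₀ ℤ

/-- Prepend an element. -/
def cns {S : Type} {n : ℕ} (s : S) (v : Fin n → S) : Fin (n + 1) → S := Fin.cons s v

@[simp] lemma cns_zero {S : Type} {n : ℕ} (s : S) (v : Fin n → S) : cns s v 0 = s := rfl
@[simp] lemma cns_succ {S : Type} {n : ℕ} (s : S) (v : Fin n → S) (i : Fin n) :
    cns s v i.succ = v i := rfl
@[simp] lemma tail_cns {S : Type} {n : ℕ} (s : S) (v : Fin n → S) : Fin.tail (cns s v) = v := rfl
lemma cns_self_tail {S : Type} {n : ℕ} (v : Fin (n + 1) → S) : cns (v 0) (Fin.tail v) = v :=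
  Fin.cons_self_tail v
lemma comp_cns {S S' : Type} {n : ℕ} (f : S → S') (s : S) (v : Fin n → S) :
    (fun i => f (cns s v i)) = cns (f s) (fun i => f (v i)) := by
  funext i
  refine Fin.cases ?_ (fun i => ?_) i <;> simp

/-- The cone operator. -/
noncomputable def cone {S : Type} {n : ℕ} (s : S) : Tup S n →ₗ[ℤ] Tup S (n + 1) :=
  Finsupp.lmapDomain ℤ ℤ (cns s)

@[simp] lemma cone_single {S : Type} {n : ℕ} (s : S) (v : Fin n → S) (a : ℤ) :
    cone s (single v a) = single (cns s v) a := by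
  simp [cone]

/-- The boundary of tuples. -/
noncomputable def bd {S : Type} : ∀ n : ℕ, Tup S (n + 1) →ₗ[ℤ] Tup S n
  | 0 => Finsupp.linearCombination ℤ (fun v => single (Fin.tail v) 1)
  | n + 1 => Finsupp.linearCombination ℤ
      (fun v => single (Fin.tail v) 1 - cone (v 0) (bd n (single (Fin.tail v) 1)))

lemma tup_ext {S M : Type} {n : ℕ} [AddCommGroup M] {f g : Tup S n →ₗ[ℤ] M}
    (h : ∀ v, f (single v 1) = g (single v 1)) : f = g := by
  refine Finsupp.lhom_ext' fun v => LinearMap.ext_ring ?_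
  simpa using h v

lemma bd_zero_cone {S : Type} (s : S) (c : Tup S 0) : bd 0 (cone s c) = c := by
  have : (bd 0).comp (cone (n := 0) s) = LinearMap.id := by
    apply tup_ext; intro v; simp [bd]
  exact LinearMap.congr_fun this c

lemma bd_succ_cone {S : Type} {n : ℕ} (s : S) (c : Tup S (n + 1)) :
    bd (n + 1) (cone s c) = c - cone s (bd n c) := by
  have : (bd (n + 1)).comp (cone (n := n + 1) s) = LinearMap.id - (cone s).comp (bd n) := by
    apply tup_ext; intro v; simp [bd]
  exact LinearMap.congr_fun this c

lemma tup_ext_cone {S M : Type} {n : ℕ} [AddCommGroup M] {f g : Tup S (n + 1) →ₗ[ℤ] M}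
    (h : ∀ s v, f (cone s (single v 1)) = g (cone s (single v 1))) : f = g := by
  apply tup_ext
  intro v
  have := h (v 0) (Fin.tail v)
  simpa [cns_self_tail] using this

lemma bd_bd {S : Type} (n : ℕ) (c : Tup S (n + 2)) : bd n (bd (n + 1) c) = 0 := by
  have : (bd n).comp (bd (n + 1)) = (0 : Tup S (n + 2) →ₗ[ℤ] Tup S n) := by
    clear c
    induction n with
    | zero =>
      apply tup_ext_cone; intro s v
      rw [LinearMap.comp_apply, bd_succ_cone, map_sub, bd_zero_cone]; simp
    | succ n ih =>
      apply tup_ext_cone; intro s v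
      rw [LinearMap.comp_apply, bd_succ_cone, map_sub, bd_succ_cone]
      have := LinearMap.congr_fun ih (single v 1)
      simp only [LinearMap.comp_apply] at this
      simp [this]
  exact LinearMap.congr_fun this c

lemma bd_exact {S : Type} (s : S) (n : ℕ) (c : Tup S (n + 1)) (hc : bd n c = 0) :
    bd (n + 1) (cone s c) = c := by
  rw [bd_succ_cone, hc]; simp

/-- Functoriality of tuples. -/
noncomputable def tmap {S S' : Type} (n : ℕ) (f : S → S') : Tup S n →ₗ[ℤ] Tup S' n :=
  Finsupp.lmapDomain ℤ ℤ (fun v i => f (v i))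

@[simp] lemma tmap_single {S S' : Type} {n : ℕ} (f : S → S') (v : Fin n → S) (a : ℤ) :
    tmap n f (single v a) = single (fun i => f (v i)) a := by
  simp [tmap]

lemma tmap_cone {S S' : Type} {n : ℕ} (f : S → S') (s : S) (c : Tup S n) :
    tmap (n + 1) f (cone s c) = cone (f s) (tmap n f c) := by
  have : (tmap (n + 1) f).comp (cone s) = (cone (f s)).comp (tmap n f) := by
    apply tup_ext; intro v; simp [comp_cns]
  exact LinearMap.congr_fun this c

lemma bd_tmap {S S' : Type} (f : S → S') (n : ℕ) (c : Tup S (n + 1)) :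
    bd n (tmap (n + 1) f c) = tmap n f (bd n c) := by
  have : (bd n).comp (tmap (n + 1) f) = (tmap n f).comp (bd n) := by
    clear c
    induction n with
    | zero =>
      apply tup_ext_cone; intro s v
      rw [LinearMap.comp_apply, LinearMap.comp_apply, tmap_cone, bd_zero_cone, bd_zero_cone]
    | succ n ih =>
      apply tup_ext_cone; intro s v
      have := LinearMap.congr_fun ih (single v 1)
      simp only [LinearMap.comp_apply] at this
      rw [LinearMap.comp_apply, LinearMap.comp_apply, tmap_cone, bd_succ_cone, bd_succ_cone,
        map_sub, tmap_cone, this]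
  exact LinearMap.congr_fun this c

/-- The prism operator. -/
noncomputable def prism {S S' : Type} (f g : S → S') : ∀ n : ℕ, Tup S n →ₗ[ℤ] Tup S' (n + 1)
  | 0 => 0
  | n + 1 => Finsupp.linearCombination ℤ (fun v =>
      cone (f (v 0)) (tmap (n + 1) g (single v 1) - prism f g n (single (Fin.tail v) 1)))

lemma prism_succ_cone {S S' : Type} (f g : S → S') (n : ℕ) (s : S) (c : Tup S n) :
    prism f g (n + 1) (cone s c) = cone (f s) (tmap (n + 1) g (cone s c) - prism f g n c) := by
  have : (prism f g (n + 1)).comp (cone s) =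
      (cone (f s)).comp ((tmap (n + 1) g).comp (cone s) - prism f g n) := by
    apply tup_ext; intro v; simp [prism]
  exact LinearMap.congr_fun this c

lemma tmap_zero_eq {S S' : Type} (f g : S → S') : tmap 0 f = tmap 0 g := by
  apply tup_ext; intro v; simp only [tmap_single]; congr 1; funext i; exact i.elim0

lemma bd_prism {S S' : Type} (f g : S → S') (n : ℕ) (c : Tup S (n + 1)) :
    bd (n + 1) (prism f g (n + 1) c) + prism f g n (bd n c) = tmap (n + 1) g c - tmap (n + 1) f c := by
  have : (bd (n + 1)).comp (prism f g (n + 1)) + (prism f g n).comp (bd n)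
      = tmap (n + 1) g - tmap (n + 1) f := by
    clear c
    induction n with
    | zero =>
      apply tup_ext_cone; intro s v
      have h0 := LinearMap.congr_fun (tmap_zero_eq f g) (single v 1)
      simp only [LinearMap.add_apply, LinearMap.comp_apply, LinearMap.sub_apply]
      rw [prism_succ_cone, bd_succ_cone, map_sub, tmap_cone, bd_zero_cone]
      simp only [prism, LinearMap.zero_apply, sub_zero, map_zero, add_zero]
      rw [tmap_cone, h0]
    | succ n ih =>
      apply tup_ext_cone; intro s v
      have := LinearMap.congr_fun ih (single v 1)
      simp only [LinearMap.add_apply, LinearMap.comp_apply, LinearMap.sub_apply] at this ⊢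
      have h2 : bd (n + 1) (prism f g (n + 1) (single v 1)) =
        tmap (n + 1) g (single v 1) - tmap (n + 1) f (single v 1)
          - prism f g n (bd n (single v 1)) := by rw [← this]; abel
      rw [prism_succ_cone, bd_succ_cone, bd_succ_cone, map_sub (bd (n + 1)), map_sub (prism f g (n + 1)),
        h2, prism_succ_cone, bd_tmap, bd_succ_cone]
      simp only [map_sub, tmap_cone]
      abel
  exact LinearMap.congr_fun this c

lemma tmap_comp {S S' S'' : Type} (f : S → S') (g : S' → S'') (n : ℕ) (c : Tup S n) :
    tmap n g (tmap n f c) = tmap n (fun s => g (f s)) c := by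
  have : (tmap n g).comp (tmap n f) = tmap n (fun s => g (f s)) := by
    apply tup_ext; intro v; simp
  exact LinearMap.congr_fun this c

lemma prism_post {S S' S'' : Type} (f g : S → S') (k : S' → S'') (n : ℕ) (c : Tup S n) :
    prism (fun s => k (f s)) (fun s => k (g s)) n c = tmap (n + 1) k (prism f g n c) := by
  have : prism (fun s => k (f s)) (fun s => k (g s)) n = (tmap (n + 1) k).comp (prism f g n) := by
    clear c
    induction n with
    | zero => apply tup_ext; intro v; simp [prism]
    | succ n ih =>
      apply tup_ext_cone; intro s v
      rw [LinearMap.comp_apply, prism_succ_cone, prism_succ_cone, tmap_cone k, map_sub (tmap (n + 1) k), tmap_comp, ih]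
      rfl
  exact LinearMap.congr_fun this c

lemma prism_pre {S S' S'' : Type} (k : S → S') (f g : S' → S'') (n : ℕ) (c : Tup S n) :
    prism (fun s => f (k s)) (fun s => g (k s)) n c = prism f g n (tmap n k c) := by
  have : prism (fun s => f (k s)) (fun s => g (k s)) n = (prism f g n).comp (tmap n k) := by
    clear c
    induction n with
    | zero => apply tup_ext; intro v; simp [prism]
    | succ n ih =>
      apply tup_ext_cone; intro s v
      rw [LinearMap.comp_apply, prism_succ_cone, tmap_cone k, prism_succ_cone, ih, ← tmap_cone k, tmap_comp]
      rfl
  exact LinearMap.congr_fun this c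

/-- The recursive boundary is the alternating sum of the faces. -/
lemma bd_single_eq_sum {S : Type} (n : ℕ) (v : Fin (n + 1) → S) :
    bd n (single v 1) = ∑ i : Fin (n + 1), (-1 : ℤ) ^ (i : ℕ) • single (fun j => v (i.succAbove j)) 1 := by
  induction n with
  | zero =>
    simp [bd]
  | succ n ih =>
    rw [Fin.sum_univ_succ]
    have h := bd_succ_cone (v 0) (single (Fin.tail v) 1)
    rw [cone_single, cns_self_tail] at h
    rw [h, ih, map_sum, sub_eq_add_neg, ← Finset.sum_neg_distrib]
    congr 1
    · simp; rfl
    · refine Finset.sum_congr rfl fun i _ => ?_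
      rw [map_zsmul, cone_single]
      simp only [Fin.val_succ, pow_succ, mul_neg, mul_one, neg_smul]
      congr 3
      funext j
      refine Fin.cases ?_ (fun j => ?_) j <;> simp [Fin.tail]

end BDM

namespace BDM
open Finsupp

/-! ### Chains of a group with permutation coefficients -/

/-- Orbits of tuples with a point. -/
abbrev Orb (Γ X : Type) [Group Γ] [MulAction Γ X] (n : ℕ) : Type :=
  MulAction.orbitRel.Quotient Γ ((Fin n → Γ) × X)

/-- Augmented homogeneous chains with coefficients in a permutation module. -/
abbrev Ch (Γ X : Type) [Group Γ] [MulAction Γ X] (n : ℕ) : Type := Orb Γ X n →₀ ℤ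

section chains
variable {Γ X Y Z : Type} [Group Γ] [MulAction Γ X] [MulAction Γ Y] [MulAction Γ Z] {n : ℕ}

/-- Basis elements. -/
noncomputable def e (v : Fin n → Γ) (x : X) : Ch Γ X n :=
  single (Quotient.mk (MulAction.orbitRel Γ ((Fin n → Γ) × X)) (v, x)) 1

lemma e_smul (g : Γ) (v : Fin n → Γ) (x : X) : e (fun i => g * v i) (g • x) = e v x := by
  unfold e
  congr 1
  apply Quotient.sound
  exact ⟨g, rfl⟩

/-- Maps out of chains. -/
noncomputable def chLift {M : Type} [AddCommGroup M] (F : (Fin n → Γ) → X → M)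
    (h : ∀ (g : Γ) v x, F (fun i => g * v i) (g • x) = F v x) : Ch Γ X n →ₗ[ℤ] M :=
  Finsupp.linearCombination ℤ (fun o : Orb Γ X n => Quotient.lift (fun p => F p.1 p.2) (by
    rintro ⟨v, x⟩ ⟨w, y⟩ ⟨g, hg⟩
    obtain ⟨h1, h2⟩ := Prod.mk.inj hg
    simp only at h1 h2 ⊢
    rw [← h2, ← h1]
    exact h g w y) o)

@[simp] lemma chLift_e {M : Type} [AddCommGroup M] (F : (Fin n → Γ) → X → M)
    (h : ∀ (g : Γ) v x, F (fun i => g * v i) (g • x) = F v x) (v : Fin n → Γ) (x : X) :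
    chLift F h (e v x) = F v x := by
  simp [chLift, e]

lemma ch_ext {M : Type} [AddCommGroup M] {f g : Ch Γ X n →ₗ[ℤ] M}
    (h : ∀ v x, f (e v x) = g (e v x)) : f = g := by
  refine Finsupp.lhom_ext' fun o => LinearMap.ext_ring ?_
  induction o using Quotient.inductionOn with
  | h p => exact h p.1 p.2

/-- The bilinear pairing. -/
noncomputable def pr (n : ℕ) : Tup Γ n →ₗ[ℤ] (X →₀ ℤ) →ₗ[ℤ] Ch Γ X n :=
  Finsupp.linearCombination ℤ (fun v => Finsupp.linearCombination ℤ (fun x => e v x))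

@[simp] lemma pr_single (v : Fin n → Γ) (x : X) : pr n (single v 1) (single x 1) = e v x := by
  simp [pr]

lemma bilin_ext {S T M : Type} [AddCommGroup M] {f g : (S →₀ ℤ) →ₗ[ℤ] (T →₀ ℤ) →ₗ[ℤ] M}
    (h : ∀ s t, f (single s 1) (single t 1) = g (single s 1) (single t 1)) : f = g := by
  refine Finsupp.lhom_ext' fun s => LinearMap.ext_ring ?_
  refine Finsupp.lhom_ext' fun t => LinearMap.ext_ring ?_
  simpa using h s t

/-- The action on permutation modules. -/
noncomputable def act (g : Γ) : (X →₀ ℤ) →ₗ[ℤ] (X →₀ ℤ) := Finsupp.lmapDomain ℤ ℤ (fun x => g • x)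

@[simp] lemma act_single (g : Γ) (x : X) (a : ℤ) : act g (single x a) = single (g • x) a := by
  simp [act]

lemma act_mul (g h : Γ) (c : X →₀ ℤ) : act (g * h) c = act g (act h c) := by
  have : (act (g * h) : (X →₀ ℤ) →ₗ[ℤ] _) = (act g).comp (act h) := by
    refine Finsupp.lhom_ext' fun t => LinearMap.ext_ring ?_
    simp [mul_smul]
  exact LinearMap.congr_fun this c

@[simp] lemma act_one (c : X →₀ ℤ) : act (1 : Γ) c = c := by
  have : (act (1 : Γ) : (X →₀ ℤ) →ₗ[ℤ] _) = LinearMap.id := by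
    refine Finsupp.lhom_ext' fun t => LinearMap.ext_ring ?_
    simp
  exact LinearMap.congr_fun this c

lemma pr_act (g : Γ) (t : Tup Γ n) (c : X →₀ ℤ) :
    pr n (tmap n (fun s => g * s) t) (act g c) = pr n t c := by
  have : ((pr n).comp (tmap n (fun s => g * s))).compl₂ (act g) =
      (pr n : Tup Γ n →ₗ[ℤ] (X →₀ ℤ) →ₗ[ℤ] Ch Γ X n) := by
    apply bilin_ext; intro s t
    simp [e_smul]
  exact LinearMap.congr_fun (LinearMap.congr_fun this t) c

/-- The differential. -/
noncomputable def d (n : ℕ) : Ch Γ X (n + 1) →ₗ[ℤ] Ch Γ X n :=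
  chLift (fun v x => pr n (bd n (single v 1)) (single x 1)) (by
    intro g v x
    have := pr_act g (bd n (single v 1)) (single x 1)
    rw [← bd_tmap] at this
    simpa using this)

lemma d_pr (t : Tup Γ (n + 1)) (c : X →₀ ℤ) : d n (pr (n + 1) t c) = pr n (bd n t) c := by
  have : (pr (n + 1)).compr₂ (d n) =
      ((pr n).comp (bd n) : Tup Γ (n + 1) →ₗ[ℤ] (X →₀ ℤ) →ₗ[ℤ] Ch Γ X n) := by
    apply bilin_ext; intro s t
    simp [d]
  exact LinearMap.congr_fun (LinearMap.congr_fun this t) c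

lemma d_e (v : Fin (n + 1) → Γ) (x : X) : d n (e v x) = pr n (bd n (single v 1)) (single x 1) := by
  simp [d]

lemma ch_ext_pr {M : Type} [AddCommGroup M] {f g : Ch Γ X n →ₗ[ℤ] M}
    (h : ∀ t (x : X), f (pr n t (single x 1)) = g (pr n t (single x 1))) : f = g := by
  apply ch_ext; intro v x
  simpa using h (single v 1) x

lemma d_d (c : Ch Γ X (n + 2)) : d n (d (n + 1) c) = 0 := by
  have : (d n).comp (d (n + 1)) = (0 : Ch Γ X (n + 2) →ₗ[ℤ] Ch Γ X n) := by
    apply ch_ext_pr; intro t x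
    simp [d_pr, bd_bd]
  exact LinearMap.congr_fun this c

end chains

section maps
variable {Γ X Γ' X' Γ'' X'' : Type} [Group Γ] [MulAction Γ X] [Group Γ'] [MulAction Γ' X']
  [Group Γ''] [MulAction Γ'' X''] {n : ℕ}

/-- Compatibility of a pair of maps. -/
def Compat (f : X → Γ → Γ') (ρ : X → X') : Prop :=
  ∀ (g : Γ) (x : X), ∃ a : Γ', (∀ v, f (g • x) (g * v) = a * f x v) ∧ ρ (g • x) = a • ρ x

/-- The induced map on chains. -/
noncomputable def cmap (f : X → Γ → Γ') (ρ : X → X') (h : Compat f ρ) (n : ℕ) :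
    Ch Γ X n →ₗ[ℤ] Ch Γ' X' n :=
  chLift (fun v x => e (fun i => f x (v i)) (ρ x)) (by
    intro g v x
    obtain ⟨a, h1, h2⟩ := h g x
    simp only [h1, h2, e_smul])

lemma cmap_e (f : X → Γ → Γ') (ρ : X → X') (h : Compat f ρ) (v : Fin n → Γ) (x : X) :
    cmap f ρ h n (e v x) = e (fun i => f x (v i)) (ρ x) := by simp [cmap]

lemma cmap_pr (f : X → Γ → Γ') (ρ : X → X') (h : Compat f ρ) (t : Tup Γ n) (x : X) :
    cmap f ρ h n (pr n t (single x 1)) = pr n (tmap n (f x) t) (single (ρ x) 1) := by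
  have : (cmap f ρ h n).comp ((pr n).flip (single x 1)) =
      ((pr n).flip (single (ρ x) 1)).comp (tmap n (f x)) := by
    apply tup_ext; intro v
    simp [cmap_e]
  exact LinearMap.congr_fun this t

lemma d_cmap (f : X → Γ → Γ') (ρ : X → X') (h : Compat f ρ) (c : Ch Γ X (n + 1)) :
    d n (cmap f ρ h (n + 1) c) = cmap f ρ h n (d n c) := by
  have : (d n).comp (cmap f ρ h (n + 1)) = (cmap f ρ h n).comp (d n) := by
    apply ch_ext_pr; intro t x
    simp [d_pr, cmap_pr, bd_tmap]
  exact LinearMap.congr_fun this c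

lemma cmap_comp (f : X → Γ → Γ') (ρ : X → X') (h : Compat f ρ)
    (f' : X' → Γ' → Γ'') (ρ' : X' → X'') (h' : Compat f' ρ')
    (h'' : Compat (fun x v => f' (ρ x) (f x v)) (fun x => ρ' (ρ x))) (c : Ch Γ X n) :
    cmap f' ρ' h' n (cmap f ρ h n c) = cmap _ _ h'' n c := by
  have : (cmap f' ρ' h' n).comp (cmap f ρ h n) = cmap _ _ h'' n := by
    apply ch_ext; intro v x
    simp [cmap_e]
  exact LinearMap.congr_fun this c

lemma Compat.comp {f : X → Γ → Γ'} {ρ : X → X'} (h : Compat f ρ)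
    {f' : X' → Γ' → Γ''} {ρ' : X' → X''} (h' : Compat f' ρ') :
    Compat (fun x v => f' (ρ x) (f x v)) (fun x => ρ' (ρ x)) := by
  intro g x
  obtain ⟨a, h1, h2⟩ := h g x
  obtain ⟨b, h3, h4⟩ := h' a (ρ x)
  refine ⟨b, fun v => ?_, ?_⟩
  · simp only [h1, h2, h3]
  · simp only [h2, h4]

/-- Maps which are pointwise translates agree. -/
lemma cmap_congr {f f' : X → Γ → Γ'} {ρ ρ' : X → X'} (h : Compat f ρ) (h' : Compat f' ρ')
    (a : X → Γ') (hf : ∀ x v, f' x v = a x * f x v) (hρ : ∀ x, ρ' x = a x • ρ x) (c : Ch Γ X n) :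
    cmap f ρ h n c = cmap f' ρ' h' n c := by
  have : cmap f ρ h n = cmap f' ρ' h' n := by
    apply ch_ext; intro v x
    simp only [cmap_e, hf, hρ, e_smul]
  exact LinearMap.congr_fun this c

lemma cmap_id (h : Compat (fun (_ : X) (v : Γ) => v) (fun x : X => x)) (c : Ch Γ X n) :
    cmap _ _ h n c = c := by
  have : cmap _ _ h n = (LinearMap.id : Ch Γ X n →ₗ[ℤ] _) := by
    apply ch_ext; intro v x
    simp [cmap_e]
  exact LinearMap.congr_fun this c

/-- Joint compatibility. -/
def Compat2 (f f' : X → Γ → Γ') (ρ : X → X') : Prop :=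
  ∀ (g : Γ) (x : X), ∃ a : Γ', (∀ v, f (g • x) (g * v) = a * f x v) ∧
    (∀ v, f' (g • x) (g * v) = a * f' x v) ∧ ρ (g • x) = a • ρ x

/-- The homotopy. -/
noncomputable def hmt (f f' : X → Γ → Γ') (ρ : X → X') (h : Compat2 f f' ρ) (n : ℕ) :
    Ch Γ X n →ₗ[ℤ] Ch Γ' X' (n + 1) :=
  chLift (fun v x => pr (n + 1) (prism (f x) (f' x) n (single v 1)) (single (ρ x) 1)) (by
    intro g v x
    obtain ⟨a, h1, h2, h3⟩ := h g x
    have e1 := prism_pre (fun s => g * s) (f (g • x)) (f' (g • x)) n (single v 1)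
    simp only [tmap_single] at e1
    rw [← e1]
    simp only [h1, h2, h3]
    rw [prism_post (f x) (f' x) (fun s => a * s)]
    have := pr_act a (prism (f x) (f' x) n (single v 1)) (single (ρ x) 1)
    simpa using this)

lemma hmt_pr (f f' : X → Γ → Γ') (ρ : X → X') (h : Compat2 f f' ρ) (t : Tup Γ n) (x : X) :
    hmt f f' ρ h n (pr n t (single x 1)) =
      pr (n + 1) (prism (f x) (f' x) n t) (single (ρ x) 1) := by
  have : (hmt f f' ρ h n).comp ((pr n).flip (single x 1)) =
      ((pr (n + 1)).flip (single (ρ x) 1)).comp (prism (f x) (f' x) n) := by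
    apply tup_ext; intro v
    simp [hmt]
  exact LinearMap.congr_fun this t

lemma Compat2.left {f f' : X → Γ → Γ'} {ρ : X → X'} (h : Compat2 f f' ρ) : Compat f ρ := by
  intro g x
  obtain ⟨a, h1, h2, h3⟩ := h g x
  exact ⟨a, h1, h3⟩

lemma Compat2.right {f f' : X → Γ → Γ'} {ρ : X → X'} (h : Compat2 f f' ρ) : Compat f' ρ := by
  intro g x
  obtain ⟨a, h1, h2, h3⟩ := h g x
  exact ⟨a, h2, h3⟩

lemma d_hmt (f f' : X → Γ → Γ') (ρ : X → X') (h : Compat2 f f' ρ) (c : Ch Γ X (n + 1)) :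
    d (n + 1) (hmt f f' ρ h (n + 1) c) + hmt f f' ρ h n (d n c) =
      cmap f' ρ h.right (n + 1) c - cmap f ρ h.left (n + 1) c := by
  have : (d (n + 1)).comp (hmt f f' ρ h (n + 1)) + (hmt f f' ρ h n).comp (d n) =
      cmap f' ρ h.right (n + 1) - cmap f ρ h.left (n + 1) := by
    apply ch_ext_pr; intro t x
    simp only [LinearMap.add_apply, LinearMap.comp_apply, LinearMap.sub_apply, hmt_pr, d_pr,
      cmap_pr]
    rw [← LinearMap.add_apply, ← map_add, bd_prism]
    simp
  exact LinearMap.congr_fun this c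

/-- Homotopic maps agree on cycles up to boundaries. -/
lemma hmt_cycle (f f' : X → Γ → Γ') (ρ : X → X') (h : Compat2 f f' ρ) (c : Ch Γ X (n + 1))
    (hc : d n c = 0) (h1 : Compat f ρ) (h2 : Compat f' ρ) :
    ∃ b, d (n + 1) b = cmap f' ρ h2 (n + 1) c - cmap f ρ h1 (n + 1) c :=
  ⟨hmt f f' ρ h (n + 1) c, by rw [← d_hmt f f' ρ h c, hc]; simp⟩

end maps

section lam
variable {Γ X Y Z : Type} [Group Γ] [MulAction Γ X] [MulAction Γ Y] [MulAction Γ Z] {n : ℕ}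

variable (Γ) in
/-- Equivariant linear maps of permutation modules. -/
def Eqv (L : (X →₀ ℤ) →ₗ[ℤ] (Y →₀ ℤ)) : Prop := ∀ (g : Γ) c, L (act g c) = act g (L c)

lemma eqv_of_single {L : (X →₀ ℤ) →ₗ[ℤ] (Y →₀ ℤ)}
    (h : ∀ (g : Γ) x, L (single (g • x) 1) = act g (L (single x 1))) : Eqv Γ L := by
  intro g c
  have : L.comp (act g) = (act g).comp L := by
    refine Finsupp.lhom_ext' fun t => LinearMap.ext_ring ?_
    simpa using h g t
  exact LinearMap.congr_fun this c

/-- Change of coefficients. -/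
noncomputable def lam (L : (X →₀ ℤ) →ₗ[ℤ] (Y →₀ ℤ)) (hL : Eqv Γ L) (n : ℕ) :
    Ch Γ X n →ₗ[ℤ] Ch Γ Y n :=
  chLift (fun v x => pr n (single v 1) (L (single x 1))) (by
    intro g v x
    have h1 := hL g (single x 1)
    rw [act_single] at h1
    have := pr_act g (single v 1) (L (single x 1))
    rw [h1]
    simpa using this)

lemma lam_pr (L : (X →₀ ℤ) →ₗ[ℤ] (Y →₀ ℤ)) (hL : Eqv Γ L) (t : Tup Γ n) (c : X →₀ ℤ) :
    lam L hL n (pr n t c) = pr n t (L c) := by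
  have : (pr n).compr₂ (lam L hL n) = (pr n : Tup Γ n →ₗ[ℤ] _).compl₂ L := by
    apply bilin_ext; intro s t
    simp [lam]
  exact LinearMap.congr_fun (LinearMap.congr_fun this t) c

lemma d_lam (L : (X →₀ ℤ) →ₗ[ℤ] (Y →₀ ℤ)) (hL : Eqv Γ L) (c : Ch Γ X (n + 1)) :
    d n (lam L hL (n + 1) c) = lam L hL n (d n c) := by
  have : (d n).comp (lam L hL (n + 1)) = (lam L hL n).comp (d n) := by
    apply ch_ext_pr; intro t x
    simp [lam_pr, d_pr]
  exact LinearMap.congr_fun this c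

lemma lam_comp (L : (X →₀ ℤ) →ₗ[ℤ] (Y →₀ ℤ)) (hL : Eqv Γ L) (L' : (Y →₀ ℤ) →ₗ[ℤ] (Z →₀ ℤ))
    (hL' : Eqv Γ L') (L'' : (X →₀ ℤ) →ₗ[ℤ] (Z →₀ ℤ)) (hL'' : Eqv Γ L'')
    (h : ∀ c, L' (L c) = L'' c) (c : Ch Γ X n) :
    lam L' hL' n (lam L hL n c) = lam L'' hL'' n c := by
  have : (lam L' hL' n).comp (lam L hL n) = lam L'' hL'' n := by
    apply ch_ext_pr; intro t x
    simp [lam_pr, h]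
  exact LinearMap.congr_fun this c

lemma lam_add (L L' L'' : (X →₀ ℤ) →ₗ[ℤ] (Y →₀ ℤ)) (hL : Eqv Γ L)
    (hL' : Eqv Γ L') (hL'' : Eqv Γ L'')
    (h : ∀ c, L'' c = L c + L' c) (c : Ch Γ X n) :
    lam L'' hL'' n c = lam L hL n c + lam L' hL' n c := by
  have : lam L'' hL'' n = lam L hL n + lam L' hL' n := by
    apply ch_ext_pr; intro t x
    simp [lam_pr, h]
  exact LinearMap.congr_fun this c

lemma lam_id (L : (X →₀ ℤ) →ₗ[ℤ] (X →₀ ℤ)) (hL : Eqv Γ L) (h : ∀ c, L c = c) (c : Ch Γ X n) :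
    lam L hL n c = c := by
  have : lam L hL n = LinearMap.id := by
    apply ch_ext_pr; intro t x
    simp [lam_pr, h]
  exact LinearMap.congr_fun this c

lemma lam_zero (L : (X →₀ ℤ) →ₗ[ℤ] (Y →₀ ℤ)) (hL : Eqv Γ L) (h : ∀ c, L c = 0) (c : Ch Γ X n) :
    lam L hL n c = 0 := by
  have : lam L hL n = 0 := by
    apply ch_ext_pr; intro t x
    simp [lam_pr, h]
  exact LinearMap.congr_fun this c

/-- Normal form of chains in positive levels. -/
noncomputable def toK (n : ℕ) : Ch Γ X (n + 1) →ₗ[ℤ] ((Fin n → Γ) →₀ (X →₀ ℤ)) :=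
  chLift (fun v x => single (fun i => (v 0)⁻¹ * v i.succ) (single ((v 0)⁻¹ • x) 1)) (by
    intro g v x
    simp only [mul_inv_rev, smul_smul, mul_assoc, inv_mul_cancel_left,
      inv_mul_cancel, mul_one])

/-- Inverse of the normal form. -/
noncomputable def fromK (n : ℕ) : ((Fin n → Γ) →₀ (X →₀ ℤ)) →ₗ[ℤ] Ch Γ X (n + 1) :=
  Finsupp.lsum ℤ (fun w => pr (n + 1) (single (cns 1 w) 1))

lemma fromK_single (w : Fin n → Γ) (c : X →₀ ℤ) :
    fromK n (single w c) = pr (n + 1) (single (cns 1 w) 1) c := by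
  simp [fromK]

lemma fromK_toK (c : Ch Γ X (n + 1)) : fromK n (toK n c) = c := by
  have : (fromK n).comp (toK n) = (LinearMap.id : Ch Γ X (n + 1) →ₗ[ℤ] _) := by
    apply ch_ext; intro v x
    simp only [LinearMap.comp_apply, toK, chLift_e, fromK_single, pr_single, LinearMap.id_apply]
    rw [← e_smul (v 0)]
    congr 1
    · funext i
      refine Fin.cases ?_ (fun i => ?_) i <;> simp
    · simp
  exact LinearMap.congr_fun this c

lemma toK_pr (w : Fin n → Γ) (c : X →₀ ℤ) :
    toK n (pr (n + 1) (single (cns 1 w) 1) c) = single w c := by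
  have : (toK n).comp (pr (n + 1) (single (cns 1 w) 1)) =
      (Finsupp.lsingle w : (X →₀ ℤ) →ₗ[ℤ] _) := by
    refine Finsupp.lhom_ext' fun t => LinearMap.ext_ring ?_
    simp [toK]
  exact LinearMap.congr_fun this c

lemma toK_fromK (c : (Fin n → Γ) →₀ (X →₀ ℤ)) : toK n (fromK n c) = c := by
  have : (toK n).comp (fromK n) = LinearMap.id (R := ℤ) (M := (Fin n → Γ) →₀ (X →₀ ℤ)) := by
    refine Finsupp.lhom_ext' fun t => ?_
    apply LinearMap.ext; intro c
    simp [fromK_single, toK_pr]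
  exact LinearMap.congr_fun this c

lemma toK_lam (L : (X →₀ ℤ) →ₗ[ℤ] (Y →₀ ℤ)) (hL : Eqv Γ L) (c : Ch Γ X (n + 1)) :
    toK n (lam L hL (n + 1) c) = Finsupp.mapRange.linearMap L (toK n c) := by
  obtain ⟨c, rfl⟩ : ∃ k, c = fromK n k := ⟨toK n c, (fromK_toK c).symm⟩
  rw [toK_fromK]
  have : ((toK n).comp (lam L hL (n + 1))).comp (fromK n) = Finsupp.mapRange.linearMap L := by
    refine Finsupp.lhom_ext' fun t => ?_
    apply LinearMap.ext; intro c
    simp [fromK_single, toK_pr, lam_pr]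
  exact LinearMap.congr_fun this c

/-- Exactness in the coefficients in positive levels. -/
lemma lam_exact (L : (X →₀ ℤ) →ₗ[ℤ] (Y →₀ ℤ)) (hL : Eqv Γ L) (L' : (Y →₀ ℤ) →ₗ[ℤ] (Z →₀ ℤ))
    (hL' : Eqv Γ L') (h : ∀ y, L' y = 0 → ∃ x, L x = y) (c : Ch Γ Y (n + 1))
    (hc : lam L' hL' (n + 1) c = 0) : ∃ b, lam L hL (n + 1) b = c := by
  have h1 := toK_lam L' hL' c
  rw [hc, map_zero] at h1
  have h2 : ∀ w, ∃ x, L x = toK n c w := fun w => h _ (by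
    have := DFunLike.congr_fun h1 w
    simpa using this.symm)
  choose x hx using h2
  refine ⟨∑ w ∈ (toK n c).support, fromK n (single w (x w)), ?_⟩
  rw [map_sum]
  simp only [fromK_single, lam_pr, hx]
  rw [← fromK_toK c]
  conv_rhs => rw [← Finsupp.sum_single (toK n c), Finsupp.sum, map_sum]
  simp only [fromK_single, fromK_toK]

lemma lam_inj (L : (X →₀ ℤ) →ₗ[ℤ] (Y →₀ ℤ)) (hL : Eqv Γ L) (h : ∀ y, L y = 0 → y = 0)
    (c : Ch Γ X (n + 1)) (hc : lam L hL (n + 1) c = 0) : c = 0 := by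
  have h1 := toK_lam L hL c
  rw [hc, map_zero] at h1
  rw [← fromK_toK c]
  have : toK n c = 0 := by
    ext1 w
    apply h
    have := DFunLike.congr_fun h1 w
    simpa using this.symm
  rw [this, map_zero]

lemma lam_surj (L : (X →₀ ℤ) →ₗ[ℤ] (Y →₀ ℤ)) (hL : Eqv Γ L) (h : ∀ y, ∃ x, L x = y)
    (c : Ch Γ Y (n + 1)) : ∃ b, lam L hL (n + 1) b = c :=
  lam_exact L hL (0 : (Y →₀ ℤ) →ₗ[ℤ] (Y →₀ ℤ)) (fun g c => by simp) (fun y _ => h y) c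
    (lam_zero _ _ (fun _ => rfl) _)

end lam

end BDM

namespace BDM
open Finsupp

section group
variable {G H K : Type} [Group G] [Group H] [Group K] {n : ℕ}

/-- Boundaries. -/
def IsB {Γ X : Type} [Group Γ] [MulAction Γ X] {n : ℕ} (z : Ch Γ X n) : Prop := ∃ b, d n b = z

section isB
variable {Γ X Γ' X' Y : Type} [Group Γ] [MulAction Γ X] [Group Γ'] [MulAction Γ' X'] [MulAction Γ Y]

lemma IsB.add {z w : Ch Γ X n} (hz : IsB z) (hw : IsB w) : IsB (z + w) := by
  obtain ⟨a, rfl⟩ := hz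
  obtain ⟨b, rfl⟩ := hw
  exact ⟨a + b, map_add _ _ _⟩

lemma IsB.neg {z : Ch Γ X n} (hz : IsB z) : IsB (-z) := by
  obtain ⟨a, rfl⟩ := hz
  exact ⟨-a, map_neg _ _⟩

lemma IsB.sub {z w : Ch Γ X n} (hz : IsB z) (hw : IsB w) : IsB (z - w) := by
  rw [sub_eq_add_neg]; exact hz.add hw.neg

lemma isB_zero : IsB (0 : Ch Γ X n) := ⟨0, map_zero _⟩

lemma IsB.of_sub {z w : Ch Γ X n} (hz : IsB (z - w)) (hw : IsB w) : IsB z := by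
  have := hz.add hw
  simpa using this

lemma IsB.of_sub_right {z w : Ch Γ X n} (hz : IsB (z - w)) (hw : IsB z) : IsB w := by
  have := hw.sub hz
  simpa using this

lemma IsB.trans {x y z : Ch Γ X n} (h1 : IsB (x - y)) (h2 : IsB (y - z)) : IsB (x - z) := by
  have := h1.add h2
  simpa using this

lemma IsB.symm {x y : Ch Γ X n} (h1 : IsB (x - y)) : IsB (y - x) := by
  have := h1.neg
  simpa using this

lemma IsB.d_eq {z : Ch Γ X (n + 1)} (hz : IsB z) : d n z = 0 := by
  obtain ⟨a, rfl⟩ := hz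
  exact d_d a

lemma IsB.cmap {z : Ch Γ X n} (hz : IsB z) (f : X → Γ → Γ') (ρ : X → X') (h : Compat f ρ) :
    IsB (cmap f ρ h n z) := by
  obtain ⟨a, rfl⟩ := hz
  exact ⟨_, d_cmap f ρ h a⟩

lemma IsB.lam {z : Ch Γ X n} (hz : IsB z) (L : (X →₀ ℤ) →ₗ[ℤ] (Y →₀ ℤ)) (h : Eqv Γ L) :
    IsB (lam L h n z) := by
  obtain ⟨a, rfl⟩ := hz
  exact ⟨_, d_lam L h a⟩

lemma isB_sum {ι : Type} (s : Finset ι) (f : ι → Ch Γ X n) (h : ∀ i ∈ s, IsB (f i)) :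
    IsB (∑ i ∈ s, f i) := by
  classical
  induction s using Finset.induction_on with
  | empty => simpa using isB_zero
  | insert a s ha ih =>
    rw [Finset.sum_insert ha]
    exact (h a (by simp)).add (ih fun i hi => h i (by simp [hi]))

end isB

lemma gcompat (φ : G →* H) : Compat (fun (_ : Unit) (v : G) => φ v) (fun _ : Unit => ()) :=
  fun g _ => ⟨φ g, fun v => map_mul φ g v, rfl⟩

/-- Functoriality in the group. -/
noncomputable def gmap (φ : G →* H) (n : ℕ) : Ch G Unit n →ₗ[ℤ] Ch H Unit n :=
  cmap _ _ (gcompat φ) n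

lemma gmap_e (φ : G →* H) (v : Fin n → G) (x : Unit) :
    gmap φ n (e v x) = e (fun i => φ (v i)) () := cmap_e _ _ _ _ _

lemma d_gmap (φ : G →* H) (c : Ch G Unit (n + 1)) : d n (gmap φ (n + 1) c) = gmap φ n (d n c) :=
  d_cmap _ _ _ _

lemma IsB.gmap {z : Ch G Unit n} (hz : IsB z) (φ : G →* H) : IsB (gmap φ n z) := hz.cmap _ _ _

lemma gmap_gmap (φ : G →* H) (ψ : H →* K) (χ : G →* K) (h : ∀ g, ψ (φ g) = χ g)
    (c : Ch G Unit n) : gmap ψ n (gmap φ n c) = gmap χ n c := by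
  have : (gmap ψ n).comp (gmap φ n) = gmap χ n := by
    apply ch_ext; intro v x
    simp [gmap_e, h]
  exact LinearMap.congr_fun this c

lemma gmap_id (φ : G →* G) (h : ∀ g, φ g = g) (c : Ch G Unit n) : gmap φ n c = c := by
  have : gmap φ n = LinearMap.id := by
    apply ch_ext; intro v x
    simp [gmap_e, h]
  exact LinearMap.congr_fun this c

lemma gmap_congr (φ ψ : G →* H) (h : ∀ g, φ g = ψ g) (c : Ch G Unit n) :
    gmap φ n c = gmap ψ n c := by
  rw [MonoidHom.ext h]

/-- Conjugate homomorphisms agree in homology. -/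
lemma gmap_conj (φ ψ : G →* H) (t : H) (h : ∀ g, ψ g = t * φ g * t⁻¹) (c : Ch G Unit (n + 1))
    (hc : d n c = 0) : IsB (gmap ψ (n + 1) c - gmap φ (n + 1) c) := by
  have h2 : Compat2 (fun (_ : Unit) (v : G) => φ v) (fun _ v => φ v * t⁻¹) (fun _ : Unit => ()) :=
    fun g _ => ⟨φ g, fun v => map_mul φ g v, fun v => by simp [mul_assoc], rfl⟩
  obtain ⟨b, hb⟩ := hmt_cycle _ _ _ h2 c hc (gcompat φ) h2.right
  refine ⟨b, ?_⟩
  rw [hb, cmap_congr h2.right (gcompat ψ) (fun _ => t) (fun _ v => by simp [h, mul_assoc])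
    (fun _ => rfl)]
  rfl

/-! Shapiro -/

lemma shp_compat (A : Subgroup G) :
    Compat (fun (_ : Unit) (a : A) => (a : G)) (fun _ : Unit => ((1 : G) : G ⧸ A)) := by
  intro g x
  refine ⟨g, fun v => rfl, ?_⟩
  change _ = ((g * 1 : G) : G ⧸ A)
  rw [QuotientGroup.eq]
  simp

/-- The Shapiro map. -/
noncomputable def shp (A : Subgroup G) (n : ℕ) : Ch A Unit n →ₗ[ℤ] Ch G (G ⧸ A) n :=
  cmap _ _ (shp_compat A) n

lemma shp_e (A : Subgroup G) (v : Fin n → A) (x : Unit) :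
    shp A n (e v x) = e (fun i => (v i : G)) ((1 : G) : G ⧸ A) := cmap_e _ _ _ _ _

lemma d_shp (A : Subgroup G) (c : Ch A Unit (n + 1)) : d n (shp A (n + 1) c) = shp A n (d n c) :=
  d_cmap _ _ _ _

lemma exists_section (A : Subgroup G) : ∃ s : G ⧸ A → G, (∀ x, (s x : G ⧸ A) = x) ∧
    s ((1 : G) : G ⧸ A) = 1 := by
  classical
  refine ⟨fun x => if x = ((1 : G) : G ⧸ A) then 1 else Quotient.out x, fun x => ?_, by simp⟩
  by_cases h : x = ((1 : G) : G ⧸ A)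
  · simp [h]
  · simp only [h, if_false]
    exact Quotient.out_eq x

/-- The Shapiro map has a homotopy inverse. -/
lemma exists_unshp (A : Subgroup G) : ∃ u : ∀ n, Ch G (G ⧸ A) n →ₗ[ℤ] Ch A Unit n,
    (∀ n c, d n (u (n + 1) c) = u n (d n c)) ∧ (∀ n c, u n (shp A n c) = c) ∧
    (∀ n (c : Ch G (G ⧸ A) (n + 1)), d n c = 0 → IsB (c - shp A (n + 1) (u (n + 1) c))) := by
  obtain ⟨s, hs, hs1⟩ := exists_section A
  have hsm : ∀ (g : G) (x : G ⧸ A), (s (g • x))⁻¹ * (g * s x) ∈ A := by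
    intro g x
    rw [← QuotientGroup.eq, hs]
    change _ = g • (s x : G ⧸ A)
    rw [hs]
  have hm : ∀ (x : G ⧸ A) (v : G), (s x)⁻¹ * (v * s (v⁻¹ • x)) ∈ A := by
    intro x v
    have := hsm v (v⁻¹ • x)
    rwa [smul_inv_smul] at this
  have hF : Compat (fun (x : G ⧸ A) (v : G) => (⟨_, hm x v⟩ : A)) (fun _ => ()) := by
    intro g x
    refine ⟨⟨_, hsm g x⟩, fun v => ?_, rfl⟩
    apply Subtype.ext
    simp [mul_smul, mul_assoc]
  refine ⟨fun n => cmap _ _ hF n, fun n c => d_cmap _ _ _ _, fun n c => ?_, fun n c hc => ?_⟩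
  · rw [shp, cmap_comp _ _ _ _ _ _ ((shp_compat A).comp hF)]
    have : ∀ a : A, (a : G)⁻¹ • ((1 : G) : G ⧸ A) = ((1 : G) : G ⧸ A) := by
      intro a
      change (((a : G)⁻¹ * 1 : G) : G ⧸ A) = _
      rw [QuotientGroup.eq]; simp
    have hid : Compat (fun (_ : Unit) (a : A) => a) (fun _ : Unit => ()) :=
      fun g _ => ⟨g, fun _ => rfl, rfl⟩
    refine Eq.trans ?_ (cmap_id hid c)
    symm
    have hx : ∀ (x : Unit) (v : A), (⟨_, hm ((1 : G) : G ⧸ A) (v : G)⟩ : A) = 1 * v := by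
      intro x v
      apply Subtype.ext
      simp [this, hs1]
    exact cmap_congr hid ((shp_compat A).comp hF) (fun _ => 1) hx (fun _ => rfl) _
  · have h2 : Compat2 (fun (x : G ⧸ A) (v : G) => v * s (v⁻¹ • x)) (fun _ v => v) (fun x => x) := by
      intro g x
      exact ⟨g, fun v => by simp [mul_smul, mul_assoc], fun v => rfl, rfl⟩
    obtain ⟨b, hb⟩ := hmt_cycle _ _ _ h2 c hc h2.left h2.right
    refine ⟨b, ?_⟩
    have h3 : cmap _ _ h2.left (n + 1) c = cmap _ _ (hF.comp (shp_compat A)) (n + 1) c := by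
      symm
      refine cmap_congr (hF.comp (shp_compat A)) h2.left (fun x => s x) (fun x v => ?_)
        (fun x => ?_) _
      · simp
      · change x = (((s x) * 1 : G) : G ⧸ A)
        rw [mul_one, hs]
    rw [hb, cmap_id, shp, cmap_comp _ _ _ _ _ _ (hF.comp (shp_compat A)), h3]

lemma shp_inj (A : Subgroup G) (z : Ch A Unit n) (h : IsB (shp A n z)) : IsB z := by
  obtain ⟨u, h1, h2, h3⟩ := exists_unshp A
  obtain ⟨b, hb⟩ := h
  exact ⟨u _ b, by rw [h1, hb, h2]⟩

lemma shp_surj (A : Subgroup G) (w : Ch G (G ⧸ A) (n + 1)) (h : d n w = 0) :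
    ∃ z : Ch A Unit (n + 1), d n z = 0 ∧ IsB (w - shp A (n + 1) z) := by
  obtain ⟨u, h1, h2, h3⟩ := exists_unshp A
  exact ⟨u _ w, by rw [h1, h, map_zero], h3 n w h⟩

/-! Injective homomorphisms and directed unions -/

lemma gmap_inj (φ : G →* H) (hφ : Function.Injective φ) (c : Ch G Unit (n + 1))
    (hc : gmap φ (n + 1) c = 0) : c = 0 := by
  classical
  let F : (Fin (n + 1) → H) → Unit → Ch G Unit (n + 1) := fun v _ =>
    if h : ∃ w : Fin (n + 1) → G, ∀ i, φ (w i) = (v 0)⁻¹ * v i then e h.choose () else 0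
  have hF : ∀ (g : H) v x, F (fun i => g * v i) (g • x) = F v x := by
    intro g v x
    have : ∀ i, (g * v 0)⁻¹ * (g * v i) = (v 0)⁻¹ * v i := fun i => by simp [mul_assoc]
    simp only [F, this]
  have : (chLift F hF).comp (gmap φ (n + 1)) = LinearMap.id := by
    apply ch_ext; intro v x
    have hex : ∃ w : Fin (n + 1) → G, ∀ i, φ (w i) = (φ (v 0))⁻¹ * φ (v i) :=
      ⟨fun i => (v 0)⁻¹ * v i, fun i => by simp⟩
    simp only [LinearMap.comp_apply, gmap_e, chLift_e, F, LinearMap.id_apply]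
    rw [dif_pos hex]
    have h2 : hex.choose = fun i => (v 0)⁻¹ * v i := by
      funext i
      apply hφ
      rw [hex.choose_spec i]; simp
    rw [h2]
    exact e_smul (v 0)⁻¹ v ()
  have h2 := LinearMap.congr_fun this c
  simp only [LinearMap.comp_apply, hc, map_zero, LinearMap.id_apply] at h2
  exact h2.symm

lemma gmap_lift {ι : Type} (A : ι → Type) [∀ i, Group (A i)] (φ : ∀ i, A i →* G)
    (h : ∀ s : Finset G, ∃ i, ∀ g ∈ s, g ∈ (φ i).range) (c : Ch G Unit n) :
    ∃ i c', gmap (φ i) n c' = c := by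
  classical
  have hr : ∀ o : Orb G Unit n, ∃ v : Fin n → G, single o 1 = e v () := by
    intro o
    induction o using Quotient.inductionOn with
    | h p => exact ⟨p.1, rfl⟩
  choose v hv using hr
  obtain ⟨i, hi⟩ := h (c.support.biUnion fun o => Finset.univ.image (v o))
  have h1 : ∀ o ∈ c.support, ∃ w : Ch (A i) Unit n, gmap (φ i) n w = single o 1 := by
    intro o ho
    have : ∀ j, ∃ a, φ i a = v o j := fun j => hi _ (by
      simp only [Finset.mem_biUnion, Finset.mem_image, Finset.mem_univ, true_and]
      exact ⟨o, ho, j, rfl⟩)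
    choose a ha using this
    exact ⟨e a (), by simp [gmap_e, ha, hv]⟩
  have : c ∈ LinearMap.range (gmap (φ i) n) := by
    rw [← Finsupp.sum_single c]
    refine Submodule.sum_mem _ fun o ho => ?_
    obtain ⟨w, hw⟩ := h1 o ho
    refine ⟨c o • w, ?_⟩
    rw [map_zsmul, hw]; simp
  exact ⟨i, this⟩

/-! First homology -/

/-- The map to the abelianization. -/
noncomputable def abm : Ch G Unit 2 →ₗ[ℤ] Additive (Abelianization G) :=
  chLift (fun v _ => Additive.ofMul (Abelianization.of ((v 0)⁻¹ * v 1))) (by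
    intro g v x
    simp [mul_assoc])

lemma abm_e (v : Fin 2 → G) (x : Unit) :
    abm (e v x) = Additive.ofMul (Abelianization.of ((v 0)⁻¹ * v 1)) := by simp [abm]

lemma bd_one {G : Type} (a b : G) : bd 1 (single ![a, b] 1) = single ![b] 1 - single ![a] (1 : ℤ) := by
  rw [bd_single_eq_sum, Fin.sum_univ_two]
  simp only [Fin.val_zero, pow_zero, one_smul, Fin.val_one, pow_one, neg_smul, ← sub_eq_add_neg]
  congr 2 <;> (funext i; fin_cases i; rfl)

lemma bd_two {G : Type} (a b c : G) : bd 2 (single ![a, b, c] 1) =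
    single ![b, c] 1 - single ![a, c] (1 : ℤ) + single ![a, b] 1 := by
  rw [bd_single_eq_sum, Fin.sum_univ_three]
  have h2 : ((2 : Fin 3) : ℕ) = 2 := rfl
  simp only [Fin.val_zero, pow_zero, one_smul, Fin.val_one, pow_one, neg_smul, ← sub_eq_add_neg, h2,
    neg_one_sq]
  congr 2
  · congr 2 <;> (funext i; fin_cases i <;> rfl)
  · funext i; fin_cases i <;> rfl

lemma d_one_eq (c : Ch G Unit 2) : d 1 c = 0 := by
  have : d 1 = (0 : Ch G Unit 2 →ₗ[ℤ] _) := by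
    apply ch_ext; intro v x
    have hv : v = ![v 0, v 1] := by funext i; fin_cases i <;> rfl
    rw [hv, d_e, bd_one]
    simp only [map_sub, LinearMap.sub_apply, pr_single, LinearMap.zero_apply]
    rw [sub_eq_zero, ← e_smul (v 1 * (v 0)⁻¹) ![v 0]]
    congr 1
    funext i; fin_cases i; simp
  exact LinearMap.congr_fun this c

lemma abm_d (c : Ch G Unit 3) : abm (d 2 c) = 0 := by
  have : abm.comp (d 2) = (0 : Ch G Unit 3 →ₗ[ℤ] _) := by
    apply ch_ext; intro v x
    have hv : v = ![v 0, v 1, v 2] := by funext i; fin_cases i <;> rfl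
    rw [hv, LinearMap.comp_apply, d_e, bd_two]
    simp only [map_sub, map_add, LinearMap.add_apply, LinearMap.sub_apply, pr_single,
      LinearMap.zero_apply, abm_e]
    simp only [← ofMul_mul, ← ofMul_div, ← map_mul, ← map_div]
    rw [ofMul_eq_zero]
    simp
  exact LinearMap.congr_fun this c

lemma abm_inj (c : Ch G Unit 2) (hc : abm c = 0) : IsB c := by
  let Q := Ch G Unit 2 ⧸ LinearMap.range (d (Γ := G) (X := Unit) 2)
  have hrel : ∀ a b c : G, (Submodule.Quotient.mk (e ![a, c] ()) : Q) =
      Submodule.Quotient.mk (e ![a, b] ()) + Submodule.Quotient.mk (e ![b, c] ()) := by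
    intro a b c
    rw [← Submodule.Quotient.mk_add, eq_comm, Submodule.Quotient.eq]
    refine ⟨e ![a, b, c] (), ?_⟩
    rw [d_e, bd_two]
    simp
    abel
  have htr : ∀ a b c : G, (e ![a * b, a * c] () : Ch G Unit 2) = e ![b, c] () := by
    intro a b c
    rw [← e_smul a ![b, c]]
    congr 1
    funext i; fin_cases i <;> rfl
  let θ : G →* Multiplicative Q := MonoidHom.mk' (fun g =>
    Multiplicative.ofAdd (Submodule.Quotient.mk (e ![1, g] ()))) (by
    intro a b
    rw [← ofAdd_add]
    congr 1
    rw [hrel 1 a (a * b)]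
    congr 2
    have := htr a 1 b
    rw [mul_one] at this
    exact this)
  have key : (MonoidHom.toAdditiveLeft (Abelianization.lift θ)).toIntLinearMap.comp abm =
      Submodule.mkQ _ := by
    apply ch_ext; intro v x
    have hv : v = ![v 0, v 1] := by funext i; fin_cases i <;> rfl
    have := htr (v 0)⁻¹ (v 0) (v 1)
    rw [hv, ← this, inv_mul_cancel]
    rw [LinearMap.comp_apply, abm_e]
    simp only [Matrix.cons_val_zero, Matrix.cons_val_one, inv_one, one_mul]
    change Multiplicative.toAdd (Abelianization.lift θ (Abelianization.of ((v 0)⁻¹ * v 1))) = _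
    rw [Abelianization.lift_apply_of]
    rfl
  have := LinearMap.congr_fun key c
  rw [LinearMap.comp_apply, hc, map_zero] at this
  have h2 := (Submodule.Quotient.mk_eq_zero _).1 this.symm
  exact h2

lemma abm_gmap (φ : G →* H) (c : Ch G Unit 2) :
    abm (gmap φ 2 c) = (MonoidHom.toAdditive (Abelianization.map φ)) (abm c) := by
  have : abm.comp (gmap φ 2) =
      (MonoidHom.toAdditive (Abelianization.map φ)).toIntLinearMap.comp abm := by
    apply ch_ext; intro v x
    simp [gmap_e, abm_e]
  exact LinearMap.congr_fun this c

end group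

end BDM

namespace BDM
open Finsupp

/-! ### A weak Künneth theorem -/

/-- Tuples with action of a product through the second factor. -/
def TX (_ H : Type) (p : ℕ) : Type := Fin p → H

instance (G H : Type) [Group G] [Group H] (p : ℕ) : MulAction (G × H) (TX G H p) where
  smul γ x := fun i => γ.2 * x i
  one_smul x := funext fun i => one_mul (x i)
  mul_smul a b x := funext fun i => mul_assoc a.2 b.2 (x i)

/-- Trivial action. -/
def Triv (O : Type) : Type := O

instance (G O : Type) [Group G] : MulAction G (Triv O) where
  smul _ x := x
  one_smul _ := rfl
  mul_smul _ _ _ := rfl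

/-- Introduce the type synonym. -/
def toTriv {O : Type} (o : O) : Triv O := o

lemma triv_smul {G O : Type} [Group G] (g : G) (x : Triv O) : g • x = x := rfl

lemma d_zero_surj {Γ X : Type} [Group Γ] [MulAction Γ X] (c : Ch Γ X 0) : IsB c := by
  have : c ∈ LinearMap.range (d (Γ := Γ) (X := X) 0) := by
    rw [← Finsupp.sum_single c]
    refine Submodule.sum_mem _ fun o _ => ?_
    have : (single o (c o) : Ch Γ X 0) = c o • single o 1 := by simp
    rw [this]
    refine Submodule.smul_mem _ _ ?_
    induction o using Quotient.inductionOn with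
    | h p =>
      refine ⟨e (fun _ => 1) p.2, ?_⟩
      rw [d_e]
      simp only [bd, linearCombination_single, one_smul, pr_single]
      rw [e]
      congr 2
      exact Prod.ext (Subsingleton.elim _ _) rfl
  exact this

lemma d_zero_inj_triv {G O : Type} [Group G] (c : Ch G (Triv O) 1) (hc : d 0 c = 0) : c = 0 := by
  let s : Ch G (Triv O) 0 →ₗ[ℤ] Ch G (Triv O) 1 :=
    chLift (fun _ x => e (fun _ => 1) x) (fun g v x => by simp only [triv_smul])
  have : s.comp (d 0) = LinearMap.id := by
    apply ch_ext; intro w x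
    rw [LinearMap.comp_apply, d_e]
    simp only [bd, linearCombination_single, one_smul, pr_single, s, chLift_e, LinearMap.id_apply]
    rw [← e_smul (w 0)]
    congr 1
    funext i
    rw [Subsingleton.elim i 0]; simp
  have := LinearMap.congr_fun this c
  rw [LinearMap.comp_apply, hc, map_zero] at this
  exact this.symm

/-- Partial contraction of the chains of a group which is acyclic up to some level. -/
lemma exists_contraction {H : Type} [Group H] (n : ℕ)
    (hex : ∀ k, k + 1 ≤ n → ∀ c : Ch H Unit (k + 1), d k c = 0 → IsB c) (k : ℕ) (hk : k + 1 ≤ n) :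
    ∃ (h0 : Ch H Unit k →ₗ[ℤ] Ch H Unit (k + 1)) (h1 : Ch H Unit (k + 1) →ₗ[ℤ] Ch H Unit (k + 2)),
      ∀ c, d (k + 1) (h1 c) + h0 (d k c) = c := by
  have step : ∀ k, k + 1 ≤ n → ∀ h0 : Ch H Unit k →ₗ[ℤ] Ch H Unit (k + 1),
      (∀ c, d k (h0 (d k c)) = d k c) → ∃ (h1 : Ch H Unit (k + 1) →ₗ[ℤ] Ch H Unit (k + 2)),
      ∀ c, d (k + 1) (h1 c) + h0 (d k c) = c := by
    intro k hk h0 hh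
    have : ∀ o : Orb H Unit (k + 1), ∃ b, d (k + 1) b = single o 1 - h0 (d k (single o 1)) :=
      fun o => hex k hk _ (by rw [map_sub, hh, sub_self])
    choose b hb using this
    refine ⟨Finsupp.linearCombination ℤ b, fun c => ?_⟩
    have : (d (k + 1)).comp (Finsupp.linearCombination ℤ b) + h0.comp (d k) = LinearMap.id := by
      refine Finsupp.lhom_ext' fun o => LinearMap.ext_ring ?_
      simp [hb]
    exact LinearMap.congr_fun this c
  induction k with
  | zero =>
    have : ∀ o : Orb H Unit 0, ∃ b, d 0 b = single o 1 := fun o => d_zero_surj _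
    choose b hb using this
    have h : ∀ c, d 0 (Finsupp.linearCombination ℤ b c) = c := by
      intro c
      have : (d 0).comp (Finsupp.linearCombination ℤ b) = LinearMap.id := by
        refine Finsupp.lhom_ext' fun o => LinearMap.ext_ring ?_
        simp [hb]
      exact LinearMap.congr_fun this c
    obtain ⟨h1, hh⟩ := step 0 hk (Finsupp.linearCombination ℤ b) (fun c => h _)
    exact ⟨_, h1, hh⟩
  | succ k ih =>
    obtain ⟨h0, h1, hh⟩ := ih (by omega)
    obtain ⟨h2, hh2⟩ := step (k + 1) hk h1 (fun c => by
      have := hh (d (k + 1) c)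
      rw [d_d, map_zero, add_zero] at this
      exact this)
    exact ⟨h1, h2, hh2⟩

lemma cmap_pr_const {Γ X Γ' X' : Type} [Group Γ] [MulAction Γ X] [Group Γ'] [MulAction Γ' X'] {n : ℕ}
    (f : Γ → Γ') (ρ : X → X') (h : Compat (fun _ => f) ρ) (t : Tup Γ n) (c : X →₀ ℤ) :
    cmap _ _ h n (pr n t c) = pr n (tmap n f t) (Finsupp.lmapDomain ℤ ℤ ρ c) := by
  have : (pr n).compr₂ (cmap _ _ h n) = ((pr n).comp (tmap n f)).compl₂ (Finsupp.lmapDomain ℤ ℤ ρ) := by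
    apply bilin_ext; intro s t
    simp [cmap_e]
  exact LinearMap.congr_fun (LinearMap.congr_fun this t) c

section kun
variable {G H : Type} [Group G] [Group H]

/-- Horizontal boundary on coefficients. -/
noncomputable def bdT (G H : Type) (p : ℕ) : (TX G H (p + 1) →₀ ℤ) →ₗ[ℤ] (TX G H p →₀ ℤ) :=
  bd (S := H) p

lemma bdT_eqv (p : ℕ) : Eqv (G × H) (bdT G H p) := fun γ c => bd_tmap (fun s => γ.2 * s) p c

lemma bd_eqv (p : ℕ) : Eqv H (bd (S := H) p) := fun h c => bd_tmap (fun s => h * s) p c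

/-- Horizontal differential. -/
noncomputable def dp (p q : ℕ) : Ch (G × H) (TX G H (p + 1)) q →ₗ[ℤ] Ch (G × H) (TX G H p) q :=
  lam (bdT G H p) (bdT_eqv p) q

/-- Horizontal differential for the second factor. -/
noncomputable def dbp (p q : ℕ) : Ch H (Fin (p + 1) → H) q →ₗ[ℤ] Ch H (Fin p → H) q :=
  lam (bd p) (bd_eqv p) q

/-- Forget the type synonym. -/
def toF (p : ℕ) (x : TX G H p) : Fin p → H := x

/-- Introduce the type synonym. -/
def ofF (G : Type) {H : Type} (p : ℕ) (x : Fin p → H) : TX G H p := x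

lemma pi_compat (p : ℕ) : Compat (fun (_ : TX G H p) (γ : G × H) => γ.2)
    (toF p) := fun γ _ => ⟨γ.2, fun _ => rfl, rfl⟩

/-- Projection to the second factor. -/
noncomputable def piD (p q : ℕ) : Ch (G × H) (TX G H p) q →ₗ[ℤ] Ch H (Fin p → H) q :=
  cmap _ _ (pi_compat p) q

lemma sig_compat (p : ℕ) : Compat (fun (_ : Fin p → H) (h : H) => ((1 : G), h))
    (ofF G p) := fun h _ => ⟨(1, h), fun _ => by simp, rfl⟩

lemma piD_surj (p : ℕ) (u : Ch H (Fin p → H) 0) :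
    piD p 0 (cmap _ _ (sig_compat (G := G) p) 0 u) = u := by
  have : (piD (G := G) (H := H) p 0).comp (cmap _ _ (sig_compat (G := G) p) 0) = LinearMap.id := by
    apply ch_ext; intro v x
    simp [piD, cmap_e]
    rfl
  exact LinearMap.congr_fun this u

lemma piD_inj (p : ℕ) (u : Ch (G × H) (TX G H p) 0) (hu : piD p 0 u = 0) : u = 0 := by
  have : (cmap _ _ (sig_compat (G := G) p) 0).comp (piD (G := G) (H := H) p 0) = LinearMap.id := by
    apply ch_ext; intro v x
    simp only [piD, LinearMap.comp_apply, cmap_e, LinearMap.id_apply]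
    congr 1
    exact Subsingleton.elim _ _
  have := LinearMap.congr_fun this u
  rw [LinearMap.comp_apply, hu, map_zero] at this
  exact this.symm

lemma piD_dp (p q : ℕ) (c : Ch (G × H) (TX G H (p + 1)) q) : piD p q (dp p q c) = dbp p q (piD (p + 1) q c) := by
  have : (piD (G := G) (H := H) p q).comp (dp p q) = (dbp p q).comp (piD (p + 1) q) := by
    apply ch_ext_pr; intro t x
    simp only [LinearMap.comp_apply, dp, dbp, piD, lam_pr, cmap_pr_const]
    congr 1
    have h1 : ∀ c : TX G H p →₀ ℤ, Finsupp.lmapDomain ℤ ℤ (toF p) c = c :=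
      fun c => Finsupp.mapDomain_id
    have h2 : ∀ c : TX G H (p + 1) →₀ ℤ, Finsupp.lmapDomain ℤ ℤ (toF (p + 1)) c = c :=
      fun c => Finsupp.mapDomain_id
    rw [h1, h2]
    rfl
  exact LinearMap.congr_fun this c

/-- Class of a tuple. -/
def cls (p : ℕ) (x : TX G H p) : Triv (Orb H Unit p) :=
  Quotient.mk (MulAction.orbitRel H ((Fin p → H) × Unit)) ((x : Fin p → H), ())

lemma cls_smul (p : ℕ) (γ : G × H) (x : TX G H p) : cls p (γ • x) = cls p x :=
  Quotient.sound ⟨γ.2, rfl⟩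

lemma kap_compat (p : ℕ) : Compat (fun (_ : TX G H p) (γ : G × H) => γ.1) (cls p) :=
  fun γ x => ⟨γ.1, fun _ => rfl, cls_smul p γ x⟩

/-- Passage to the first factor. -/
noncomputable def kap (p q : ℕ) : Ch (G × H) (TX G H p) q →ₗ[ℤ] Ch G (Triv (Orb H Unit p)) q :=
  cmap _ _ (kap_compat p) q

/-- The boundary of the chains of `H`, seen on trivial modules. -/
noncomputable def dT (H : Type) [Group H] (p : ℕ) :
    (Triv (Orb H Unit (p + 1)) →₀ ℤ) →ₗ[ℤ] (Triv (Orb H Unit p) →₀ ℤ) :=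
  d (Γ := H) (X := Unit) p

lemma triv_eqv {O O' : Type} (L : (Triv O →₀ ℤ) →ₗ[ℤ] (Triv O' →₀ ℤ)) : Eqv G L := by
  have h : ∀ (O : Type) (g : G) (c : Triv O →₀ ℤ), act g c = c := fun O g c => Finsupp.mapDomain_id
  intro g c
  rw [h, h]

lemma kap_dp (p q : ℕ) (c : Ch (G × H) (TX G H (p + 1)) q) :
    kap p q (dp p q c) = lam (dT H p) (triv_eqv _) q (kap (p + 1) q c) := by
  have : (kap (G := G) (H := H) p q).comp (dp p q) =
      (lam (dT H p) (triv_eqv _) q).comp (kap (p + 1) q) := by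
    apply ch_ext_pr; intro t x
    simp only [LinearMap.comp_apply, dp, kap, lam_pr, cmap_pr_const]
    congr 1
    have h1 : ∀ (p : ℕ) (c : Tup H p), Finsupp.lmapDomain ℤ ℤ (fun v : Fin p → H =>
        (Quotient.mk (MulAction.orbitRel H ((Fin p → H) × Unit)) (v, ()) : Orb H Unit p)) c =
        pr (Γ := H) p c (single () 1) := by
      intro p c
      have : Finsupp.lmapDomain ℤ ℤ (fun v : Fin p → H =>
        (Quotient.mk (MulAction.orbitRel H ((Fin p → H) × Unit)) (v, ()) : Orb H Unit p)) =
        ((pr (Γ := H) (X := Unit) p).flip (single () 1) : Tup H p →ₗ[ℤ] _) := by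
        apply tup_ext; intro v
        rw [LinearMap.flip_apply, pr_single]
        exact Finsupp.mapDomain_single
      exact LinearMap.congr_fun this c
    have := d_pr (Γ := H) (X := Unit) (single (x : Fin (p + 1) → H) 1) (single () 1)
    exact (h1 p _).trans (this.symm.trans (congrArg (d p) (h1 (p + 1) _).symm))
  exact LinearMap.congr_fun this c

lemma exists_ksec (p : ℕ) :
    ∃ σ : ∀ q, Ch G (Triv (Orb H Unit (p + 1))) q →ₗ[ℤ] Ch (G × H) (TX G H (p + 1)) q,
    (∀ q c, d q (σ (q + 1) c) = σ q (d q c)) ∧ (∀ q c, kap (p + 1) q (σ q c) = c) ∧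
    (∀ q (c : Ch (G × H) (TX G H (p + 1)) (q + 1)), d q c = 0 →
      IsB (c - σ (q + 1) (kap (p + 1) (q + 1) c))) := by
  have hr : ∀ o : Triv (Orb H Unit (p + 1)), ∃ x : TX G H (p + 1), cls (p + 1) x = o := by
    intro o
    induction o using Quotient.inductionOn with
    | h p => exact ⟨p.1, rfl⟩
  choose r hr using hr
  have hex : ∀ x : TX G H (p + 1), ∃ h : H, x = fun i => h * r (cls (p + 1) x) i := by
    intro x
    obtain ⟨h, hh⟩ := Quotient.exact (hr (cls (p + 1) x))
    refine ⟨h⁻¹, ?_⟩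
    have h3 : (fun i => h * x i) = r (cls (p + 1) x) := congrArg Prod.fst hh
    funext i
    rw [← h3]
    simp
  choose c hc using hex
  have hcs : ∀ (γ : G × H) x, c (γ • x) = γ.2 * c x := by
    intro γ x
    have h1 := congrFun (hc (γ • x)) 0
    have h2 := congrFun (hc x) 0
    rw [cls_smul] at h1
    have h3 : (γ • x) 0 = γ.2 * x 0 := rfl
    rw [h3, h2, ← mul_assoc] at h1
    exact (mul_right_cancel h1).symm
  have hS : Compat (fun (_ : Triv (Orb H Unit (p + 1))) (g : G) => (g, (1 : H))) r :=
    fun g o => ⟨(g, 1), fun v => by simp, funext fun i => (one_mul _).symm⟩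
  refine ⟨fun q => cmap _ _ hS q, fun q c => d_cmap _ _ _ _, fun q c => ?_, fun q z hz => ?_⟩
  · have : (kap (G := G) (H := H) (p + 1) q).comp (cmap _ _ hS q) = LinearMap.id := by
      apply ch_ext; intro v x
      simp [kap, cmap_e, hr]
    exact LinearMap.congr_fun this c
  · have h2 : Compat2 (fun (x : TX G H (p + 1)) (v : G × H) => (v.1, c x)) (fun _ v => v) (fun x => x) := by
      intro γ x
      exact ⟨γ, fun v => by
        change ((γ * v).1, c (γ • x)) = _
        rw [hcs]; rfl, fun v => rfl, rfl⟩
    obtain ⟨b, hb⟩ := hmt_cycle _ _ _ h2 z hz h2.left h2.right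
    refine ⟨b, ?_⟩
    have h3 : cmap _ _ h2.left (q + 1) z = cmap _ _ ((kap_compat (p + 1)).comp hS) (q + 1) z := by
      symm
      refine cmap_congr ((kap_compat (p + 1)).comp hS) h2.left (fun x => (1, c x)) (fun x v => ?_)
        (fun x => ?_) _
      · simp
      · exact hc x
    rw [hb, cmap_id, kap, cmap_comp _ _ _ _ _ _ ((kap_compat (p + 1)).comp hS), h3]

lemma kap_inj (p q : ℕ) (c : Ch (G × H) (TX G H (p + 1)) (q + 1)) (hc : d q c = 0)
    (h : IsB (kap (p + 1) (q + 1) c)) : IsB c := by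
  obtain ⟨σ, h1, h2, h3⟩ := exists_ksec (G := G) (H := H) p
  refine (h3 q c hc).of_sub ?_
  obtain ⟨b, hb⟩ := h
  exact ⟨σ _ b, by rw [h1, hb]⟩

lemma dp_exact (p q : ℕ) (x : Ch (G × H) (TX G H (p + 1)) (q + 1)) (h : dp p (q + 1) x = 0) :
    ∃ y, dp (p + 1) (q + 1) y = x :=
  lam_exact (bdT G H (p + 1)) (bdT_eqv _) (bdT G H p) (bdT_eqv _)
    (fun y hy => ⟨cone (1 : H) y, bd_exact (1 : H) p y hy⟩) x h

lemma dp_surj (q : ℕ) (x : Ch (G × H) (TX G H 0) (q + 1)) : ∃ y, dp 0 (q + 1) y = x :=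
  lam_surj (bdT G H 0) (bdT_eqv _) (fun y => ⟨cone (1 : H) y, bd_zero_cone (1 : H) y⟩) x

lemma dbp_exact (p q : ℕ) (x : Ch H (Fin (p + 1) → H) (q + 1)) (h : dbp p (q + 1) x = 0) :
    ∃ y, dbp (p + 1) (q + 1) y = x :=
  lam_exact _ _ _ _ (fun y hy => ⟨cone (1 : H) y, bd_exact 1 p y hy⟩) x h

lemma dbp_surj (q : ℕ) (x : Ch H (Fin 0 → H) (q + 1)) : ∃ y, dbp 0 (q + 1) y = x :=
  lam_surj _ _ (fun y => ⟨cone (1 : H) y, bd_zero_cone (1 : H) y⟩) x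

lemma d_dp (p q : ℕ) (c : Ch (G × H) (TX G H (p + 1)) (q + 1)) :
    d q (dp p (q + 1) c) = dp p q (d q c) := d_lam _ _ _

lemma d_dbp (p q : ℕ) (c : Ch H (Fin (p + 1) → H) (q + 1)) :
    d q (dbp p (q + 1) c) = dbp p q (d q c) := d_lam _ _ _

lemma d_kap (p q : ℕ) (c : Ch (G × H) (TX G H p) (q + 1)) :
    d q (kap p (q + 1) c) = kap p q (d q c) := d_cmap _ _ _ _

lemma d_piD (p q : ℕ) (c : Ch (G × H) (TX G H p) (q + 1)) :
    d q (piD p (q + 1) c) = piD p q (d q c) := d_cmap _ _ _ _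

lemma dp_dp (p q : ℕ) (c : Ch (G × H) (TX G H (p + 2)) q) : dp p q (dp (p + 1) q c) = 0 := by
  have : (dp p q).comp (dp (p + 1) q) = (0 : Ch (G × H) (TX G H (p + 2)) q →ₗ[ℤ] _) := by
    apply ch_ext_pr; intro t x
    simp only [LinearMap.comp_apply, dp, lam_pr]
    have : ∀ x, bdT G H p (bdT G H (p + 1) x) = 0 := fun x => bd_bd p x
    rw [this]; simp
  exact LinearMap.congr_fun this c

/-- Exactness of the columns homology in the horizontal direction. -/
lemma col_exact (n : ℕ) (hex : ∀ k, k + 1 ≤ n → ∀ c : Ch H Unit (k + 1), d k c = 0 → IsB c)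
    (p q : ℕ) (hpq : p + 1 + q = n + 1) (u : Ch (G × H) (TX G H (p + 2)) q)
    (y : Ch (G × H) (TX G H (p + 1)) (q + 1)) (hu : dp (p + 1) q u = d q y)
    (hu2 : ∀ q' (h : q = q' + 1), d q' (h ▸ u) = 0) :
    ∃ (w : Ch (G × H) (TX G H (p + 3)) q) (t : Ch (G × H) (TX G H (p + 2)) (q + 1)),
      u = dp (p + 2) q w + d q t := by
  rcases q with _ | q
  · obtain ⟨t, ht⟩ := d_zero_surj u
    exact ⟨0, t, by simp [ht]⟩
  have hu2 : d q u = 0 := hu2 q rfl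
  rcases q with _ | q
  · obtain ⟨t, ht⟩ := kap_inj (p + 1) 0 u hu2 (by
      have := d_zero_inj_triv (kap (p + 2) 1 u) (by rw [d_kap, hu2, map_zero])
      rw [this]; exact isB_zero)
    exact ⟨0, t, by simp [ht]⟩
  obtain ⟨h0, h1, hh⟩ := exists_contraction n hex (p + 1) (by omega)
  let h0' : (Triv (Orb H Unit (p + 1)) →₀ ℤ) →ₗ[ℤ] (Triv (Orb H Unit (p + 2)) →₀ ℤ) := h0
  let h1' : (Triv (Orb H Unit (p + 2)) →₀ ℤ) →ₗ[ℤ] (Triv (Orb H Unit (p + 3)) →₀ ℤ) := h1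
  have hh' : ∀ c, dT H (p + 2) (h1' c) + h0' (dT H (p + 1) c) = c := hh
  obtain ⟨σ, s1, s2, s3⟩ := exists_ksec (G := G) (H := H) (p + 2)
  set k := kap (p + 2) (q + 2) u with hk
  have hkd : d (q + 1) k = 0 := by rw [hk, d_kap, hu2, map_zero]
  have hkT : lam (dT H (p + 1)) (triv_eqv _) (q + 2) k = d (q + 2) (kap (p + 1) (q + 3) y) := by
    rw [hk, ← kap_dp, hu, d_kap]
  set m := lam h1' (triv_eqv _) (q + 2) k with hm
  have hmd : d (q + 1) m = 0 := by rw [hm, d_lam, hkd, map_zero]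
  have hdec : k = lam (dT H (p + 2)) (triv_eqv _) (q + 2) m +
      d (q + 2) (lam h0' (triv_eqv _) (q + 3) (kap (p + 1) (q + 3) y)) := by
    have hid : ∀ c, (LinearMap.id : (Triv (Orb H Unit (p + 2)) →₀ ℤ) →ₗ[ℤ] _) c
        = ((dT H (p + 2)).comp h1') c + (h0'.comp (dT H (p + 1))) c := fun c => (hh' c).symm
    have h5 := lam_add _ _ _ (triv_eqv (G := G) _) (triv_eqv _) (triv_eqv _) hid k
    rw [lam_id _ _ (fun _ => rfl)] at h5
    rw [d_lam, ← hkT, hm]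
    rw [lam_comp _ _ _ _ ((dT H (p + 2)).comp h1') (triv_eqv _) (fun _ => rfl),
      lam_comp _ _ _ _ (h0'.comp (dT H (p + 1))) (triv_eqv _) (fun _ => rfl)]
    exact h5
  set w := σ (q + 2) m with hw
  have hwd : d (q + 1) w = 0 := by rw [hw, s1, hmd, map_zero]
  obtain ⟨t, ht⟩ := kap_inj (p + 1) (q + 1) (u - dp (p + 2) (q + 2) w)
    (by rw [map_sub, hu2, d_dp, hwd, map_zero, sub_zero]) (by
      rw [map_sub, kap_dp, hw, s2, ← hk, hdec]
      exact ⟨lam h0' (triv_eqv _) (q + 3) (kap (p + 1) (q + 3) y), by abel⟩)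
  exact ⟨w, t, by rw [ht]; abel⟩

lemma dc_step (n : ℕ) (hex : ∀ k, k + 1 ≤ n → ∀ c : Ch H Unit (k + 1), d k c = 0 → IsB c) (q : ℕ) :
    ∀ (p : ℕ) (_ : p + q = n + 1) (x : Ch (G × H) (TX G H p) q)
    (_ : ∀ p' (h : p = p' + 1), dp p' q (h ▸ x) = 0)
    (_ : ∀ q' (h : q = q' + 1), d q' (h ▸ x) = 0)
    (ub : Ch H (Fin (p + 1) → H) q) (_ : ∀ q' (h : q = q' + 1), d q' (h ▸ ub) = 0)
    (_ : dbp p q ub = piD p q x),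
    ∃ u : Ch (G × H) (TX G H (p + 1)) q, (∀ q' (h : q = q' + 1), d q' (h ▸ u) = 0) ∧ dp p q u = x := by
  induction q with
  | zero =>
    intro p hp x hx1 hx2 ub hub hpi
    refine ⟨cmap _ _ (sig_compat (G := G) (p + 1)) 0 ub, fun q' h => by omega, ?_⟩
    rw [← sub_eq_zero]
    apply piD_inj
    rw [map_sub, piD_dp, piD_surj, hpi, sub_self]
  | succ q ih =>
    intro p hp x hx1 hx2 ub hub hpi
    have hx2 : d q x = 0 := hx2 q rfl
    have hub : d q ub = 0 := hub q rfl
    obtain ⟨y, hy⟩ : ∃ y, dp p (q + 1) y = x := by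
      rcases p with _ | p
      · exact dp_surj q x
      · exact dp_exact p q x (hx1 p rfl)
    obtain ⟨vb, hvb⟩ := dbp_exact p q (piD (p + 1) (q + 1) y - ub) (by
      rw [map_sub, ← piD_dp, hy, hpi, sub_self])
    obtain ⟨u1, hu1, hu1'⟩ := ih (p + 1) (by omega) (d q y)
      (fun p' h => by
        obtain rfl : p = p' := by omega
        change dp p q (d q y) = 0
        rw [← d_dp, hy, hx2])
      (fun q' h => by subst h; exact d_d y)
      (d q vb) (fun q' h => by subst h; exact d_d vb)
      (by rw [← d_dbp, hvb, map_sub, hub, sub_zero, d_piD])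
    obtain ⟨w, t, hwt⟩ := col_exact n hex p q (by omega) u1 y hu1' hu1
    refine ⟨y - dp (p + 1) (q + 1) t, fun q' h => ?_, ?_⟩
    · obtain rfl : q = q' := by omega
      change d q (y - dp (p + 1) (q + 1) t) = 0
      rw [map_sub, d_dp, ← hu1', hwt, map_add, dp_dp, zero_add, sub_self]
    · rw [map_sub, hy, dp_dp, sub_zero]

lemma unit_to_T_compat : Compat (fun (_ : Unit) (γ : G × H) => γ) (fun _ => (ofF G 0 (Fin.elim0 : Fin 0 → H))) :=
  fun γ _ => ⟨γ, fun _ => rfl, funext fun i => i.elim0⟩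

lemma T_to_unit_compat : Compat (fun (_ : TX G H 0) (γ : G × H) => γ) (fun _ => ()) :=
  fun γ _ => ⟨γ, fun _ => rfl, rfl⟩

lemma unit_to_F_compat : Compat (fun (_ : Unit) (γ : H) => γ) (fun _ => (Fin.elim0 : Fin 0 → H)) :=
  fun γ _ => ⟨γ, fun _ => rfl, funext fun i => i.elim0⟩

lemma coll_compat (O : Type) : Compat (fun (_ : Triv O) (γ : G) => γ) (fun _ => ()) :=
  fun γ _ => ⟨γ, fun _ => rfl, rfl⟩

lemma exp_compat {O : Type} (o : O) : Compat (fun (_ : Unit) (γ : G) => γ) (fun _ => toTriv o) :=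
  fun γ _ => ⟨γ, fun _ => rfl, rfl⟩

/-- Weak Künneth theorem. -/
theorem kunneth (n : ℕ) (hex : ∀ k, k + 1 ≤ n → ∀ c : Ch H Unit (k + 1), d k c = 0 → IsB c)
    (z : Ch (G × H) Unit (n + 1)) (hz : d n z = 0) (h1 : IsB (gmap (MonoidHom.fst G H) (n + 1) z))
    (h2 : IsB (gmap (MonoidHom.snd G H) (n + 1) z)) : IsB z := by
  set x := cmap _ _ (unit_to_T_compat (G := G) (H := H)) (n + 1) z with hx
  have hxd : d n x = 0 := by rw [hx, d_cmap, hz, map_zero]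
  have hback : ∀ q (c : Ch (G × H) Unit q), cmap _ _ (T_to_unit_compat (G := G) (H := H)) q
      (cmap _ _ (unit_to_T_compat (G := G) (H := H)) q c) = c := by
    intro q c
    have : (cmap _ _ (T_to_unit_compat (G := G) (H := H)) q).comp
      (cmap _ _ (unit_to_T_compat (G := G) (H := H)) q) = LinearMap.id := by
      apply ch_ext; intro v x; simp [cmap_e]
    exact LinearMap.congr_fun this c
  have hpx : piD 0 (n + 1) x = cmap _ _ (unit_to_F_compat (H := H)) (n + 1)
      (gmap (MonoidHom.snd G H) (n + 1) z) := by
    have : (piD 0 (n + 1)).comp (cmap _ _ (unit_to_T_compat (G := G) (H := H)) (n + 1)) =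
      (cmap _ _ (unit_to_F_compat (H := H)) (n + 1)).comp (gmap (MonoidHom.snd G H) (n + 1)) := by
      apply ch_ext; intro v x; simp [cmap_e, piD, gmap_e]; rfl
    exact LinearMap.congr_fun this z
  obtain ⟨b, hb⟩ : IsB (piD 0 (n + 1) x) := by rw [hpx]; exact h2.cmap _ _ _
  obtain ⟨c, hc⟩ := dbp_surj (n + 1) b
  obtain ⟨u, hu, hu'⟩ := dc_step n hex (n + 1) 0 (by omega) x (fun p' h => by omega)
    (fun q' h => by obtain rfl : n = q' := by omega
                    exact hxd) (d (n + 1) c)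
    (fun q' h => by obtain rfl : n = q' := by omega
                    exact d_d c) (by rw [← d_dbp, hc, hb])
  have hu : d n u = 0 := hu n rfl
  have hcoll : cmap _ _ (coll_compat (G := G) (Orb H Unit 1)) (n + 1) (kap 1 (n + 1) u) =
      gmap (MonoidHom.fst G H) (n + 1) z := by
    have : (cmap _ _ (coll_compat (G := G) (Orb H Unit 1)) (n + 1)).comp (kap 1 (n + 1)) =
      ((gmap (MonoidHom.fst G H) (n + 1)).comp
        (cmap _ _ (T_to_unit_compat (G := G) (H := H)) (n + 1))).comp (dp 0 (n + 1)) := by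
      apply ch_ext; intro v x
      have hd : dp 0 (n + 1) (e v x) = e v (ofF G 0 (Fin.elim0 : Fin 0 → H)) := by
        rw [← pr_single, dp, lam_pr]
        have : bdT G H 0 (single x 1) = single (ofF G 0 (Fin.elim0 : Fin 0 → H)) 1 := by
          have h9 : ∀ x : Fin 1 → H, bd 0 (single x 1) = single Fin.elim0 1 := by
            intro x
            simp only [bd, linearCombination_single, one_smul]
            exact congrArg (fun w : Fin 0 → H => single w (1 : ℤ)) (Subsingleton.elim _ _)
          exact h9 x
        rw [this, pr_single]
      simp [cmap_e, kap, gmap_e, hd]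
    have := LinearMap.congr_fun this u
    simp only [LinearMap.comp_apply] at this
    rw [this, hu', hx, hback]
  have hk : IsB (kap 1 (n + 1) u) := by
    let o : Orb H Unit 1 := Quotient.mk _ (fun _ => 1, ())
    have ho : ∀ o' : Orb H Unit 1, o' = o := by
      intro o'
      induction o' using Quotient.inductionOn with
      | h p =>
        refine Quotient.sound ⟨p.1 0, Prod.ext ?_ rfl⟩
        funext i
        rw [Subsingleton.elim i 0]
        exact mul_one _
    have : kap 1 (n + 1) u = cmap _ _ (exp_compat o) (n + 1)
        (cmap _ _ (coll_compat (G := G) (Orb H Unit 1)) (n + 1) (kap 1 (n + 1) u)) := by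
      have : (cmap _ _ (exp_compat o) (n + 1)).comp
          (cmap _ _ (coll_compat (G := G) (Orb H Unit 1)) (n + 1)) = LinearMap.id := by
        apply ch_ext; intro v x
        simp only [LinearMap.comp_apply, cmap_e, LinearMap.id_apply]
        exact congrArg (e v) (ho x).symm
      exact (LinearMap.congr_fun this _).symm
    rw [this, hcoll]
    exact h1.cmap _ _ _
  obtain ⟨t, ht⟩ := kap_inj 0 n u hu hk
  have hxB : IsB x := ⟨dp 0 (n + 2) t, by rw [d_dp, ht, hu']⟩
  have := hxB.cmap _ _ (T_to_unit_compat (G := G) (H := H))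
  rwa [hx, hback] at this

end kun

end BDM

namespace BDM
open Finsupp

/-! ### Acyclic groups -/

/-- Acyclic groups. -/
def Acyc (G : Type) [Group G] : Prop := ∀ n (c : Ch G Unit (n + 1)), d n c = 0 → IsB c

section acyc
variable {G H : Type} [Group G] [Group H] {n : ℕ}

lemma gmap_comp {K : Type} [Group K] (φ : G →* H) (ψ : H →* K) (c : Ch G Unit n) :
    gmap ψ n (gmap φ n c) = gmap (ψ.comp φ) n c := gmap_gmap _ _ _ (fun _ => rfl) c

lemma acyc_punit : Acyc PUnit := by
  let s : ∀ k, Ch PUnit Unit k →ₗ[ℤ] Ch PUnit Unit (k + 1) := fun k =>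
    chLift (fun v x => e (cns 1 v) x) (fun g v x => by congr 1)
  have hs : ∀ k t (x : Unit), s k (pr k t (single x 1)) = pr (k + 1) (cone 1 t) (single x 1) := by
    intro k t x
    have : (s k).comp ((pr k).flip (single x 1)) = ((pr (k + 1)).flip (single x 1)).comp (cone 1) := by
      apply tup_ext; intro v
      simp [s]
    exact LinearMap.congr_fun this t
  intro n c hc
  refine ⟨s _ c, ?_⟩
  have : (d (n + 1)).comp (s (n + 1)) + (s n).comp (d n) = LinearMap.id := by
    apply ch_ext_pr; intro t x
    simp only [LinearMap.add_apply, LinearMap.comp_apply, hs, d_pr, bd_succ_cone]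
    simp
  have := LinearMap.congr_fun this c
  simpa [hc] using this

lemma gmap_one_isB (φ : G →* H) (h : ∀ g, φ g = 1) (c : Ch G Unit (n + 1)) (hc : d n c = 0) :
    IsB (gmap φ (n + 1) c) := by
  have h1 := gmap_gmap (1 : G →* PUnit) (1 : PUnit →* H) φ (fun g => by simp [h]) c
  rw [← h1]
  refine IsB.gmap (acyc_punit n _ ?_) _
  rw [d_gmap, hc, map_zero]

/-- Acyclic factors can be removed. -/
lemma prod_acyc_inj (hH : Acyc H) (z : Ch (G × H) Unit (n + 1)) (hz : d n z = 0)
    (h : IsB (gmap (MonoidHom.fst G H) (n + 1) z)) : IsB z :=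
  kunneth n (fun k _ => hH k) z hz h (hH n _ (by rw [d_gmap, hz, map_zero]))

lemma acyc_zero (c : Ch G Unit 1) (hc : d 0 c = 0) : IsB c := by
  have hc2 : Compat (fun (_ : Unit) (g : G) => g) (fun _ => toTriv ()) :=
    fun g _ => ⟨g, fun _ => rfl, rfl⟩
  have h1 := d_zero_inj_triv (cmap _ _ hc2 1 c) (by rw [d_cmap, hc, map_zero])
  have h2 : cmap _ _ (coll_compat (G := G) Unit) 1 (cmap _ _ hc2 1 c) = c := by
    have : (cmap _ _ (coll_compat (G := G) Unit) 1).comp (cmap _ _ hc2 1) = LinearMap.id := by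
      apply ch_ext; intro v x
      simp [cmap_e]
    exact LinearMap.congr_fun this c
  rw [← h2, h1, map_zero]
  exact isB_zero

/-- The swindle. -/
theorem acyc_of_swindle (Γ : Type) [Group Γ] (F : ℕ → Subgroup Γ) (hF : Monotone F)
    (hU : ∀ g, ∃ m, g ∈ F m)
    (hs : ∀ m, ∃ (φ : F m →* Γ) (τ : Γ), (∀ a b : F m, Commute (a : Γ) (φ b)) ∧
      ∀ a : F m, φ a = τ * (a * φ a) * τ⁻¹) : Acyc Γ := by
  have hfin : ∀ s : Finset Γ, ∃ m, ∀ g ∈ s, g ∈ F m := by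
    classical
    intro s
    induction s using Finset.induction_on with
    | empty => exact ⟨0, by simp⟩
    | insert a s ha ih =>
      obtain ⟨m, hm⟩ := ih
      obtain ⟨k, hk⟩ := hU a
      refine ⟨max m k, fun g hg => ?_⟩
      rcases Finset.mem_insert.1 hg with rfl | hg
      · exact hF (le_max_right _ _) hk
      · exact hF (le_max_left _ _) (hm g hg)
  intro n
  induction n using Nat.strong_induction_on with
  | _ n ih =>
  intro z hz
  rcases n with _ | n
  · exact acyc_zero z hz
  obtain ⟨m, z', hz'⟩ := gmap_lift (fun m => F m) (fun m => (F m).subtype)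
    (fun s => by simpa using hfin s) z
  -- the test cycle in the product
  have hy : IsB (gmap ((MonoidHom.id Γ).prod (MonoidHom.id Γ)) (n + 2) z
      - gmap (MonoidHom.inl Γ Γ) (n + 2) z - gmap (MonoidHom.inr Γ Γ) (n + 2) z) := by
    refine kunneth (n + 1) (fun k hk => ih k (by omega)) _ ?_ ?_ ?_
    · rw [map_sub, map_sub, d_gmap, d_gmap, d_gmap, hz]; simp
    · rw [map_sub, map_sub, gmap_gmap _ _ (MonoidHom.id Γ) (fun _ => rfl),
        gmap_gmap _ _ (MonoidHom.id Γ) (fun _ => rfl), gmap_gmap _ _ 1 (fun _ => rfl), sub_self,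
        zero_sub]
      exact (gmap_one_isB _ (fun _ => rfl) _ hz).neg
    · rw [map_sub, map_sub, gmap_gmap _ _ (MonoidHom.id Γ) (fun _ => rfl),
        gmap_gmap (MonoidHom.inr Γ Γ) _ (MonoidHom.id Γ) (fun _ => rfl),
        gmap_gmap _ _ 1 (fun _ => rfl), sub_right_comm, sub_self, zero_sub]
      exact (gmap_one_isB _ (fun _ => rfl) _ hz).neg
  obtain ⟨b, hb⟩ := hy
  obtain ⟨⟨M, hM⟩, b', hb'⟩ := gmap_lift (ι := {M // m ≤ M}) (fun M => F M.1 × F M.1)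
    (fun M => (F M.1).subtype.prodMap (F M.1).subtype)
    (fun s => by
      classical
      obtain ⟨k, hk⟩ := hfin (s.image Prod.fst ∪ s.image Prod.snd)
      refine ⟨⟨max m k, le_max_left _ _⟩, fun g hg => ?_⟩
      have h1 := hF (le_max_right m k) (hk g.1 (Finset.mem_union_left _ (Finset.mem_image_of_mem _ hg)))
      have h2 := hF (le_max_right m k) (hk g.2 (Finset.mem_union_right _ (Finset.mem_image_of_mem _ hg)))
      exact ⟨(⟨g.1, h1⟩, ⟨g.2, h2⟩), rfl⟩) b
  simp only at b' hb'
  set zM := gmap (Subgroup.inclusion (hF hM)) (n + 2) z' with hzM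
  have hzM' : gmap (F M).subtype (n + 2) zM = z := by
    rw [hzM, gmap_gmap _ _ (F m).subtype (fun _ => rfl), hz']
  have hzMd : d (n + 1) zM = 0 := by
    apply gmap_inj (F M).subtype Subtype.val_injective
    rw [← d_gmap, hzM', hz]
  clear_value zM
  have key : d (n + 2) b' = gmap ((MonoidHom.id (F M)).prod (MonoidHom.id (F M))) (n + 2) zM
      - gmap (MonoidHom.inl (F M) (F M)) (n + 2) zM - gmap (MonoidHom.inr (F M) (F M)) (n + 2) zM := by
    rw [← sub_eq_zero]
    apply gmap_inj ((F M).subtype.prodMap (F M).subtype)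
      (Function.Injective.prodMap Subtype.val_injective Subtype.val_injective)
    rw [map_sub, ← d_gmap, hb', hb, sub_eq_zero, map_sub, map_sub, ← hzM']
    congr 1
    · congr 1
      · exact (gmap_comp _ _ _).trans ((gmap_congr _ _ (fun g => by simp) _).trans (gmap_comp _ _ _).symm)
      · exact (gmap_comp _ _ _).trans ((gmap_congr _ _ (fun g => by simp) _).trans (gmap_comp _ _ _).symm)
    · exact (gmap_comp _ _ _).trans ((gmap_congr _ _ (fun g => by simp) _).trans (gmap_comp _ _ _).symm)
  obtain ⟨φ, τ, hc, ht⟩ := hs M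
  let θ : F M × F M →* Γ := (F M).subtype.noncommCoprod φ hc
  have hθ : ∀ p : F M × F M, θ p = (p.1 : Γ) * φ p.2 := fun _ => rfl
  have h5 : IsB (gmap θ (n + 2) (d (n + 2) b')) := ⟨gmap θ (n + 3) b', d_gmap _ _⟩
  rw [key, map_sub, map_sub, gmap_comp,
    gmap_gmap (MonoidHom.inl (F M) (F M)) θ (F M).subtype (fun g => by simp [hθ]), hzM',
    gmap_gmap (MonoidHom.inr (F M) (F M)) θ φ (fun g => by simp [hθ])] at h5
  have h6 := gmap_conj (θ.comp ((MonoidHom.id (F M)).prod (MonoidHom.id (F M)))) φ τ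
    (fun g => by rw [ht]; simp [hθ]) zM hzMd
  have := (h5.add h6).neg
  simpa using this

end acyc

/-! ### Permutation groups -/

section perm
open Equiv

/-- Family of permutations on copies. -/
def PF {X : Type} : (ℤ → Perm X) →* Perm (X × ℤ) where
  toFun f := 
    { toFun := fun p => (f p.2 p.1, p.2)
      invFun := fun p => ((f p.2)⁻¹ p.1, p.2)
      left_inv := fun p => by simp
      right_inv := fun p => by simp }
  map_one' := by ext p <;> rfl
  map_mul' f g := by ext p <;> rfl

lemma PF_apply {X : Type} (f : ℤ → Perm X) (p : X × ℤ) : PF f p = (f p.2 p.1, p.2) := rfl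

/-- The shift. -/
def shf (X : Type) : Perm (X × ℤ) := Equiv.prodCongr (Equiv.refl X) (Equiv.addRight (1 : ℤ))

lemma shf_apply {X : Type} (p : X × ℤ) : shf X p = (p.1, p.2 + 1) := rfl

lemma shf_conj {X : Type} (f : ℤ → Perm X) :
    shf X * PF f * (shf X)⁻¹ = PF (fun k => f (k - 1)) := by
  rw [mul_inv_eq_iff_eq_mul]
  ext p <;> simp [PF_apply, shf_apply]

/-- Indicator families. -/
def ind {X : Type} (S : ℤ → Prop) [DecidablePred S] : Perm X →* (ℤ → Perm X) where
  toFun σ k := if S k then σ else 1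
  map_one' := by funext k; simp
  map_mul' a b := by funext k; by_cases h : S k <;> simp [h]

/-- Extension along an embedding. -/
noncomputable abbrev via {S X : Type} (i : S ↪ X) : Perm S →* Perm X := Perm.viaEmbeddingHom i

lemma via_apply {S X : Type} (i : S ↪ X) (σ : Perm S) (s : S) : via i σ (i s) = i (σ s) :=
  Perm.viaEmbedding_apply σ i s

lemma via_not {S X : Type} (i : S ↪ X) (σ : Perm S) (x : X) (h : x ∉ Set.range i) : via i σ x = x :=
  Perm.viaEmbedding_apply_of_notMem σ i x h

lemma via_conj {S X : Type} (i j : S ↪ X) (g : Perm X) (h : ∀ s, g (i s) = j s) (σ : Perm S) :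
    g * via i σ * g⁻¹ = via j σ := by
  rw [mul_inv_eq_iff_eq_mul]
  ext x
  by_cases hx : x ∈ Set.range i
  · obtain ⟨s, rfl⟩ := hx
    simp [via_apply, h]
  · have : g x ∉ Set.range j := by
      rintro ⟨s, hs⟩
      rw [← h] at hs
      exact hx ⟨s, g.injective hs⟩
    rw [Perm.mul_apply, Perm.mul_apply, via_not i σ x hx, via_not j σ _ this]

lemma via_comm {S T X : Type} (i : S ↪ X) (j : T ↪ X) (h : ∀ s t, i s ≠ j t) (σ : Perm S)
    (τ : Perm T) : Commute (via i σ) (via j τ) := by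
  have : via j τ * via i σ * (via j τ)⁻¹ = via i σ := via_conj i i _ (fun s => via_not j τ _ (by
    rintro ⟨t, ht⟩; exact h s t ht.symm)) σ
  rw [mul_inv_eq_iff_eq_mul] at this
  exact this.symm

/-- The points on which the permutations act. -/
abbrev PX (Y0 : Type) : Type := (Y0 × ℕ) × ℕ

/-- The group of permutations with bounded support. -/
def Gam (Y0 : Type) : Subgroup (Perm (PX Y0)) where
  carrier := {σ | ∃ m, ∀ x : PX Y0, m ≤ x.2 → σ x = x}
  one_mem' := ⟨0, fun _ _ => rfl⟩
  mul_mem' := by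
    rintro a b ⟨m, hm⟩ ⟨k, hk⟩
    refine ⟨max m k, fun x hx => ?_⟩
    rw [Perm.mul_apply, hk x (le_trans (le_max_right _ _) hx), hm x (le_trans (le_max_left _ _) hx)]
  inv_mem' := by
    rintro a ⟨m, hm⟩
    refine ⟨m, fun x hx => ?_⟩
    rw [Perm.inv_eq_iff_eq, hm x hx]

/-- The filtration. -/
def GamF (Y0 : Type) (m : ℕ) : Subgroup (Gam Y0) where
  carrier := {σ | ∀ x : PX Y0, m ≤ x.2 → (σ : Perm (PX Y0)) x = x}
  one_mem' := fun _ _ => rfl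
  mul_mem' := by
    intro a b hm hk x hx
    rw [Subgroup.coe_mul, Perm.mul_apply, hk x hx, hm x hx]
  inv_mem' := by
    intro a hm x hx
    rw [Subgroup.coe_inv, Perm.inv_eq_iff_eq, hm x hx]

variable {Y0 : Type}

/-- Coding many copies into one level. -/
noncomputable def cod (p : PX Y0 × ℤ) : Y0 × ℕ := (p.1.1.1, Encodable.encode (p.1.1.2, p.1.2, p.2))

lemma cod_inj : Function.Injective (cod (Y0 := Y0)) := by
  rintro ⟨⟨⟨y, a⟩, b⟩, k⟩ ⟨⟨⟨y', a'⟩, b'⟩, k'⟩ h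
  obtain ⟨h1, h2⟩ := Prod.mk.inj h
  have h3 := Encodable.encode_injective h2
  simp only [Prod.mk.injEq] at h1 h3 ⊢
  tauto

open Classical in
/-- The swindle embedding. -/
noncomputable def iot (Y0 : Type) (m : ℕ) : PX Y0 × ℤ ↪ PX Y0 where
  toFun p := if p.2 = 0 ∧ p.1.2 < m then p.1 else (cod p, m)
  inj' := by
    intro p q h
    by_cases hp : p.2 = 0 ∧ p.1.2 < m <;> by_cases hq : q.2 = 0 ∧ q.1.2 < m
    · simp only [hp, hq, and_self, if_true] at h
      exact Prod.ext h (hp.1.trans hq.1.symm)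
    · simp only [hp, hq, and_self, if_true, if_false] at h
      have := congrArg Prod.snd h
      simp only at this
      omega
    · simp only [hp, hq, and_self, if_true, if_false] at h
      have := congrArg Prod.snd h
      simp only at this
      omega
    · simp only [hp, hq, if_false] at h
      exact cod_inj (Prod.mk.inj h).1

lemma iot_small (m : ℕ) (x : PX Y0) (h : x.2 < m) : iot Y0 m (x, 0) = x := by
  exact if_pos ⟨rfl, h⟩

lemma iot_big (m : ℕ) (p : PX Y0 × ℤ) (h : ¬ (p.2 = 0 ∧ p.1.2 < m)) : iot Y0 m p = (cod p, m) := by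
  exact if_neg h

lemma iot_le (m : ℕ) (p : PX Y0 × ℤ) : (iot Y0 m p).2 ≤ m := by
  by_cases h : p.2 = 0 ∧ p.1.2 < m
  · obtain ⟨x, k⟩ := p
    obtain ⟨rfl, h⟩ := h
    simp only at h
    rw [iot_small m x h]
    exact h.le
  · rw [iot_big m p h]

lemma via_mem {S : Type} (i : S ↪ PX Y0) (m : ℕ) (h : ∀ s, (i s).2 ≤ m) (σ : Perm S) :
    via i σ ∈ Gam Y0 := by
  refine ⟨m + 1, fun x hx => via_not i σ x ?_⟩
  rintro ⟨s, rfl⟩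
  have := h s
  omega

lemma eq_via_iot (m : ℕ) (σ : Perm (PX Y0)) (h : ∀ x : PX Y0, m ≤ x.2 → σ x = x) :
    σ = via (iot Y0 m) (PF (ind (fun k => k = 0) σ)) := by
  have hpres : ∀ x : PX Y0, x.2 < m → (σ x).2 < m := by
    intro x hx
    by_contra hc
    have h1 := h (σ x) (by omega)
    have := σ.injective h1
    rw [this] at hc
    omega
  ext1 x
  by_cases hx : x.2 < m
  · have h1 := iot_small m x hx
    conv_rhs => rw [← h1, via_apply]
    have : PF (ind (fun k => k = 0) σ) (x, 0) = (σ x, 0) := by simp [PF_apply, ind]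
    rw [this, iot_small m _ (hpres x hx)]
  · rw [h x (by omega)]
    by_cases hr : x ∈ Set.range (iot Y0 m)
    · obtain ⟨⟨y, k⟩, rfl⟩ := hr
      rw [via_apply, PF_apply]
      by_cases hk : k = 0
      · subst hk
        have hy : ¬ y.2 < m := fun hy => hx (by rw [iot_small m y hy]; exact hy)
        simp [ind, h y (by omega)]
      · simp [ind, hk]
    · rw [via_not _ _ _ hr]

theorem acyc_gam (Y0 : Type) : Acyc (Gam Y0) := by
  refine acyc_of_swindle (Gam Y0) (GamF Y0) ?_ ?_ ?_
  · intro m k hmk a ha x hx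
    exact ha x (le_trans hmk hx)
  · rintro ⟨a, m, hm⟩
    exact ⟨m, hm⟩
  · intro m
    let V : Perm (PX Y0 × ℤ) →* Gam Y0 := (via (iot Y0 m)).codRestrict (Gam Y0)
      (fun σ => via_mem _ m (iot_le m) σ)
    have hV : ∀ σ, ((V σ : Gam Y0) : Perm (PX Y0)) = via (iot Y0 m) σ := fun _ => rfl
    let φ : GamF Y0 m →* Gam Y0 := ((V.comp PF).comp (ind (fun k => 0 < k))).comp
      ((Gam Y0).subtype.comp (GamF Y0 m).subtype)
    have hφ : ∀ a : GamF Y0 m, φ a = V (PF (ind (fun k => 0 < k) ((a : Gam Y0) : Perm (PX Y0)))) :=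
      fun _ => rfl
    have ha : ∀ a : GamF Y0 m, (a : Gam Y0) =
        V (PF (ind (fun k => k = 0) ((a : Gam Y0) : Perm (PX Y0)))) := fun a =>
      Subtype.ext (eq_via_iot m _ a.2)
    refine ⟨φ, V (shf _), fun a b => ?_, fun a => ?_⟩
    · rw [ha, hφ]
      rw [commute_iff_eq]
      simp only [← map_mul]
      congr 2
      funext k
      by_cases h : k = 0
      · subst h; simp [ind]
      · simp [ind, h]
    · conv_rhs => rw [ha]
      rw [hφ]
      simp only [← map_mul, ← map_inv]
      rw [shf_conj]
      congr 2
      funext k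
      rcases lt_trichotomy k 1 with h | h | h
      · simp [ind, show ¬ (0 < k) by omega, show ¬ (k - 1 = 0) by omega]
        intro h; omega
      · subst h; simp [ind]
      · simp [ind, show (0 < k) by omega, show ¬ (k - 1 = 0) by omega, h]

/-- Level zero action. -/
noncomputable def lev0 (Y0 : Type) : Perm Y0 →* Gam Y0 where
  toFun σ := ⟨
    { toFun := fun x => if x.2 = 0 then ((σ x.1.1, x.1.2), x.2) else x
      invFun := fun x => if x.2 = 0 then ((σ⁻¹ x.1.1, x.1.2), x.2) else x
      left_inv := fun x => by by_cases h : x.2 = 0 <;> simp [h, Prod.ext_iff]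
      right_inv := fun x => by by_cases h : x.2 = 0 <;> simp [h, Prod.ext_iff] },
    1, fun x hx => by simp [show x.2 ≠ 0 by omega]⟩
  map_one' := by
    apply Subtype.ext; ext1 x
    by_cases h : x.2 = 0 <;> simp [h, Prod.ext_iff]
  map_mul' a b := by
    apply Subtype.ext; ext1 x
    by_cases h : x.2 = 0 <;> simp [h]

lemma lev0_apply (σ : Perm Y0) (x : Y0 × ℕ) : (lev0 Y0 σ : Perm (PX Y0)) (x, 0) = ((σ x.1, x.2), 0) := by
  simp [lev0]

lemma lev0_inj : Function.Injective (lev0 Y0) := by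
  intro a b h
  ext1 y
  have h1 := lev0_apply a (y, 0)
  rw [h, lev0_apply] at h1
  simp only [Prod.mk.injEq, and_true] at h1
  exact h1.symm

/-- Swap of two disjoint embeddings. -/
lemma exists_swap {S : Type} (i j : S ↪ PX Y0) (m : ℕ) (hi : ∀ s, (i s).2 ≤ m)
    (hj : ∀ s, (j s).2 ≤ m) (h : ∀ s t, i s ≠ j t) :
    ∃ g ∈ Gam Y0, ∀ s, g (i s) = j s := by
  let k : S ⊕ S ↪ PX Y0 := ⟨Sum.elim i j, by
    rintro (a | a) (b | b) hab
    · exact congrArg _ (i.injective hab)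
    · exact absurd hab (h a b)
    · exact absurd hab.symm (h b a)
    · exact congrArg _ (j.injective hab)⟩
  refine ⟨via k (Equiv.sumComm S S), via_mem k m (by rintro (a | a); exacts [hi a, hj a]) _, ?_⟩
  intro s
  exact via_apply k (Equiv.sumComm S S) (Sum.inl s)

/-- Normal generation. -/
theorem normal_gen (g : Gam Y0) (j : PX Y0 × ℤ ↪ PX Y0) (M : ℕ) (hj : ∀ p, (j p).2 ≤ M)
    (hj2 : ∀ p, ((g : Perm (PX Y0)) (j p)).2 ≤ M)
    (hd : ∀ p q, (g : Perm (PX Y0)) (j p) ≠ j q) : Subgroup.normalClosure {g} = ⊤ := by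
  set N := Subgroup.normalClosure {g} with hN
  have hgN : g ∈ N := Subgroup.subset_normalClosure rfl
  haveI : N.Normal := Subgroup.normalClosure_normal
  let i : PX Y0 × ℤ ↪ PX Y0 := j.trans (g : Perm (PX Y0)).toEmbedding
  have hi : ∀ p, i p = (g : Perm (PX Y0)) (j p) := fun _ => rfl
  let VI : Perm (PX Y0 × ℤ) →* Gam Y0 := (via i).codRestrict (Gam Y0) (fun σ => via_mem _ M hj2 σ)
  let VJ : Perm (PX Y0 × ℤ) →* Gam Y0 := (via j).codRestrict (Gam Y0) (fun σ => via_mem _ M hj σ)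
  have hconj : ∀ σ, g * VJ σ * g⁻¹ = VI σ := fun σ => Subtype.ext (via_conj j i _ (fun s => rfl) σ)
  have hcomm : ∀ σ τ, Commute (VI σ) (VJ τ) := fun σ τ => Subtype.ext
    (via_comm i j (fun s t => hd s t) σ τ)
  have hs : VI (shf _) * (VJ (shf _))⁻¹ ∈ N := by
    rw [← hconj, mul_assoc, mul_assoc]
    refine N.mul_mem hgN ?_
    rw [← mul_assoc]
    exact Subgroup.Normal.conj_mem inferInstance _ (N.inv_mem hgN) _
  have hcopy : ∀ h : Perm (PX Y0), VI (PF (ind (fun k => k = 0) h)) ∈ N := by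
    intro h
    set a := VI (PF (ind (fun k => 0 ≤ k) h)) with ha
    set S := VI (shf (PX Y0)) with hS
    set R := VJ (shf (PX Y0)) with hR
    have h1 : a * (S * R⁻¹) * a⁻¹ * (S * R⁻¹)⁻¹ ∈ N :=
      N.mul_mem (Subgroup.Normal.conj_mem inferInstance _ hs _) (N.inv_mem hs)
    have hc1 : Commute a R := hcomm _ _
    have h2 : a * (S * R⁻¹) * a⁻¹ * (S * R⁻¹)⁻¹ = a * (S * a⁻¹ * S⁻¹) := by
      have h3 : R⁻¹ * a⁻¹ = a⁻¹ * R⁻¹ := (hc1.inv_inv.eq).symm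
      calc a * (S * R⁻¹) * a⁻¹ * (S * R⁻¹)⁻¹ = a * (S * (R⁻¹ * a⁻¹) * R * S⁻¹) := by group
        _ = a * (S * a⁻¹ * S⁻¹) := by rw [h3]; group
    rw [h2] at h1
    convert h1 using 1
    rw [ha, hS]
    simp only [← map_mul, ← map_inv]
    rw [shf_conj, ← map_mul]
    congr 2
    funext k
    rcases lt_trichotomy k 0 with hk | hk | hk
    · simp [ind, show ¬ (0 ≤ k) by omega, show ¬ (1 ≤ k) by omega, show ¬ k = 0 by omega]
    · subst hk; simp [ind]
    · simp [ind, show (0 ≤ k) by omega, show (1 ≤ k) by omega, show ¬ k = 0 by omega]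
  rw [eq_top_iff]
  rintro ⟨h, m0, hm0⟩ -
  set m := max m0 (M + 1) with hm
  have hhm : ∀ x : PX Y0, m ≤ x.2 → h x = x := fun x hx => hm0 x (le_trans (le_max_left _ _) hx)
  -- the copy at level `m`
  let a : PX Y0 ↪ PX Y0 := ⟨fun x => iot Y0 m (x, 1), fun x y hxy => by
    have := (iot Y0 m).injective hxy
    simpa using this⟩
  have ha : ∀ x, a x = (cod (x, 1), m) := fun x => iot_big m (x, 1) (by simp)
  let b : PX Y0 ↪ PX Y0 := ⟨fun x => i (x, 0), fun x y hxy => by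
    have := i.injective hxy
    simpa using this⟩
  have hcopy' : ∀ (f : PX Y0 × ℤ ↪ PX Y0) (k : ℤ) (c : PX Y0 ↪ PX Y0) (_ : ∀ x, c x = f (x, k))
      (σ : Perm (PX Y0)), via f (PF (ind (fun l => l = k) σ)) = via c σ := by
    intro f k c hc σ
    ext1 x
    by_cases hx : x ∈ Set.range f
    · obtain ⟨⟨y, l⟩, rfl⟩ := hx
      rw [via_apply, PF_apply]
      by_cases hl : l = k
      · subst hl
        conv_rhs => rw [← hc, via_apply, hc]
        simp [ind]
      · rw [via_not c]
        · simp [ind, hl]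
        · rintro ⟨s, hs⟩
          rw [hc] at hs
          exact hl (Prod.mk.inj (f.injective hs)).2.symm
    · rw [via_not f _ _ hx, via_not c]
      rintro ⟨s, hs⟩
      rw [hc] at hs
      exact hx ⟨_, hs⟩
  obtain ⟨s, hsG, hs2⟩ := exists_swap b a m (fun x => by
      have := hj2 (x, 0)
      change ((g : Perm (PX Y0)) (j (x, 0))).2 ≤ m
      omega) (fun x => by rw [ha]) (fun x y hxy => by
      have h1 := hj2 (x, 0)
      have h2 : (b x).2 = ((g : Perm (PX Y0)) (j (x, 0))).2 := rfl
      rw [hxy, ha] at h2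
      simp only at h2
      omega)
  have hb : (⟨via b h, via_mem b M (fun x => hj2 _) h⟩ : Gam Y0) ∈ N := by
    have := hcopy h
    convert this using 1
    exact Subtype.ext (hcopy' i 0 b (fun _ => rfl) h).symm
  have ha' : (⟨via a h, via_mem a m (fun x => by rw [ha]) h⟩ : Gam Y0) ∈ N := by
    have := Subgroup.Normal.conj_mem inferInstance _ hb ⟨s, hsG⟩
    convert this using 1
    exact Subtype.ext (via_conj b a s hs2 h).symm
  have hsh : via (iot Y0 m) (shf (PX Y0)) ∈ Gam Y0 := via_mem _ m (iot_le m) _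
  have hfin : h = (via (iot Y0 m) (shf (PX Y0)))⁻¹ * via a h * (via (iot Y0 m) (shf (PX Y0))) := by
    rw [← hcopy' (iot Y0 m) 1 a (fun _ => rfl) h]
    conv_lhs => rw [eq_via_iot m h hhm]
    rw [mul_assoc, eq_inv_mul_iff_mul_eq, ← mul_inv_eq_iff_eq_mul]
    simp only [← map_mul, ← map_inv]
    rw [shf_conj]
    congr 2
    funext k
    simp only [ind, MonoidHom.coe_mk, OneHom.coe_mk, sub_eq_zero]
  have := Subgroup.Normal.conj_mem inferInstance _ ha' (⟨_, hsh⟩⁻¹ : Gam Y0)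
  convert this using 1
  apply Subtype.ext
  simpa using hfin

end perm

end BDM

namespace BDM
open Finsupp

/-! ### Amalgams -/

/-- Characterisation of amalgamated products. -/
structure IsAmalg {C A B Γ : Type} [Group C] [Group A] [Group B] [Group Γ] (iA : C →* A) (iB : C →* B)
    (jA : A →* Γ) (jB : B →* Γ) : Prop where
  iA_inj : Function.Injective iA
  iB_inj : Function.Injective iB
  jA_inj : Function.Injective jA
  jB_inj : Function.Injective jB
  comm : ∀ c, jA (iA c) = jB (iB c)
  gen : ∀ S : Subgroup Γ, (∀ a, jA a ∈ S) → (∀ b, jB b ∈ S) → S = ⊤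
  lift : ∀ {K : Type} [Group K] (f : A →* K) (g : B →* K), (∀ c, f (iA c) = g (iB c)) →
    ∃ h : Γ →* K, (∀ a, h (jA a) = f a) ∧ (∀ b, h (jB b) = g b)

/-- The two factors as a family. -/
abbrev Fam (A B : Type) : Bool → Type := fun t => Bool.rec A B t

instance famGroup (A B : Type) [Group A] [Group B] : ∀ t, Group (Fam A B t)
  | false => inferInstanceAs (Group A)
  | true => inferInstanceAs (Group B)

/-- Homs on the family. -/
def famHom {C A B : Type} [Group C] [Group A] [Group B] (iA : C →* A) (iB : C →* B) :
    ∀ t, C →* Fam A B t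
  | false => iA
  | true => iB

/-- Homs from the family. -/
def famHomTo {K A B : Type} [Group K] [Group A] [Group B] (iA : A →* K) (iB : B →* K) :
    ∀ t, Fam A B t →* K
  | false => iA
  | true => iB

theorem exists_amalg {C A B : Type} [Group C] [Group A] [Group B] (iA : C →* A) (iB : C →* B)
    (hA : Function.Injective iA) (hB : Function.Injective iB) :
    ∃ (Γ : Type) (_ : Group Γ) (jA : A →* Γ) (jB : B →* Γ), IsAmalg iA iB jA jB := by
  let φ := famHom iA iB
  have hφ : ∀ t, Function.Injective (φ t) := by
    intro t; cases t
    · exact hA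
    · exact hB
  let jA : A →* Monoid.PushoutI φ := Monoid.PushoutI.of (φ := φ) false
  let jB : B →* Monoid.PushoutI φ := Monoid.PushoutI.of (φ := φ) true
  have hjA : ∀ c, jA (iA c) = Monoid.PushoutI.base φ c := fun c =>
    Monoid.PushoutI.of_apply_eq_base φ false c
  have hjB : ∀ c, jB (iB c) = Monoid.PushoutI.base φ c := fun c =>
    Monoid.PushoutI.of_apply_eq_base φ true c
  refine ⟨Monoid.PushoutI φ, inferInstance, jA, jB, hA, hB,
    Monoid.PushoutI.of_injective hφ false, Monoid.PushoutI.of_injective hφ true, fun c => ?_, ?_, ?_⟩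
  · rw [hjA, hjB]
  · intro S h1 h2
    rw [eq_top_iff]
    rintro x -
    induction x using Monoid.PushoutI.induction_on with
    | of t g =>
      cases t
      · exact h1 g
      · exact h2 g
    | base h => rw [← hjA]; exact h1 _
    | mul x y hx hy => exact S.mul_mem hx hy
  · intro K _ f g hfg
    refine ⟨Monoid.PushoutI.lift (famHomTo f g) (f.comp iA) ?_, ?_, ?_⟩
    · intro t
      cases t
      · rfl
      · ext c; exact (hfg c).symm
    · intro a
      exact Monoid.PushoutI.lift_of (famHomTo f g) (f.comp iA) _ (i := false) a
    · intro b
      exact Monoid.PushoutI.lift_of (famHomTo f g) (f.comp iA) _ (i := true) b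

/-! ### Derivations -/

section deriv
variable {Γ X : Type} [Group Γ] [MulAction Γ X]

/-- The action as permutations. -/
noncomputable def actP : Γ →* Equiv.Perm (X →₀ ℤ) where
  toFun g :=
    { toFun := act g
      invFun := act g⁻¹
      left_inv := fun c => by rw [← act_mul]; simp
      right_inv := fun c => by rw [← act_mul]; simp }
  map_one' := by ext1 c; exact act_one c
  map_mul' a b := by ext1 c; exact act_mul a b c

/-- The permutations that are affine over the given group. -/
def affS (Ψ : Γ →* Equiv.Perm (X →₀ ℤ)) : Subgroup Γ where
  carrier := {γ | ∀ m, Ψ γ m = act γ m + Ψ γ 0}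
  one_mem' := fun m => by simp
  mul_mem' := by
    intro a b ha hb m
    rw [map_mul, Equiv.Perm.mul_apply, Equiv.Perm.mul_apply, hb m, ha (act b m + _), ha (Ψ b 0),
      map_add, ← act_mul, add_assoc]
  inv_mem' := by
    intro a ha m
    rw [map_inv, Equiv.Perm.inv_eq_iff_eq, ha, map_add, ← act_mul, mul_inv_cancel, act_one, add_assoc,
      ← ha]; simp

lemma affS_mul (Ψ : Γ →* Equiv.Perm (X →₀ ℤ)) (h : affS Ψ = ⊤) (a b : Γ) :
    Ψ (a * b) 0 = Ψ a 0 + act a (Ψ b 0) := by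
  have : a ∈ affS Ψ := h ▸ Subgroup.mem_top a
  rw [map_mul, Equiv.Perm.mul_apply, this, add_comm]

/-- Conjugate of the action by a translation. -/
noncomputable def trP (m : X →₀ ℤ) : Γ →* Equiv.Perm (X →₀ ℤ) :=
  (MulAut.conj (Equiv.addLeft m)).toMonoidHom.comp actP

lemma trP_apply (m : X →₀ ℤ) (g : Γ) (c : X →₀ ℤ) : trP m g c = m + act g (-m + c) := rfl

/-- Two derivations agree. -/
lemma deriv_subgroup {M : Type} [AddCommGroup M] (D D' : Γ → M) (α : Γ → M →+ M)
    (h1 : ∀ a b, D (a * b) = D a + α a (D b)) (h2 : ∀ a b, D' (a * b) = D' a + α a (D' b))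
    (hα : ∀ a b m, α a (α b m) = α (a * b) m) (hα1 : ∀ m, α 1 m = m) :
    ∃ S : Subgroup Γ, ∀ γ, γ ∈ S ↔ D γ = D' γ := by
  have e1 : D 1 = 0 := by
    have := h1 1 1
    rw [hα1, mul_one] at this
    simpa using this
  have e2 : D' 1 = 0 := by
    have := h2 1 1
    rw [hα1, mul_one] at this
    simpa using this
  have inv : ∀ (D : Γ → M), (∀ a b, D (a * b) = D a + α a (D b)) → D 1 = 0 → ∀ a,
      D a⁻¹ = - α a⁻¹ (D a) := by
    intro D h e a
    have := h a⁻¹ a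
    rw [inv_mul_cancel, e] at this
    exact eq_neg_of_add_eq_zero_left this.symm
  refine ⟨⟨⟨⟨{γ | D γ = D' γ}, ?_⟩, ?_⟩, ?_⟩, fun γ => Iff.rfl⟩
  · intro a b ha hb
    simp only [Set.mem_ofPred_eq] at ha hb ⊢
    rw [h1, h2, ha, hb]
  · simp only [Set.mem_ofPred_eq]
    rw [e1, e2]
  · intro a ha
    simp only [Set.mem_ofPred_eq] at ha ⊢
    rw [inv D h1 e1, inv D' h2 e2, ha]

/-- If a derivation agrees with a principal one on generators, it does so everywhere. -/
lemma deriv_principal {Y : Type} [MulAction Γ Y] (D : Γ → (X →₀ ℤ))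
    (hD : ∀ a b, D (a * b) = D a + act a (D b)) (L : (X →₀ ℤ) →ₗ[ℤ] (Y →₀ ℤ)) (hL : Eqv Γ L)
    (m : Y →₀ ℤ) : ∃ S : Subgroup Γ, ∀ γ, γ ∈ S ↔ L (D γ) = act γ m - m :=
  deriv_subgroup (fun γ => L (D γ)) (fun γ => act γ m - m) (fun γ => (act γ).toAddMonoidHom)
    (fun a b => by rw [hD, map_add, hL]; rfl)
    (fun a b => by
      simp only [LinearMap.toAddMonoidHom_coe]
      rw [map_sub, ← act_mul]; abel)
    (fun a b m => (act_mul a b m).symm) (fun m => act_one m)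

end deriv

end BDM

namespace BDM
open Finsupp

section lmsec
variable {Γ X Y : Type} [Group Γ] [MulAction Γ X] [MulAction Γ Y] {n : ℕ}

/-- Linearisation of a map. -/
noncomputable def lm (f : X → Y) : (X →₀ ℤ) →ₗ[ℤ] (Y →₀ ℤ) := Finsupp.lmapDomain ℤ ℤ f

@[simp] lemma lm_single (f : X → Y) (x : X) (a : ℤ) : lm f (single x a) = single (f x) a := by
  simp [lm]

lemma lm_eqv (f : X → Y) (h : ∀ (g : Γ) x, f (g • x) = g • f x) : Eqv Γ (lm f) :=
  eqv_of_single (fun g x => by simp [h])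

/-- Augmentation. -/
noncomputable def aug : (X →₀ ℤ) →ₗ[ℤ] (Unit →₀ ℤ) := lm (fun _ => ())

lemma aug_eqv : Eqv Γ (aug : (X →₀ ℤ) →ₗ[ℤ] (Unit →₀ ℤ)) := lm_eqv _ (fun _ _ => rfl)

lemma lam_lm_e (f : X → Y) (h : Eqv Γ (lm f)) (v : Fin n → Γ) (x : X) :
    lam (lm f) h n (e v x) = e v (f x) := by
  rw [← pr_single, lam_pr, lm_single, pr_single]

lemma act_single_mk (H : Subgroup Γ) (g γ : Γ) (a : ℤ) :
    act g (single (γ : Γ ⧸ H) a) = single ((g * γ : Γ) : Γ ⧸ H) a := by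
  rw [act_single]; rfl

/-- Linear extension from a quotient. -/
noncomputable def qlin {M : Type} [AddCommGroup M] (H : Subgroup Γ) (F : Γ → M)
    (h : ∀ γ, ∀ g ∈ H, F (γ * g) = F γ) : ((Γ ⧸ H) →₀ ℤ) →ₗ[ℤ] M :=
  Finsupp.lsum ℤ (fun x => (LinearMap.toSpanSingleton ℤ M (Quotient.liftOn' x F (fun a b hab => by
    have := h a (a⁻¹ * b) (QuotientGroup.leftRel_apply.1 hab)
    rw [mul_inv_cancel_left] at this
    exact this.symm))))

lemma qlin_single {M : Type} [AddCommGroup M] (H : Subgroup Γ) (F : Γ → M)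
    (h : ∀ γ, ∀ g ∈ H, F (γ * g) = F γ) (γ : Γ) : qlin H F h (single (γ : Γ ⧸ H) 1) = F γ := by
  simp only [qlin, Finsupp.lsum_single, LinearMap.toSpanSingleton_apply, one_smul]
  rfl

lemma q_ext {M : Type} [AddCommGroup M] {H : Subgroup Γ} {f g : ((Γ ⧸ H) →₀ ℤ) →ₗ[ℤ] M}
    (h : ∀ γ : Γ, f (single (γ : Γ ⧸ H) 1) = g (single (γ : Γ ⧸ H) 1)) : f = g := by
  refine Finsupp.lhom_ext' fun x => LinearMap.ext_ring ?_
  obtain ⟨γ, rfl⟩ := QuotientGroup.mk_surjective x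
  exact h γ

end lmsec

section amalg
variable {C A B Γ : Type} [Group C] [Group A] [Group B] [Group Γ] {iA : C →* A} {iB : C →* B}
    {jA : A →* Γ} {jB : B →* Γ}

lemma IsAmalg.exists_deriv (h : IsAmalg iA iB jA jB) :
    ∃ D : Γ → ((Γ ⧸ (jA.comp iA).range) →₀ ℤ), (∀ a b, D (a * b) = D a + act a (D b)) ∧
      (∀ a, D (jA a) = 0) ∧ ∀ b, D (jB b) = single ((jB b : Γ) : Γ ⧸ (jA.comp iA).range) 1 -
        single ((1 : Γ) : Γ ⧸ (jA.comp iA).range) 1 := by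
  set E : (Γ ⧸ (jA.comp iA).range) →₀ ℤ := single ((1 : Γ) : Γ ⧸ (jA.comp iA).range) 1 with hE
  have hEC : ∀ c, act (jB (iB c)) E = E := by
    intro c
    rw [hE, act_single_mk, mul_one]
    congr 1
    rw [QuotientGroup.eq, mul_one, Subgroup.inv_mem_iff]
    exact ⟨c, h.comm c⟩
  obtain ⟨Ψ, hA, hB⟩ := h.lift (actP.comp jA : A →* Equiv.Perm ((Γ ⧸ (jA.comp iA).range) →₀ ℤ))
    ((trP (-E)).comp jB) (fun c => by
      ext1 m
      change act (jA (iA c)) m = -E + act (jB (iB c)) (- -E + m)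
      rw [map_add, neg_neg, hEC, h.comm]
      abel)
  have hA' : ∀ a m, Ψ (jA a) m = act (jA a) m := fun a m => by rw [hA]; rfl
  have hB' : ∀ b m, Ψ (jB b) m = -E + act (jB b) (- -E + m) := fun a m => by rw [hB]; rfl
  have htop : affS Ψ = ⊤ := h.gen _
    (fun a m => by rw [hA', hA', map_zero, add_zero])
    (fun b m => by rw [hB', hB', map_add, add_zero]; abel)
  refine ⟨fun γ => Ψ γ 0, affS_mul Ψ htop, fun a => (hA' a 0).trans (map_zero _), fun b => ?_⟩
  refine (hB' b 0).trans ?_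
  rw [hE, add_zero, neg_neg, act_single_mk, mul_one]
  abel

lemma jle_A : (jA.comp iA).range ≤ jA.range := by
  rintro _ ⟨c, rfl⟩
  exact ⟨iA c, rfl⟩

lemma IsAmalg.jle_B (h : IsAmalg iA iB jA jB) : (jA.comp iA).range ≤ jB.range := by
  rintro _ ⟨c, rfl⟩
  exact ⟨iB c, (h.comm c).symm⟩

/-- Projection between coset spaces. -/
noncomputable def qm {H K : Subgroup Γ} (h : H ≤ K) : ((Γ ⧸ H) →₀ ℤ) →ₗ[ℤ] ((Γ ⧸ K) →₀ ℤ) :=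
  lm (Subgroup.quotientMapOfLE h)

lemma qm_single {H K : Subgroup Γ} (h : H ≤ K) (γ : Γ) (a : ℤ) :
    qm h (single (γ : Γ ⧸ H) a) = single (γ : Γ ⧸ K) a := by
  rw [qm, lm_single]; rfl

lemma qm_eqv {H K : Subgroup Γ} (h : H ≤ K) : Eqv Γ (qm h) := by
  apply lm_eqv
  intro g x
  obtain ⟨γ, rfl⟩ := QuotientGroup.mk_surjective x
  rfl

/-- The basic exactness statement. -/
lemma IsAmalg.exact (h : IsAmalg iA iB jA jB) :
    (∀ y : (Γ ⧸ (jA.comp iA).range) →₀ ℤ, qm jle_A y = 0 → qm h.jle_B y = 0 → y = 0) ∧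
    (∀ u v, aug u = aug v → ∃ y : (Γ ⧸ (jA.comp iA).range) →₀ ℤ, qm jle_A y = u ∧
      qm h.jle_B y = v) := by
  obtain ⟨D, hD, hDA, hDB⟩ := h.exists_deriv
  let DA : ((Γ ⧸ jA.range) →₀ ℤ) →ₗ[ℤ] ((Γ ⧸ (jA.comp iA).range) →₀ ℤ) := qlin jA.range D (by
    rintro γ _ ⟨a, rfl⟩
    rw [hD, hDA, map_zero, add_zero])
  let DB : ((Γ ⧸ jB.range) →₀ ℤ) →ₗ[ℤ] ((Γ ⧸ (jA.comp iA).range) →₀ ℤ) := qlin jB.range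
    (fun γ => D γ - single ((γ : Γ) : Γ ⧸ (jA.comp iA).range) 1) (by
    rintro γ _ ⟨b, rfl⟩
    rw [hD, hDB, map_sub, act_single_mk, act_single_mk, mul_one]
    abel)
  have hA : ∀ γ : Γ, DA (single (γ : Γ ⧸ jA.range) 1) = D γ := fun γ => qlin_single _ _ _ _
  have hB : ∀ γ : Γ, DB (single (γ : Γ ⧸ jB.range) 1) = D γ -
    single ((γ : Γ) : Γ ⧸ (jA.comp iA).range) 1 := fun γ => qlin_single _ _ _ _
  have pA : ∀ γ, qm jle_A (D γ) = single (γ : Γ ⧸ jA.range) 1 - single ((1 : Γ) : Γ ⧸ jA.range) 1 := by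
    obtain ⟨S, hS⟩ := deriv_principal D hD (qm jle_A) (qm_eqv _)
      (single ((1 : Γ) : Γ ⧸ jA.range) 1)
    have hS2 : S = ⊤ := h.gen S
      (fun a => by
        rw [hS, hDA, map_zero, act_single_mk, mul_one]
        symm
        rw [sub_eq_zero]
        congr 1
        rw [QuotientGroup.eq, mul_one, Subgroup.inv_mem_iff]
        exact ⟨a, rfl⟩)
      (fun b => by rw [hS, hDB, map_sub, qm_single, qm_single, act_single_mk, mul_one])
    intro γ
    have := (hS γ).1 (hS2 ▸ Subgroup.mem_top γ)
    rwa [act_single_mk, mul_one] at this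
  have pB : ∀ γ, qm h.jle_B (D γ) = 0 := by
    obtain ⟨S, hS⟩ := deriv_principal D hD (qm h.jle_B) (qm_eqv _) 0
    have hS2 : S = ⊤ := h.gen S
      (fun a => by rw [hS, hDA]; simp)
      (fun b => by
        rw [hS, hDB, map_sub, qm_single, qm_single]
        simp only [map_zero, sub_zero]
        rw [sub_eq_zero]
        congr 1
        rw [QuotientGroup.eq, mul_one, Subgroup.inv_mem_iff]
        exact ⟨b, rfl⟩)
    intro γ
    have := (hS γ).1 (hS2 ▸ Subgroup.mem_top γ)
    simpa using this
  constructor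
  · intro y h1 h2
    have : DA.comp (qm jle_A) - DB.comp (qm h.jle_B) = LinearMap.id := by
      apply q_ext; intro γ
      simp only [LinearMap.sub_apply, LinearMap.comp_apply, qm_single, hA, hB, LinearMap.id_apply]
      abel
    have := LinearMap.congr_fun this y
    simpa [h1, h2] using this.symm
  · intro u v huv
    let σ : (Unit →₀ ℤ) →ₗ[ℤ] ((Γ ⧸ jA.range) →₀ ℤ) := lm (fun _ => ((1 : Γ) : Γ ⧸ jA.range))
    have e1 : ∀ u, qm jle_A (DA u) = u - σ (aug u) := by
      intro u
      have : (qm jle_A).comp DA = LinearMap.id - σ.comp aug := by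
        apply q_ext; intro γ
        simp [hA, pA, σ, aug]
      exact LinearMap.congr_fun this u
    have e2 : ∀ v, qm jle_A (DB v) = - σ (aug v) := by
      intro v
      have : (qm jle_A).comp DB = - σ.comp aug := by
        apply q_ext; intro γ
        simp [hB, pA, σ, aug, qm_single]
      exact LinearMap.congr_fun this v
    have e3 : ∀ u, qm h.jle_B (DA u) = 0 := by
      intro v
      have : (qm h.jle_B).comp DA = 0 := by
        apply q_ext; intro γ
        simp [hA, pB]
      exact LinearMap.congr_fun this v
    have e4 : ∀ u, qm h.jle_B (DB u) = - u := by
      intro v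
      have : (qm h.jle_B).comp DB = - LinearMap.id := by
        apply q_ext; intro γ
        simp [hB, pB, qm_single]
      exact LinearMap.congr_fun this v
    refine ⟨DA u - DB v, ?_, ?_⟩
    · rw [map_sub, e1, e2, huv]; abel
    · rw [map_sub, e3, e4]; abel

end amalg

end BDM

namespace BDM
open Finsupp

section shq
variable {A Γ : Type} [Group A] [Group Γ] {n : ℕ}

/-- Shapiro map for a homomorphism. -/
noncomputable def shq (j : A →* Γ) (n : ℕ) : Ch A Unit n →ₗ[ℤ] Ch Γ (Γ ⧸ j.range) n :=
  (shp j.range n).comp (gmap j.rangeRestrict n)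

lemma shq_e (j : A →* Γ) (v : Fin n → A) (x : Unit) :
    shq j n (e v x) = e (fun i => j (v i)) ((1 : Γ) : Γ ⧸ j.range) := by
  rw [shq, LinearMap.comp_apply, gmap_e, shp_e]; rfl

lemma d_shq (j : A →* Γ) (c : Ch A Unit (n + 1)) : d n (shq j (n + 1) c) = shq j n (d n c) := by
  rw [shq, LinearMap.comp_apply, d_shp, d_gmap]; rfl

lemma exists_rinv (j : A →* Γ) (hj : Function.Injective j) : ∃ k : j.range →* A,
    (∀ a, k (j.rangeRestrict a) = a) ∧ ∀ b, j.rangeRestrict (k b) = b := by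
  let E := MonoidHom.ofInjective hj
  refine ⟨E.symm.toMonoidHom, fun a => ?_, fun b => ?_⟩
  · exact E.symm_apply_apply a
  · exact E.apply_symm_apply b

lemma shq_inj (j : A →* Γ) (hj : Function.Injective j) (z : Ch A Unit n) (h : IsB (shq j n z)) :
    IsB z := by
  obtain ⟨k, hk, -⟩ := exists_rinv j hj
  have h1 := (shp_inj _ _ h).gmap k
  rwa [gmap_gmap _ _ (MonoidHom.id A) hk, gmap_id _ (fun _ => rfl)] at h1

lemma shq_surj (j : A →* Γ) (hj : Function.Injective j) (w : Ch Γ (Γ ⧸ j.range) (n + 1))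
    (h : d n w = 0) : ∃ z : Ch A Unit (n + 1), d n z = 0 ∧ IsB (w - shq j (n + 1) z) := by
  obtain ⟨k, -, hk⟩ := exists_rinv j hj
  obtain ⟨z, hz, hz2⟩ := shp_surj _ w h
  refine ⟨gmap k _ z, by rw [d_gmap, hz, map_zero], ?_⟩
  rwa [shq, LinearMap.comp_apply, gmap_gmap _ _ (MonoidHom.id _) hk, gmap_id _ (fun _ => rfl)]

/-- A coset module over a subgroup without homology has no homology. -/
lemma isB_of_shq (j : A →* Γ) (hj : Function.Injective j)
    (h : ∀ z : Ch A Unit (n + 1), d n z = 0 → IsB z) (w : Ch Γ (Γ ⧸ j.range) (n + 1))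
    (hw : d n w = 0) : IsB w := by
  obtain ⟨z, hz, hz2⟩ := shq_surj j hj w hw
  obtain ⟨t, ht⟩ := h z hz
  exact hz2.of_sub ⟨shq j _ t, by rw [d_shq, ht]⟩

lemma lam_aug_shq (j : A →* Γ) (c : Ch A Unit n) :
    lam aug aug_eqv n (shq j n c) = gmap j n c := by
  have : (lam aug aug_eqv n).comp (shq j n) = gmap j n := by
    apply ch_ext; intro v x
    rw [LinearMap.comp_apply, shq_e, gmap_e]
    exact lam_lm_e _ _ _ _
  exact LinearMap.congr_fun this c

end shq

section les
variable {C A B Γ : Type} [Group C] [Group A] [Group B] [Group Γ] {iA : C →* A} {iB : C →* B}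
    {jA : A →* Γ} {jB : B →* Γ} {n : ℕ}

/-- chain maps of the Mayer-Vietoris sequence -/
noncomputable def mvA (iA : C →* A) (jA : A →* Γ) (n : ℕ) :
    Ch Γ (Γ ⧸ (jA.comp iA).range) n →ₗ[ℤ] Ch Γ (Γ ⧸ jA.range) n := lam (qm jle_A) (qm_eqv _) n

/-- chain maps of the Mayer-Vietoris sequence -/
noncomputable def mvB (h : IsAmalg iA iB jA jB) (n : ℕ) :
    Ch Γ (Γ ⧸ (jA.comp iA).range) n →ₗ[ℤ] Ch Γ (Γ ⧸ jB.range) n := lam (qm h.jle_B) (qm_eqv _) n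

/-- chain maps of the Mayer-Vietoris sequence -/
noncomputable def mvE (X : Type) [MulAction Γ X] (n : ℕ) :
    Ch Γ X n →ₗ[ℤ] Ch Γ Unit n := lam aug aug_eqv n

lemma d_mvA (c : Ch Γ (Γ ⧸ (jA.comp iA).range) (n + 1)) : d n (mvA iA jA (n + 1) c) = mvA iA jA n (d n c) :=
  d_lam _ _ _

lemma d_mvB (h : IsAmalg iA iB jA jB) (c : Ch Γ (Γ ⧸ (jA.comp iA).range) (n + 1)) :
    d n (mvB h (n + 1) c) = mvB h n (d n c) := d_lam _ _ _

lemma d_mvE (X : Type) [MulAction Γ X] (c : Ch Γ X (n + 1)) :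
    d n (mvE X (n + 1) c) = mvE X n (d n c) := d_lam _ _ _

lemma aug_qm {H K : Subgroup Γ} (h : H ≤ K) (c : (Γ ⧸ H) →₀ ℤ) : aug (qm h c) = aug c := by
  have : aug.comp (qm h) = aug := by
    apply q_ext; intro γ
    simp [qm_single, aug]
  exact LinearMap.congr_fun this c

lemma mvE_mvA (c : Ch Γ (Γ ⧸ (jA.comp iA).range) n) : mvE _ n (mvA iA jA n c) = mvE _ n c :=
  lam_comp _ _ _ _ _ _ (aug_qm _) _

lemma mvE_mvB (h : IsAmalg iA iB jA jB) (c : Ch Γ (Γ ⧸ (jA.comp iA).range) n) :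
    mvE _ n (mvB h n c) = mvE _ n c :=
  lam_comp _ _ _ _ _ _ (aug_qm _) _

lemma mvA_shq (c : Ch C Unit n) : mvA iA jA n (shq (jA.comp iA) n c) = shq jA n (gmap iA n c) := by
  have : (mvA iA jA n).comp (shq (jA.comp iA) n) = (shq jA n).comp (gmap iA n) := by
    apply ch_ext; intro v x
    rw [LinearMap.comp_apply, LinearMap.comp_apply, shq_e, gmap_e, shq_e]
    exact lam_lm_e _ _ _ _
  exact LinearMap.congr_fun this c

lemma mvB_shq (h : IsAmalg iA iB jA jB) (c : Ch C Unit n) :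
    mvB h n (shq (jA.comp iA) n c) = shq jB n (gmap iB n c) := by
  have : (mvB h n).comp (shq (jA.comp iA) n) = (shq jB n).comp (gmap iB n) := by
    apply ch_ext; intro v x
    rw [LinearMap.comp_apply, LinearMap.comp_apply, shq_e, gmap_e, shq_e]
    refine (lam_lm_e _ _ _ _).trans ?_
    congr 1
    funext i
    exact h.comm _
  exact LinearMap.congr_fun this c

lemma mv_inj (h : IsAmalg iA iB jA jB) (c : Ch Γ (Γ ⧸ (jA.comp iA).range) (n + 1))
    (h1 : mvA iA jA _ c = 0) (h2 : mvB h _ c = 0) : c = 0 := by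
  have h1 := (toK_lam (qm jle_A) (qm_eqv _) c).symm.trans (congrArg (toK n) h1)
  have h2 := (toK_lam (qm h.jle_B) (qm_eqv _) c).symm.trans (congrArg (toK n) h2)
  rw [map_zero] at h1 h2
  rw [← fromK_toK c]
  have : toK n c = 0 := by
    ext1 w
    apply h.exact.1
    · have := DFunLike.congr_fun h1 w
      simpa using this
    · have := DFunLike.congr_fun h2 w
      simpa using this
  rw [this, map_zero]

lemma mv_exact (h : IsAmalg iA iB jA jB) (u : Ch Γ (Γ ⧸ jA.range) (n + 1))
    (v : Ch Γ (Γ ⧸ jB.range) (n + 1)) (huv : mvE _ _ u = mvE _ _ v) :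
    ∃ c, mvA iA jA (n + 1) c = u ∧ mvB h (n + 1) c = v := by
  classical
  have h1 := (toK_lam aug aug_eqv u).symm.trans ((congrArg (toK n) huv).trans (toK_lam aug aug_eqv v))
  have h2 : ∀ w, ∃ x, qm jle_A x = toK n u w ∧ qm h.jle_B x = toK n v w := fun w => h.exact.2 _ _ (by
    have := DFunLike.congr_fun h1 w
    simpa using this)
  choose x hx hx2 using h2
  refine ⟨∑ w ∈ (toK n u).support ∪ (toK n v).support, fromK n (single w (x w)), ?_, ?_⟩
  · rw [map_sum]
    simp only [fromK_single, mvA, lam_pr, hx]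
    rw [← fromK_toK u]
    conv_rhs => rw [← Finsupp.sum_single (toK n u), Finsupp.sum_of_support_subset _
      (Finset.subset_union_left (s₂ := (toK n v).support)) _ (by simp), map_sum]
    simp only [fromK_single, fromK_toK]
  · rw [map_sum]
    simp only [fromK_single, mvB, lam_pr, hx2]
    rw [← fromK_toK v]
    conv_rhs => rw [← Finsupp.sum_single (toK n v), Finsupp.sum_of_support_subset _
      (Finset.subset_union_right (s₁ := (toK n u).support)) _ (by simp), map_sum]
    simp only [fromK_single, fromK_toK]

lemma aug_surj (j : A →* Γ) (y : Unit →₀ ℤ) : ∃ x : (Γ ⧸ j.range) →₀ ℤ, aug x = y := by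
  refine ⟨lm (fun _ => ((1 : Γ) : Γ ⧸ j.range)) y, ?_⟩
  have : aug.comp (lm (fun _ : Unit => ((1 : Γ) : Γ ⧸ j.range))) = LinearMap.id := by
    refine Finsupp.lhom_ext' fun t => LinearMap.ext_ring ?_
    simp [aug]
  exact LinearMap.congr_fun this y

/-- The connecting relation. -/
def Conn (h : IsAmalg iA iB jA jB) (n : ℕ) (z : Ch Γ Unit (n + 1)) (y : Ch C Unit n) : Prop :=
  ∃ (u : Ch Γ (Γ ⧸ jA.range) (n + 1)) (v : Ch Γ (Γ ⧸ jB.range) (n + 1)),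
    mvE _ _ u - mvE _ _ v = z ∧ d n u = mvA iA jA n (shq (jA.comp iA) n y) ∧
    d n v = mvB h n (shq (jA.comp iA) n y)

lemma Conn.sub {h : IsAmalg iA iB jA jB} {z z' : Ch Γ Unit (n + 1)} {y y' : Ch C Unit n}
    (h1 : Conn h n z y) (h2 : Conn h n z' y') : Conn h n (z - z') (y - y') := by
  obtain ⟨u, v, a1, a2, a3⟩ := h1
  obtain ⟨u', v', b1, b2, b3⟩ := h2
  refine ⟨u - u', v - v', ?_, ?_, ?_⟩
  · simp only [map_sub, ← a1, ← b1]; abel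
  · simp only [map_sub, a2, b2]
  · simp only [map_sub, a3, b3]

lemma jC_inj (h : IsAmalg iA iB jA jB) : Function.Injective (jA.comp iA) := h.jA_inj.comp h.iA_inj

lemma Conn.exists_right (h : IsAmalg iA iB jA jB) (z : Ch Γ Unit (n + 3)) (hz : d _ z = 0) :
    ∃ y : Ch C Unit (n + 2), d _ y = 0 ∧ Conn h (n + 2) z y := by
  obtain ⟨u0, hu0⟩ := lam_surj aug aug_eqv (aug_surj jA) z
  change mvE _ _ u0 = z at hu0
  obtain ⟨y0, hy1, hy2⟩ := mv_exact h (d _ u0) 0 (by rw [← d_mvE, hu0, hz, map_zero])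
  have hy0 : d _ y0 = 0 := mv_inj h _ (by rw [← d_mvA, hy1, d_d]) (by rw [← d_mvB, hy2, map_zero])
  obtain ⟨y, hy, t, ht⟩ := shq_surj _ (jC_inj h) y0 hy0
  refine ⟨y, hy, u0 - mvA iA jA _ t, - mvB h _ t, ?_, ?_, ?_⟩
  · rw [map_sub, map_neg, mvE_mvA, mvE_mvB, hu0]; abel
  · rw [map_sub, d_mvA, ht, map_sub, hy1]; abel
  · rw [map_neg, d_mvB, ht, map_sub, hy2]; abel

lemma Conn.exists_left (h : IsAmalg iA iB jA jB) (y : Ch C Unit (n + 2))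
    (h1 : IsB (gmap iA _ y)) (h2 : IsB (gmap iB _ y)) :
    ∃ z : Ch Γ Unit (n + 3), d _ z = 0 ∧ Conn h (n + 2) z y := by
  obtain ⟨u, hu⟩ := h1
  obtain ⟨v, hv⟩ := h2
  have e1 : d (n + 2) (shq jA _ u) = mvA iA jA (n + 2) (shq (jA.comp iA) (n + 2) y) := by
    rw [d_shq, hu, mvA_shq]
  have e2 : d (n + 2) (shq jB _ v) = mvB h (n + 2) (shq (jA.comp iA) (n + 2) y) := by
    rw [d_shq, hv, mvB_shq]
  refine ⟨mvE _ _ (shq jA _ u) - mvE _ _ (shq jB _ v), ?_, _, _, rfl, e1, e2⟩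
  rw [map_sub, d_mvE, d_mvE, e1, e2, mvE_mvA, mvE_mvB, sub_self]

lemma Conn.isB_right {h : IsAmalg iA iB jA jB} {z : Ch Γ Unit (n + 3)} {y : Ch C Unit (n + 2)}
    (hc : Conn h (n + 2) z y) (hz : IsB z) : IsB y := by
  obtain ⟨u, v, h1, h2, h3⟩ := hc
  obtain ⟨z', hz'⟩ := hz
  obtain ⟨p, hp⟩ := lam_surj aug aug_eqv (aug_surj jA) z'
  change mvE _ _ p = z' at hp
  obtain ⟨t, ht1, ht2⟩ := mv_exact h (u - d _ p) v (by
    rw [map_sub, ← d_mvE, hp, hz', ← h1]; abel)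
  refine shq_inj _ (jC_inj h) y ⟨t, ?_⟩
  rw [← sub_eq_zero]
  apply mv_inj h
  · rw [map_sub, ← d_mvA, ht1, map_sub, d_d, sub_zero, h2, sub_self]
  · rw [map_sub, ← d_mvB, ht2, h3, sub_self]

lemma Conn.isB_left {h : IsAmalg iA iB jA jB} {z : Ch Γ Unit (n + 3)} {y : Ch C Unit (n + 2)}
    (hA : ∀ c : Ch A Unit (n + 3), d _ c = 0 → IsB c) (hB : ∀ c : Ch B Unit (n + 3), d _ c = 0 → IsB c)
    (hc : Conn h (n + 2) z y) (hy : IsB y) : IsB z := by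
  obtain ⟨u, v, h1, h2, h3⟩ := hc
  obtain ⟨t, ht⟩ := hy
  obtain ⟨p, hp⟩ := isB_of_shq jA h.jA_inj hA (u - mvA iA jA _ (shq _ _ t)) (by
    rw [map_sub, h2, d_mvA, d_shq, ht, sub_self])
  obtain ⟨q, hq⟩ := isB_of_shq jB h.jB_inj hB (v - mvB h _ (shq _ _ t)) (by
    rw [map_sub, h3, d_mvB, d_shq, ht, sub_self])
  refine ⟨mvE _ _ p - mvE _ _ q, ?_⟩
  rw [map_sub, d_mvE, d_mvE, hp, hq, map_sub, map_sub, mvE_mvA, mvE_mvB, ← h1]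
  abel

/-- What is needed of `y` when it comes from a connecting relation. -/
lemma Conn.isB_images {h : IsAmalg iA iB jA jB} {z : Ch Γ Unit (n + 1)} {y : Ch C Unit n}
    (hc : Conn h n z y) : IsB (gmap iA _ y) ∧ IsB (gmap iB _ y) := by
  obtain ⟨u, v, h1, h2, h3⟩ := hc
  rw [mvA_shq] at h2
  rw [mvB_shq] at h3
  exact ⟨shq_inj _ h.jA_inj _ ⟨u, h2⟩, shq_inj _ h.jB_inj _ ⟨v, h3⟩⟩

end les

end BDM

namespace BDM
open Finsupp

/-! ### Homology as a represented quotient -/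

/-- `B` is the homology of `G` in degree `n`. -/
def HRep (G : Type) [Group G] (n : ℕ) (B : Type) [AddCommGroup B] : Prop :=
  ∃ κ : LinearMap.ker (d n : Ch G Unit (n + 1) →ₗ[ℤ] Ch G Unit n) →+ B,
    Function.Surjective κ ∧ ∀ z, κ z = 0 ↔ IsB z.1

/-- The homology vanishes in degree `n`. -/
def Van (G : Type) [Group G] (n : ℕ) : Prop := ∀ c : Ch G Unit (n + 1), d n c = 0 → IsB c

section hrep
variable {G H : Type} [Group G] [Group H] {n m : ℕ}

lemma HRep.of_rel {B : Type} [AddCommGroup B] (hB : HRep H m B)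
    (R : Ch G Unit (n + 1) → Ch H Unit (m + 1) → Prop)
    (hsub : ∀ z z' y y', R z y → R z' y' → R (z - z') (y - y'))
    (hl : ∀ z, d n z = 0 → ∃ y, d m y = 0 ∧ R z y)
    (hr : ∀ y, d m y = 0 → ∃ z, d n z = 0 ∧ R z y)
    (hiff : ∀ z y, d n z = 0 → d m y = 0 → R z y → (IsB z ↔ IsB y)) : HRep G n B := by
  obtain ⟨κ, hκ, hκ2⟩ := hB
  choose f hf hfR using fun z : LinearMap.ker (d n : Ch G Unit (n + 1) →ₗ[ℤ] Ch G Unit n) =>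
    hl z.1 z.2
  refine ⟨AddMonoidHom.mk' (fun z => κ ⟨f z, hf z⟩) ?_, ?_, ?_⟩
  · intro a b
    rw [← sub_eq_zero, ← map_add, ← map_sub, hκ2]
    have h1 := hsub _ _ _ _ (hsub _ _ _ _ (hfR (a + b)) (hfR a)) (hfR b)
    have h2 : IsB (f (a + b) - f a - f b) := (hiff _ _ (by simp) (by simp [hf]) h1).1 (by
      simp only [Submodule.coe_add, add_sub_cancel_left, sub_self]
      exact isB_zero)
    simpa [sub_sub] using h2
  · intro b
    obtain ⟨⟨y, hy⟩, rfl⟩ := hκ b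
    obtain ⟨z, hz, hR⟩ := hr y hy
    refine ⟨⟨z, hz⟩, ?_⟩
    change κ _ = κ _
    rw [← sub_eq_zero, ← map_sub, hκ2]
    have hy' : d m y = 0 := hy
    refine (hiff _ _ (by simp) (by simp [hf, hy']) (hsub _ _ _ _ (hfR ⟨z, hz⟩) hR)).1 ?_
    simp only [sub_self]
    exact isB_zero
  · intro z
    change κ _ = 0 ↔ _
    rw [hκ2]
    exact (hiff _ _ z.2 (hf z) (hfR z)).symm

/-- Homology isomorphisms. -/
lemma HRep.of_hom {B : Type} [AddCommGroup B] (hB : HRep G n B) (φ : G →* H)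
    (hi : ∀ z : Ch G Unit (n + 1), d n z = 0 → IsB (gmap φ _ z) → IsB z)
    (hs : ∀ y : Ch H Unit (n + 1), d n y = 0 → ∃ z, d n z = 0 ∧ IsB (y - gmap φ _ z)) :
    HRep H n B := by
  refine hB.of_rel (fun y z => IsB (y - gmap φ _ z)) ?_ hs ?_ ?_
  · intro z z' y y' h1 h2
    have := h1.sub h2
    rw [map_sub]
    convert this using 1
    abel
  · intro z hz
    refine ⟨gmap φ _ z, by rw [d_gmap, hz, map_zero], ?_⟩
    rw [sub_self]
    exact isB_zero
  · intro y z hy hz h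
    exact ⟨fun h' => hi z hz (h.of_sub_right h'), fun h' => h.of_sub (h'.gmap φ)⟩

lemma hrep_one (G : Type) [Group G] : HRep G 1 (Additive (Abelianization G)) := by
  refine ⟨(abm.comp (LinearMap.ker (d 1 : Ch G Unit 2 →ₗ[ℤ] Ch G Unit 1)).subtype).toAddMonoidHom,
    ?_, ?_⟩
  · intro a
    obtain ⟨g, hg⟩ := QuotientGroup.mk_surjective (Additive.toMul a)
    refine ⟨⟨e ![1, g] (), d_one_eq _⟩, ?_⟩
    change abm (e ![1, g] ()) = a
    rw [abm_e]
    simp only [Matrix.cons_val_zero, Matrix.cons_val_one, inv_one, one_mul]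
    exact congrArg Additive.ofMul hg
  · intro z
    refine ⟨fun h => abm_inj _ h, ?_⟩
    rintro ⟨b, hb⟩
    change abm z.1 = 0
    rw [← hb, abm_d]

lemma HRep.congr {B B' : Type} [AddCommGroup B] [AddCommGroup B'] (h : HRep G n B) (f : B ≃+ B') :
    HRep G n B' := by
  obtain ⟨κ, h1, h2⟩ := h
  refine ⟨f.toAddMonoidHom.comp κ, f.surjective.comp h1, fun z => ?_⟩
  rw [← h2]
  exact f.map_eq_zero_iff

lemma van_one_of (h : ∀ g : G, Abelianization.of g = 1) : Van G 1 := by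
  intro c _
  apply abm_inj
  have : (abm : Ch G Unit 2 →ₗ[ℤ] _) = 0 := by
    apply ch_ext; intro v x
    rw [abm_e, h]; rfl
  rw [this]; rfl

lemma Van.one_iff (h : Van G 1) (g : G) : Abelianization.of g = 1 := by
  obtain ⟨b, hb⟩ := h (e ![1, g] ()) (d_one_eq _)
  have h1 := abm_d b
  rw [hb, abm_e] at h1
  simpa using h1

lemma van_of_acyc (h : Acyc G) (n : ℕ) : Van G n := h n

/-- A hom to an abelian group is trivial. -/
lemma Van.hom_eq_one (h : Van G 1) {M : Type} [CommGroup M] (f : G →* M) (g : G) : f g = 1 := by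
  have : f g = Abelianization.lift f (Abelianization.of g) := by simp
  rw [this, h.one_iff, map_one]

end hrep

/-! ### Cones and suspensions -/

theorem exists_cone (K : Type) [Group K] : ∃ (C : Type) (_ : Group C) (i : K →* C),
    Function.Injective i ∧ Acyc C := by
  refine ⟨Gam K, inferInstance, (lev0 K).comp (MulAction.toPermHom K K), ?_, acyc_gam K⟩
  refine lev0_inj.comp ?_
  exact MulAction.toPerm_injective

section susp
variable {C A B Γ : Type} [Group C] [Group A] [Group B] [Group Γ] {iA : C →* A} {iB : C →* B}
    {jA : A →* Γ} {jB : B →* Γ} {n : ℕ}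

lemma IsAmalg.van_one (h : IsAmalg iA iB jA jB) (hA : Van A 1) (hB : Van B 1) : Van Γ 1 := by
  apply van_one_of
  intro g
  have := h.gen (Abelianization.of : Γ →* _).ker
    (fun a => hA.hom_eq_one (Abelianization.of.comp jA) a)
    (fun b => hB.hom_eq_one (Abelianization.of.comp jB) b)
  have h2 : g ∈ (Abelianization.of : Γ →* _).ker := this ▸ Subgroup.mem_top g
  exact h2

/-- Vanishing from Mayer-Vietoris. -/
lemma IsAmalg.van (h : IsAmalg iA iB jA jB) (hA : Van A (n + 2)) (hB : Van B (n + 2))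
    (hC : ∀ y : Ch C Unit (n + 2), d _ y = 0 → IsB (gmap iA _ y) → IsB (gmap iB _ y) → IsB y) :
    Van Γ (n + 2) := by
  intro z hz
  obtain ⟨y, hy, hc⟩ := Conn.exists_right h z hz
  have h2 := hc.isB_images
  exact hc.isB_left hA hB (hC y hy h2.1 h2.2)

lemma IsAmalg.hrep (h : IsAmalg iA iB jA jB) (hA : Acyc A) (hB : Acyc B) {M : Type} [AddCommGroup M]
    (hC : HRep C (n + 1) M) : HRep Γ (n + 2) M := by
  refine hC.of_rel (Conn h (n + 2)) (fun z z' y y' h1 h2 => h1.sub h2)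
    (fun z hz => Conn.exists_right h z hz)
    (fun y hy => Conn.exists_left h y (hA _ _ (by rw [d_gmap, hy, map_zero]))
      (hB _ _ (by rw [d_gmap, hy, map_zero])))
    (fun z y _ _ hc => ⟨hc.isB_right, hc.isB_left (hA _) (hB _)⟩)

theorem exists_susp (K : Type) [Group K] : ∃ (Γ : Type) (_ : Group Γ), Van Γ 1 ∧
    (∀ n, Van K (n + 1) → Van Γ (n + 2)) ∧
    ∀ (n : ℕ) (M : Type) [AddCommGroup M], HRep K (n + 1) M → HRep Γ (n + 2) M := by
  obtain ⟨C, _, i, hi, hC⟩ := exists_cone K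
  obtain ⟨Γ, _, jA, jB, h⟩ := exists_amalg i i hi hi
  refine ⟨Γ, inferInstance, h.van_one (hC 1) (hC 1), fun n hK => ?_, fun n M _ hM => ?_⟩
  · exact h.van (hC _) (hC _) (fun y hy _ _ => hK y hy)
  · exact h.hrep hC hC hM

end susp

/-! ### Resolutions with free edges -/

section res
variable {Γ : Type} [Group Γ] {n : ℕ}

lemma free_van {X : Type} [MulAction Γ X] (p : X → Γ) (hp : ∀ (g : Γ) x, p (g • x) = g * p x)
    (c : Ch Γ X (n + 1)) (hc : d n c = 0) : IsB c := by
  let s : ∀ k, Ch Γ X k →ₗ[ℤ] Ch Γ X (k + 1) := fun k =>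
    chLift (fun v x => e (cns (p x) v) x) (fun g v x => by
      rw [hp]
      refine Eq.trans ?_ (e_smul g (cns (p x) v) x)
      congr 1
      funext i
      refine Fin.cases ?_ (fun i => ?_) i <;> simp)
  have hs : ∀ k t (x : X), s k (pr k t (single x 1)) = pr (k + 1) (cone (p x) t) (single x 1) := by
    intro k t x
    have : (s k).comp ((pr k).flip (single x 1)) =
        ((pr (k + 1)).flip (single x 1)).comp (cone (p x)) := by
      apply tup_ext; intro v
      simp [s]
    exact LinearMap.congr_fun this t
  refine ⟨s _ c, ?_⟩
  have : (d (n + 1)).comp (s (n + 1)) + (s n).comp (d n) = LinearMap.id := by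
    apply ch_ext_pr; intro t x
    simp only [LinearMap.add_apply, LinearMap.comp_apply, hs, d_pr, bd_succ_cone]
    simp
  have := LinearMap.congr_fun this c
  simpa [hc] using this

lemma res_lift {E V : Type} [MulAction Γ E] [MulAction Γ V] (α : (E →₀ ℤ) →ₗ[ℤ] (V →₀ ℤ))
    (hα : Eqv Γ α) (hinj : ∀ y, α y = 0 → y = 0) (hcomp : ∀ y, aug (α y) = 0) (hex : ∀ v, aug v = 0 → ∃ y, α y = v)
    (v0 : V) (p : E → Γ) (hp : ∀ (g : Γ) x, p (g • x) = g * p x)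
    (z : Ch Γ Unit (n + 3)) (hz : d _ z = 0) : ∃ w : Ch Γ V (n + 3), d _ w = 0 ∧ mvE V _ w = z := by
  have hsur : ∀ y : Unit →₀ ℤ, ∃ x : V →₀ ℤ, aug x = y := by
    intro y
    refine ⟨lm (fun _ => v0) y, ?_⟩
    have : aug.comp (lm (fun _ : Unit => v0)) = LinearMap.id := by
      refine Finsupp.lhom_ext' fun t => LinearMap.ext_ring ?_
      simp [aug]
    exact LinearMap.congr_fun this y
  obtain ⟨w0, hw0⟩ := lam_surj aug aug_eqv hsur z
  obtain ⟨y, hy⟩ := lam_exact α hα aug aug_eqv hex (d _ w0) (by rw [← d_lam, hw0, hz])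
  have hy0 : d _ y = 0 := lam_inj α hα hinj _ (by rw [← d_lam, hy, d_d])
  obtain ⟨t, ht⟩ := free_van p hp y hy0
  refine ⟨w0 - lam α hα _ t, ?_, ?_⟩
  · rw [map_sub, d_lam, ht, hy, sub_self]
  · have h0 : lam aug aug_eqv _ (lam α hα _ t) = 0 := by
      have hz0 : Eqv Γ (0 : (E →₀ ℤ) →ₗ[ℤ] (Unit →₀ ℤ)) := by intro g c; simp
      exact (lam_comp α hα aug aug_eqv 0 hz0 (fun c => by simp [hcomp]) t).trans
        (lam_zero 0 hz0 (fun c => by simp) t)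
    unfold mvE
    rw [map_sub, hw0, h0, sub_zero]

end res

end BDM

namespace BDM
open Finsupp

/-! ### Free groups -/

lemma free_gen {S : Type} (H : Subgroup (FreeGroup S)) (h : ∀ s, FreeGroup.of s ∈ H) : H = ⊤ := by
  rw [eq_top_iff, ← FreeGroup.closure_range_of, Subgroup.closure_le]
  rintro _ ⟨s, rfl⟩
  exact h s

lemma act_single_left {Γ : Type} [Group Γ] (g h : Γ) (a : ℤ) :
    act g (single h a) = single (g * h) a := by simp

lemma act_single_sigma {Γ S : Type} [Group Γ] (g : Γ) (s : S) (h : Γ) (a : ℤ) :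
    act g (single (⟨s, h⟩ : Σ _ : S, Γ) a) = single (⟨s, g * h⟩ : Σ _ : S, Γ) a := by
  rw [act_single]; rfl

theorem van_free (S : Type) (n : ℕ) : Van (FreeGroup S) (n + 2) := by
  let Γ := FreeGroup S
  let E := Σ _ : S, Γ
  let ε : S → (E →₀ ℤ) := fun s => single ⟨s, 1⟩ 1
  let Ψ : Γ →* Equiv.Perm (E →₀ ℤ) := FreeGroup.lift
    (fun s => Equiv.addLeft (ε s) * actP (FreeGroup.of s))
  have hΨ : ∀ s m, Ψ (FreeGroup.of s) m = ε s + act (FreeGroup.of s) m := by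
    intro s m
    simp only [Ψ]
    rfl
  have hE : affS Ψ = ⊤ := free_gen _ (fun s m => by
    rw [hΨ, hΨ, map_zero, add_zero, add_comm])
  let D : Γ → (E →₀ ℤ) := fun γ => Ψ γ 0
  have hD : ∀ a b, D (a * b) = D a + act a (D b) := fun a b => affS_mul Ψ hE a b
  have hDs : ∀ s, D (FreeGroup.of s) = ε s := fun s => by
    simp only [D]
    rw [hΨ, map_zero, add_zero]
  let α : (E →₀ ℤ) →ₗ[ℤ] (Γ →₀ ℤ) := Finsupp.linearCombination ℤ
    (fun p : E => single (p.2 * FreeGroup.of p.1) 1 - single p.2 1)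
  have hαs : ∀ (s : S) (γ : Γ), α (single ⟨s, γ⟩ 1) = single (γ * FreeGroup.of s) 1 - single γ 1 := by
    intro s γ
    simp [α]
  have hα : Eqv Γ α := eqv_of_single (by
    rintro g ⟨s, γ⟩
    have : g • (⟨s, γ⟩ : E) = ⟨s, g * γ⟩ := rfl
    rw [this, hαs, hαs, map_sub, act_single_left, act_single_left, mul_assoc])
  let r : (Γ →₀ ℤ) →ₗ[ℤ] (E →₀ ℤ) := Finsupp.linearCombination ℤ D
  have hr : ∀ γ, r (single γ 1) = D γ := fun γ => by simp [r]
  have hrα : ∀ y, r (α y) = y := by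
    intro y
    have : r.comp α = LinearMap.id := by
      refine Finsupp.lhom_ext' fun t => LinearMap.ext_ring ?_
      obtain ⟨s, γ⟩ := t
      have h1 : act γ (ε s) = single ⟨s, γ⟩ 1 :=
        (act_single_sigma γ s 1 1).trans (by rw [mul_one])
      simp only [LinearMap.comp_apply, lsingle_apply, hαs, map_sub, hr, hD, hDs, h1,
        LinearMap.id_apply]
      abel
    exact LinearMap.congr_fun this y
  have hαD : ∀ γ, α (D γ) = single γ 1 - single 1 1 := by
    obtain ⟨T, hT⟩ := deriv_principal D hD α hα (single (1 : Γ) 1)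
    have hT2 : T = ⊤ := free_gen T (fun s => by
      rw [hT, hDs, hαs, act_single_left, mul_one, one_mul])
    intro γ
    have := (hT γ).1 (hT2 ▸ Subgroup.mem_top γ)
    rwa [act_single_left, mul_one] at this
  let σ : (Unit →₀ ℤ) →ₗ[ℤ] (Γ →₀ ℤ) := lm (fun _ => 1)
  have hαr : ∀ v, α (r v) = v - σ (aug v) := by
    intro v
    have : α.comp r = LinearMap.id - σ.comp aug := by
      refine Finsupp.lhom_ext' fun t => LinearMap.ext_ring ?_
      simp [hr, hαD, σ, aug]
    exact LinearMap.congr_fun this v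
  have hcomp : ∀ y, aug (α y) = 0 := by
    intro y
    have : aug.comp α = 0 := by
      refine Finsupp.lhom_ext' fun t => LinearMap.ext_ring ?_
      obtain ⟨s, γ⟩ := t
      simp [hαs, aug]
    exact LinearMap.congr_fun this y
  intro z hz
  obtain ⟨w, hw, rfl⟩ := res_lift α hα (fun y hy => by rw [← hrα y, hy, map_zero]) hcomp
    (fun v hv => ⟨r v, by rw [hαr, hv, map_zero, sub_zero]⟩) 1 (fun p => p.2) (fun g x => rfl) z hz
  exact (free_van (fun γ => γ) (fun g x => rfl) w hw).lam _ _

end BDM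

namespace BDM
open Finsupp

/-! ### Free products -/

section coprod
variable {M : ℕ → Type} [∀ i, Group (M i)]

lemma coprod_gen (H : Subgroup (Monoid.CoprodI M)) (h : ∀ i (m : M i), Monoid.CoprodI.of m ∈ H) :
    H = ⊤ := by
  rw [eq_top_iff]
  intro x _
  induction x using Monoid.CoprodI.induction_on with
  | one => exact H.one_mem
  | of i m => exact h i m
  | mul x y hx hy => exact H.mul_mem (hx trivial) (hy trivial)

/-- Inclusion of a factor. -/
noncomputable def inc (M : ℕ → Type) [∀ i, Group (M i)] (i : ℕ) : M i →* Monoid.CoprodI M :=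
  Monoid.CoprodI.of

lemma inc_inj (i : ℕ) : Function.Injective (inc M i) := Monoid.CoprodI.of_injective i

/-- Cosets of the factors. -/
abbrev CV (M : ℕ → Type) [∀ i, Group (M i)] : Type :=
  Σ i : ℕ, Monoid.CoprodI M ⧸ (inc M i).range

/-- injection of a summand -/
noncomputable def ci (i : ℕ) : ((Monoid.CoprodI M ⧸ (inc M i).range) →₀ ℤ) →ₗ[ℤ] (CV M →₀ ℤ) :=
  lm (fun x => (⟨i, x⟩ : CV M))

lemma ci_eqv (i : ℕ) : Eqv (Monoid.CoprodI M) (ci (M := M) i) := lm_eqv _ (fun _ _ => rfl)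

/-- projection to a summand -/
noncomputable def cpj (i : ℕ) : (CV M →₀ ℤ) →ₗ[ℤ] ((Monoid.CoprodI M ⧸ (inc M i).range) →₀ ℤ) :=
  Finsupp.linearCombination ℤ (fun p : CV M =>
    if h : p.1 = i then single (h ▸ p.2 : Monoid.CoprodI M ⧸ (inc M i).range) 1 else 0)

lemma cpj_same (i : ℕ) (x : Monoid.CoprodI M ⧸ (inc M i).range) :
    cpj i (single (⟨i, x⟩ : CV M) 1) = single x 1 := by simp [cpj]

lemma cpj_ne (i k : ℕ) (x : Monoid.CoprodI M ⧸ (inc M k).range) (h : k ≠ i) :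
    cpj i (single (⟨k, x⟩ : CV M) 1) = 0 := by simp [cpj, h]

lemma cpj_eqv (i : ℕ) : Eqv (Monoid.CoprodI M) (cpj (M := M) i) := eqv_of_single (by
  rintro g ⟨k, x⟩
  have h1 : g • (⟨k, x⟩ : CV M) = ⟨k, g • x⟩ := rfl
  rw [h1]
  by_cases h : k = i
  · subst h
    rw [cpj_same, cpj_same, act_single]
  · rw [cpj_ne _ _ _ h, cpj_ne _ _ _ h, map_zero])

lemma cv_decomp {n : ℕ} (w : Ch (Monoid.CoprodI M) (CV M) n) : ∃ N0 : ℕ, ∀ N, N0 ≤ N →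
    w = ∑ i ∈ Finset.range N, lam (ci i) (ci_eqv i) n (lam (cpj i) (cpj_eqv i) n w) := by
  have add : ∀ w w' : Ch (Monoid.CoprodI M) (CV M) n,
      (∃ N0 : ℕ, ∀ N, N0 ≤ N → w = ∑ i ∈ Finset.range N, lam (ci i) (ci_eqv i) n (lam (cpj i) (cpj_eqv i) n w)) →
      (∃ N0 : ℕ, ∀ N, N0 ≤ N → w' = ∑ i ∈ Finset.range N, lam (ci i) (ci_eqv i) n (lam (cpj i) (cpj_eqv i) n w')) →
      (∃ N0 : ℕ, ∀ N, N0 ≤ N → w + w' = ∑ i ∈ Finset.range N, lam (ci i) (ci_eqv i) n (lam (cpj i) (cpj_eqv i) n (w + w'))) := by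
    rintro w w' ⟨N, h⟩ ⟨N', h'⟩
    refine ⟨max N N', fun K hK => ?_⟩
    simp only [map_add, Finset.sum_add_distrib]
    rw [← h K (le_trans (le_max_left _ _) hK), ← h' K (le_trans (le_max_right _ _) hK)]
  induction w using Finsupp.induction_linear with
  | zero => exact ⟨0, fun N _ => by simp⟩
  | add f g hf hg => exact add f g hf hg
  | single o a =>
    induction o using Quotient.inductionOn with | h p => ?_
    obtain ⟨v, k, x⟩ := p
    refine ⟨k + 1, fun N hN => ?_⟩
    have h1 : (single (Quotient.mk (MulAction.orbitRel (Monoid.CoprodI M)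
      ((Fin n → Monoid.CoprodI M) × CV M)) (v, ⟨k, x⟩)) a :
        Ch (Monoid.CoprodI M) (CV M) n) = a • e v (⟨k, x⟩ : CV M) := by
      simp [e]
    rw [h1]
    rw [Finset.sum_eq_single k]
    · rw [map_smul, map_smul, ← pr_single, lam_pr, cpj_same, lam_pr]
      simp [ci]
    · intro i _ hi
      rw [map_smul, map_smul, ← pr_single, lam_pr, cpj_ne _ _ _ hi.symm]
      simp
    · intro h
      exact absurd (Finset.mem_range.2 (by omega)) h

theorem coprod_split {n : ℕ} (z : Ch (Monoid.CoprodI M) Unit (n + 3)) (hz : d _ z = 0) :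
    ∃ (N : ℕ) (y : ∀ i, Ch (M i) Unit (n + 3)), (∀ i, d _ (y i) = 0) ∧
      IsB (z - ∑ i ∈ Finset.range N, gmap (inc M i) _ (y i)) := by
  let Γ := Monoid.CoprodI M
  let E := Σ _ : ℕ, Γ
  let ε : ℕ → (E →₀ ℤ) := fun i => Nat.casesOn i 0 (fun i => single ⟨i, 1⟩ 1)
  let Ψ : Γ →* Equiv.Perm (E →₀ ℤ) := Monoid.CoprodI.lift (fun i => (trP (ε i)).comp (inc M i))
  have hΨ : ∀ i (g : M i) m, Ψ (inc M i g) m = ε i + act (inc M i g) (- ε i + m) := by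
    intro i g m
    have : Ψ (inc M i g) = trP (ε i) (inc M i g) := Monoid.CoprodI.lift_of _ g
    rw [this, trP_apply]
  have hE : affS Ψ = ⊤ := coprod_gen _ (fun i g m => by
    change Ψ (inc M i g) m = act (inc M i g) m + Ψ (inc M i g) 0
    rw [hΨ, hΨ, map_add, add_zero]; abel)
  let D : Γ → (E →₀ ℤ) := fun γ => Ψ γ 0
  have hD : ∀ a b, D (a * b) = D a + act a (D b) := fun a b => affS_mul Ψ hE a b
  have hDs : ∀ i (g : M i), D (inc M i g) = ε i - act (inc M i g) (ε i) := fun i g => by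
    simp only [D]
    rw [hΨ, add_zero, map_neg, sub_eq_add_neg]
  let G : ∀ i, Γ → CV M := fun i γ => ⟨i, (γ : Γ ⧸ (inc M i).range)⟩
  have hG : ∀ i (g γ : Γ), act g (single (G i γ) 1) = single (G i (g * γ)) 1 := by
    intro i g γ
    rw [act_single]; rfl
  have hGm : ∀ i (γ : Γ) (g : M i), G i (γ * inc M i g) = G i γ := by
    intro i γ g
    simp only [G]
    congr 1
    rw [QuotientGroup.eq, mul_inv_rev, inv_mul_cancel_right, Subgroup.inv_mem_iff]
    exact ⟨g, rfl⟩
  let α : (E →₀ ℤ) →ₗ[ℤ] (CV M →₀ ℤ) := Finsupp.linearCombination ℤ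
    (fun p : E => single (G (p.1 + 1) p.2) 1 - single (G 0 p.2) 1)
  have hαs : ∀ (s : ℕ) (γ : Γ), α (single ⟨s, γ⟩ 1) = single (G (s + 1) γ) 1 - single (G 0 γ) 1 := by
    intro s γ
    simp [α]
  have hα : Eqv Γ α := eqv_of_single (by
    rintro g ⟨s, γ⟩
    have : g • (⟨s, γ⟩ : E) = ⟨s, g * γ⟩ := rfl
    rw [this, hαs, hαs, map_sub, hG, hG])
  have hαε : ∀ i, α (ε i) = single (G i 1) 1 - single (G 0 1) 1 := by
    intro i
    cases i with
    | zero => simp [ε]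
    | succ i => exact hαs i 1
  have hεγ : ∀ i (γ : Γ), act γ (ε (i + 1)) = single ⟨i, γ⟩ 1 := fun i γ =>
    (act_single_sigma γ i 1 1).trans (by rw [mul_one])
  let r0 : ∀ i, ((Γ ⧸ (inc M i).range) →₀ ℤ) →ₗ[ℤ] (E →₀ ℤ) := fun i =>
    qlin (inc M i).range (fun γ => D γ + act γ (ε i)) (by
      rintro γ _ ⟨g, rfl⟩
      rw [hD, hDs, map_sub, ← act_mul]
      abel)
  let r : (CV M →₀ ℤ) →ₗ[ℤ] (E →₀ ℤ) := Finsupp.linearCombination ℤ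
    (fun p => r0 p.1 (single p.2 1))
  have hr : ∀ i γ, r (single (G i γ) 1) = D γ + act γ (ε i) := fun i γ => by
    simp only [r, G, linearCombination_single, one_smul]
    exact qlin_single _ _ _ _
  have hrα : ∀ y, r (α y) = y := by
    intro y
    have : r.comp α = LinearMap.id := by
      refine Finsupp.lhom_ext' fun t => LinearMap.ext_ring ?_
      obtain ⟨s, γ⟩ := t
      have h0 : act γ (ε 0) = 0 := map_zero _
      simp only [LinearMap.comp_apply, lsingle_apply, hαs, map_sub, hr, hεγ, h0,
        LinearMap.id_apply]
      abel
    exact LinearMap.congr_fun this y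
  have hαD : ∀ γ, α (D γ) = single (G 0 γ) 1 - single (G 0 1) 1 := by
    obtain ⟨T, hT⟩ := deriv_principal D hD α hα (single (G 0 1) 1)
    have hT2 : T = ⊤ := coprod_gen T (fun i g => by
      change inc M i g ∈ T
      have h1 := hGm i 1 g
      rw [one_mul] at h1
      rw [hT, hDs, map_sub, hα, hαε, map_sub, hG, hG, mul_one, h1]
      abel)
    intro γ
    have := (hT γ).1 (hT2 ▸ Subgroup.mem_top γ)
    rw [hG, mul_one] at this
    rw [this]
  let σ : (Unit →₀ ℤ) →ₗ[ℤ] (CV M →₀ ℤ) := lm (fun _ => G 0 1)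
  have cv_ext : ∀ {N : Type} [AddCommGroup N] {f g : (CV M →₀ ℤ) →ₗ[ℤ] N},
      (∀ i γ, f (single (G i γ) 1) = g (single (G i γ) 1)) → f = g := by
    intro N _ f g h
    refine Finsupp.lhom_ext' fun t => LinearMap.ext_ring ?_
    obtain ⟨i, x⟩ := t
    obtain ⟨γ, rfl⟩ := QuotientGroup.mk_surjective x
    exact h i γ
  have hαr : ∀ v, α (r v) = v - σ (aug v) := by
    intro v
    have : α.comp r = LinearMap.id - σ.comp aug := by
      apply cv_ext
      intro i γ
      simp only [LinearMap.comp_apply, hr, map_add, hαD, hα γ, hαε, map_sub, hG, mul_one,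
        LinearMap.sub_apply, LinearMap.id_apply, σ, aug, lm_single]
      abel
    exact LinearMap.congr_fun this v
  have hcomp : ∀ y, aug (α y) = 0 := by
    intro y
    have : aug.comp α = 0 := by
      refine Finsupp.lhom_ext' fun t => LinearMap.ext_ring ?_
      obtain ⟨s, γ⟩ := t
      simp [hαs, aug]
    exact LinearMap.congr_fun this y
  obtain ⟨w, hw, rfl⟩ := res_lift α hα (fun y hy => by rw [← hrα y, hy, map_zero]) hcomp
    (fun v hv => ⟨r v, by rw [hαr, hv, map_zero, sub_zero]⟩) (G 0 1) (fun p => p.2)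
    (fun g x => rfl) z hz
  obtain ⟨N, hN⟩ := cv_decomp w
  have hN := hN N le_rfl
  have hcyc : ∀ i, d _ (lam (cpj i) (cpj_eqv i) _ w) = 0 := fun i => by rw [d_lam, hw, map_zero]
  choose y hy hy2 using fun i => shq_surj (inc M i) (inc_inj i) _ (hcyc i)
  refine ⟨N, y, hy, ?_⟩
  have h1 : mvE (CV M) _ w = ∑ i ∈ Finset.range N, lam aug aug_eqv _ (lam (cpj i) (cpj_eqv i) _ w) := by
    conv_lhs => rw [hN]
    rw [map_sum]
    refine Finset.sum_congr rfl fun i _ => ?_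
    refine lam_comp _ _ _ _ _ _ (fun c => ?_) _
    have : aug.comp (ci (M := M) i) = aug := by
      refine Finsupp.lhom_ext' fun t => LinearMap.ext_ring ?_
      simp [ci, aug]
    exact LinearMap.congr_fun this c
  rw [h1, ← Finset.sum_sub_distrib]
  refine isB_sum _ _ fun i _ => ?_
  rw [← lam_aug_shq, ← map_sub]
  exact (hy2 i).lam _ _

end coprod

end BDM

namespace BDM
open Finsupp

/-! ### Submodules of free abelian groups -/

lemma free_sub (I : Type) (N : Submodule ℤ (I →₀ ℤ)) :
    ∃ (S : Type) (ρ : (S →₀ ℤ) →ₗ[ℤ] (I →₀ ℤ)), Function.Injective ρ ∧ LinearMap.range ρ = N := by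
  classical
  obtain ⟨_, _⟩ := exists_wellFoundedLT I
  let T : I → AddSubgroup ℤ := fun i =>
    { carrier := {a | ∃ f ∈ N, (∀ j, i < j → f j = 0) ∧ f i = a}
      zero_mem' := ⟨0, N.zero_mem, fun _ _ => rfl, rfl⟩
      add_mem' := by
        rintro _ _ ⟨f, hf, h1, rfl⟩ ⟨g, hg, h2, rfl⟩
        exact ⟨f + g, N.add_mem hf hg, fun j hj => by simp [h1 j hj, h2 j hj], rfl⟩
      neg_mem' := by
        rintro _ ⟨f, hf, h1, rfl⟩
        exact ⟨-f, N.neg_mem hf, fun j hj => by simp [h1 j hj], rfl⟩ }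
  choose a ha using fun i => Int.subgroup_cyclic (T i)
  have hmem : ∀ i, a i ∈ T i := fun i => by
    rw [ha]; exact AddSubgroup.subset_closure rfl
  choose f hfN hf hfa using hmem
  let S := {i // a i ≠ 0}
  let ρ : (S →₀ ℤ) →ₗ[ℤ] (I →₀ ℤ) := Finsupp.linearCombination ℤ (fun s : S => f s.1)
  refine ⟨S, ρ, ?_, ?_⟩
  · rw [injective_iff_map_eq_zero]
    intro c hc
    by_contra hne
    have hs : c.support.Nonempty := Finsupp.support_nonempty_iff.2 hne
    let i := c.support.max' hs
    have hi : i ∈ c.support := Finset.max'_mem _ _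
    have h1 : (ρ c) i.1 = c i * a i.1 := by
      simp only [ρ, linearCombination_apply, Finsupp.sum, Finsupp.finsetSum_apply]
      rw [Finset.sum_eq_single i]
      · simp [hfa]
      · intro j hj hji
        have : j < i := lt_of_le_of_ne (Finset.le_max' _ _ hj) hji
        simp [hf j.1 i.1 this]
      · exact fun h => absurd hi h
    rw [hc] at h1
    rcases mul_eq_zero.1 h1.symm with h | h
    · exact (Finsupp.mem_support_iff.1 hi) h
    · exact i.2 h
  · apply le_antisymm
    · rintro _ ⟨c, rfl⟩
      simp only [ρ, linearCombination_apply, Finsupp.sum]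
      exact N.sum_mem fun i _ => N.smul_mem _ (hfN _)
    · have key : ∀ i, ∀ g ∈ N, (∀ j, i < j → g j = 0) → g ∈ LinearMap.range ρ := by
        intro i
        induction i using WellFoundedLT.induction with | ind i ih => ?_
        intro g hg h0
        have h1 : g i ∈ T i := ⟨g, hg, h0, rfl⟩
        rw [ha, AddSubgroup.mem_closure_singleton] at h1
        obtain ⟨k, hk⟩ := h1
        obtain ⟨u, hu, huN, hu0, hui⟩ : ∃ u ∈ LinearMap.range ρ, u ∈ N ∧ (∀ j, i < j → u j = 0) ∧
            u i = g i := by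
          by_cases hz : a i = 0
          · refine ⟨0, Submodule.zero_mem _, N.zero_mem, fun _ _ => rfl, ?_⟩
            rw [← hk, hz, smul_zero]; rfl
          · refine ⟨k • f i, ⟨single ⟨i, hz⟩ k, by simp [ρ]⟩, N.smul_mem _ (hfN i), ?_, ?_⟩
            · intro j hj
              simp [hf i j hj]
            · rw [← hk, ← hfa i]; rfl
        have hgu : g - u ∈ LinearMap.range ρ := by
          by_cases hs : (g - u).support.Nonempty
          · have hm := Finset.max'_mem _ hs
            refine ih ((g - u).support.max' hs) ?_ (g - u) (N.sub_mem hg huN) (fun j hj => ?_)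
            · by_contra h
              rcases lt_or_eq_of_le (not_lt.1 h) with h | h
              · exact (Finsupp.mem_support_iff.1 hm) (by simp [h0 _ h, hu0 _ h])
              · exact (Finsupp.mem_support_iff.1 hm) (by rw [← h]; simp [hui])
            · by_contra h
              exact absurd (Finset.le_max' _ j (Finsupp.mem_support_iff.2 h)) (not_le.2 hj)
          · rw [Finsupp.support_nonempty_iff, not_not] at hs
            rw [hs]; exact Submodule.zero_mem _
        have := Submodule.add_mem _ hgu hu
        rwa [sub_add_cancel] at this
      intro g hg
      by_cases hs : g.support.Nonempty
      · refine key (g.support.max' hs) g hg (fun j hj => ?_)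
        by_contra h
        exact absurd (Finset.le_max' _ j (Finsupp.mem_support_iff.2 h)) (not_le.2 hj)
      · rw [Finsupp.support_nonempty_iff, not_not] at hs
        rw [hs]; exact Submodule.zero_mem _

/-! ### Moore groups -/

/-- Abelianisation of a free group. -/
noncomputable def th (I : Type) : FreeGroup I →* Multiplicative (I →₀ ℤ) :=
  FreeGroup.lift (fun i => Multiplicative.ofAdd (single i 1))

lemma th_eq (I : Type) (x : FreeGroup I) : th I x =
    Multiplicative.ofAdd (FreeAbelianGroup.equivFinsupp I (Additive.ofMul (Abelianization.of x))) := by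
  have : th I = (MonoidHom.comp (AddMonoidHom.toMultiplicativeRight
      (FreeAbelianGroup.equivFinsupp I).toAddMonoidHom) (Abelianization.of : FreeGroup I →* _)) := by
    ext i : 1
    rw [th, FreeGroup.lift_apply_of]
    exact congrArg Multiplicative.ofAdd (FreeAbelianGroup.toFinsupp_of i).symm
  rw [this]; rfl

lemma th_one {I : Type} {x : FreeGroup I} (h : th I x = 1) : Abelianization.of x = 1 := by
  rw [th_eq] at h
  have h1 := (FreeAbelianGroup.equivFinsupp I).map_eq_zero_iff.1 (Multiplicative.ofAdd.injective h)
  exact h1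

lemma th_surj (I : Type) (f : I →₀ ℤ) : ∃ x, th I x = Multiplicative.ofAdd f := by
  obtain ⟨a, rfl⟩ := (FreeAbelianGroup.equivFinsupp I).surjective f
  obtain ⟨x, hx⟩ := QuotientGroup.mk_surjective (Additive.toMul a)
  refine ⟨x, ?_⟩
  rw [th_eq]
  congr 2

theorem exists_moore (A : Type) [AddCommGroup A] : ∃ (M : Type) (_ : Group M), HRep M 1 A ∧
    ∀ n, Van M (n + 2) := by
  let π : (A →₀ ℤ) →ₗ[ℤ] A := Finsupp.linearCombination ℤ id
  obtain ⟨S, ρ, hρ, hker⟩ := free_sub A (LinearMap.ker π)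
  choose w hw using fun s : S => th_surj A (ρ (single s 1))
  let φ : FreeGroup S →* FreeGroup A := FreeGroup.lift w
  have hφ : ∀ k, th A (φ k) = Multiplicative.ofAdd (ρ (Multiplicative.toAdd (th S k))) := by
    intro k
    have : (th A).comp φ = (AddMonoidHom.toMultiplicative ρ.toAddMonoidHom).comp (th S) := by
      ext s : 1
      simp only [φ, MonoidHom.comp_apply, th, FreeGroup.lift_apply_of]
      exact hw s
    exact DFunLike.congr_fun this k
  obtain ⟨C, _, i, hi, hC⟩ := exists_cone (FreeGroup S)
  obtain ⟨M, _, jA, jB, h⟩ := exists_amalg (φ.prod i) i (fun a b hab => hi (congrArg Prod.snd hab)) hi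
  have hL : ∀ n, Van (FreeGroup A × C) (n + 2) := fun n z hz =>
    prod_acyc_inj hC z hz (van_free A n _ (by rw [d_gmap, hz, map_zero]))
  refine ⟨M, inferInstance, ?_, fun n => h.van (hL n) (hC _) ?_⟩
  · let pA : FreeGroup A →* Multiplicative A := (AddMonoidHom.toMultiplicative π.toAddMonoidHom).comp (th A)
    have hpA : ∀ x, pA x = Multiplicative.ofAdd (π (Multiplicative.toAdd (th A x))) := fun x => rfl
    obtain ⟨q, hqA, hqB⟩ := h.lift (pA.comp (MonoidHom.fst _ _)) (1 : C →* Multiplicative A) (by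
      intro c
      change pA (φ c) = 1
      rw [hpA, hφ]
      have : ρ (Multiplicative.toAdd (th S c)) ∈ LinearMap.ker π := hker ▸ ⟨_, rfl⟩
      exact congrArg Multiplicative.ofAdd this)
    have htriv : ∀ c : C, Abelianization.of (jA (1, c)) = 1 := fun c =>
      Van.hom_eq_one (hC 1) ((Abelianization.of.comp jA).comp (MonoidHom.inr _ _)) c
    have htrivB : ∀ c : C, Abelianization.of (jB c) = 1 := fun c =>
      Van.hom_eq_one (hC 1) (Abelianization.of.comp jB) c
    have hinl : ∀ x c, Abelianization.of (jA (x, c)) = Abelianization.of (jA (x, 1)) := by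
      intro x c
      have : ((x, c) : FreeGroup A × C) = (x, 1) * (1, c) := by simp
      rw [this, map_mul, map_mul, htriv, mul_one]
    have hrep : ∀ g : M, ∃ x : FreeGroup A, Abelianization.of (jA (x, 1)) = Abelianization.of g := by
      intro g
      have := h.gen (((Abelianization.of.comp jA).comp (MonoidHom.inl _ _)).range.comap
        (Abelianization.of : M →* _)) (fun a => ⟨a.1, (hinl a.1 a.2).symm⟩)
        (fun b => ⟨1, by rw [map_one, htrivB]⟩)
      have h2 : g ∈ (((Abelianization.of.comp jA).comp (MonoidHom.inl _ _)).range.comap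
        (Abelianization.of : M →* _)) := this ▸ Subgroup.mem_top g
      obtain ⟨x, hx⟩ := h2
      exact ⟨x, hx⟩
    let Q : Additive (Abelianization M) →+ A := MonoidHom.toAdditiveLeft (Abelianization.lift q)
    have hQ : ∀ g, Q (Additive.ofMul (Abelianization.of g)) = Multiplicative.toAdd (q g) := fun g => by
      change Multiplicative.toAdd (Abelianization.lift q (Abelianization.of g)) = _
      rw [Abelianization.lift_apply_of]
    refine (hrep_one M).congr (AddEquiv.ofBijective Q ⟨?_, ?_⟩)
    · rw [injective_iff_map_eq_zero]
      intro a ha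
      obtain ⟨g, hg⟩ := QuotientGroup.mk_surjective (Additive.toMul a)
      obtain ⟨x, hx⟩ := hrep g
      have hax : a = Additive.ofMul (Abelianization.of (jA (x, 1))) := by
        rw [hx]; exact congrArg Additive.ofMul hg.symm
      rw [hax, hQ, hqA] at ha
      have h1 : Multiplicative.toAdd (th A x) ∈ LinearMap.ker π := ha
      rw [← hker] at h1
      obtain ⟨c, hc⟩ := h1
      obtain ⟨k, hk⟩ := th_surj S c
      have h2 : th A (φ k * x⁻¹) = 1 := by
        rw [map_mul, hφ, hk, map_inv]
        have : Multiplicative.ofAdd (ρ c) = th A x := congrArg Multiplicative.ofAdd hc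
        change Multiplicative.ofAdd (ρ c) * _ = 1
        rw [this, mul_inv_cancel]
      have h3 := th_one h2
      rw [map_mul, map_inv, mul_inv_eq_one] at h3
      have h4 : Abelianization.of (jA (φ k, 1)) = Abelianization.of (jA (x, 1)) := by
        have := congrArg (Abelianization.map (jA.comp (MonoidHom.inl _ _))) h3
        simpa using this
      rw [hax, ← h4, ← hinl _ (i k)]
      have h5 : jA (φ k, i k) = jB (i k) := h.comm k
      rw [h5, htrivB]; rfl
    · intro a
      obtain ⟨x, hx⟩ := th_surj A (single a 1)
      refine ⟨Additive.ofMul (Abelianization.of (jA (x, 1))), ?_⟩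
      rw [hQ, hqA]
      change π (Multiplicative.toAdd (th A x)) = a
      rw [hx]
      simp [π]
  · intro y hy h1 _
    cases n with
    | succ n => exact van_free S n y hy
    | zero =>
      have h2 := h1.gmap (MonoidHom.fst _ _)
      rw [gmap_gmap _ _ φ (fun _ => rfl)] at h2
      obtain ⟨b, hb⟩ := h2
      have h3 := abm_d b
      rw [hb, abm_gmap] at h3
      apply abm_inj
      obtain ⟨k, hk⟩ := QuotientGroup.mk_surjective (Additive.toMul (abm y))
      have hk' : abm y = Additive.ofMul (Abelianization.of k) := congrArg Additive.ofMul hk.symm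
      rw [hk'] at h3 ⊢
      have h4 : Abelianization.of (φ k) = 1 := h3
      have h5 : th A (φ k) = 1 := by
        rw [th_eq, h4]; exact congrArg Multiplicative.ofAdd (map_zero _)
      rw [hφ] at h5
      have h6 : Multiplicative.toAdd (th S k) = 0 :=
        (injective_iff_map_eq_zero ρ).1 hρ _ (Multiplicative.ofAdd.injective h5)
      have h7 : th S k = 1 := congrArg Multiplicative.ofAdd h6
      rw [th_one h7]; rfl

end BDM

namespace BDM
open Finsupp

/-! ### Iterated suspensions and the free product -/

theorem exists_moore_n (i : ℕ) (A : Type) [AddCommGroup A] : ∃ (M : Type) (_ : Group M),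
    HRep M (i + 1) A ∧ ∀ n, n ≠ i → Van M (n + 1) := by
  induction i with
  | zero =>
    obtain ⟨M, _, h1, h2⟩ := exists_moore A
    refine ⟨M, inferInstance, h1, fun n hn => ?_⟩
    cases n with
    | zero => exact absurd rfl hn
    | succ n => exact h2 n
  | succ i ih =>
    obtain ⟨M, _, h1, h2⟩ := ih
    obtain ⟨Γ, _, g1, g2, g3⟩ := exists_susp M
    refine ⟨Γ, inferInstance, g3 i A h1, fun n hn => ?_⟩
    cases n with
    | zero => exact g1
    | succ n => exact g2 n (h2 n (by omega))

theorem exists_wedge (A : ℕ → Type) [∀ n, AddCommGroup (A n)] : ∃ (K : Type) (_ : Group K),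
    ∀ n, HRep K (n + 1) (A n) := by
  choose M hM h1 h2 using fun i => exists_moore_n i (A i)
  refine ⟨Monoid.CoprodI M, inferInstance, fun i => (h1 i).of_hom (inc M i) ?_ ?_⟩
  · intro z hz hb
    let ret : Monoid.CoprodI M →* M i :=
      Monoid.CoprodI.lift (Pi.mulSingle i (MonoidHom.id (M i)))
    have hret : ∀ m, ret (inc M i m) = m := Monoid.CoprodI.of_leftInverse i
    have := hb.gmap ret
    rwa [gmap_gmap _ _ (MonoidHom.id (M i)) hret, gmap_id _ (fun _ => rfl)] at this
  · intro z hz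
    cases i with
    | zero =>
      have hrep : ∀ g : Monoid.CoprodI M, ∃ x : M 0,
          Abelianization.of (inc M 0 x) = Abelianization.of g := by
        intro g
        have := coprod_gen ((Abelianization.of.comp (inc M 0)).range.comap
          (Abelianization.of : Monoid.CoprodI M →* _)) (fun k m => by
            by_cases hk : k = 0
            · subst hk; exact ⟨m, rfl⟩
            · refine ⟨1, ?_⟩
              rw [map_one]
              exact (Van.hom_eq_one (h2 k 0 (Ne.symm hk)) (Abelianization.of.comp (inc M k)) m).symm)
        have h2 : g ∈ ((Abelianization.of.comp (inc M 0)).range.comap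
          (Abelianization.of : Monoid.CoprodI M →* _)) := this ▸ Subgroup.mem_top g
        obtain ⟨x, hx⟩ := h2
        exact ⟨x, hx⟩
      obtain ⟨g, hg⟩ := QuotientGroup.mk_surjective (Additive.toMul (abm z))
      obtain ⟨x, hx⟩ := hrep g
      refine ⟨e ![1, x] (), d_one_eq _, ?_⟩
      apply abm_inj
      rw [map_sub, sub_eq_zero, gmap_e, abm_e]
      simp only [Matrix.cons_val_zero, Matrix.cons_val_one, map_one, inv_one, one_mul]
      rw [hx]
      exact congrArg Additive.ofMul hg.symm
    | succ i =>
      obtain ⟨N, y, hy, hb⟩ := coprod_split z hz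
      refine ⟨if i + 1 ∈ Finset.range N then y (i + 1) else 0, ?_, ?_⟩
      · split_ifs
        · exact hy _
        · exact map_zero _
      · refine hb.trans ?_
        have h3 : gmap (inc M (i + 1)) _ (if i + 1 ∈ Finset.range N then y (i + 1) else 0) =
            ∑ j ∈ Finset.range N, if j = i + 1 then gmap (inc M j) _ (y j) else 0 := by
          rw [Finset.sum_ite_eq']
          split_ifs
          · rfl
          · exact map_zero _
        rw [h3, ← Finset.sum_sub_distrib]
        refine isB_sum _ _ fun j _ => ?_
        split_ifs with hj
        · rw [sub_self]; exact isB_zero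
        · rw [sub_zero]
          exact (h2 j (i + 1) (Ne.symm hj) (y j) (hy j)).gmap _

lemma HRep.prod {K Q B : Type} [Group K] [Group Q] [AddCommGroup B] {n : ℕ} (h : HRep K n B)
    (hQ : Acyc Q) : HRep (K × Q) n B := by
  refine h.of_hom (MonoidHom.inl K Q) ?_ ?_
  · intro z hz hb
    have := hb.gmap (MonoidHom.fst K Q)
    rwa [gmap_gmap _ _ (MonoidHom.id K) (fun _ => rfl), gmap_id _ (fun _ => rfl)] at this
  · intro y hy
    refine ⟨gmap (MonoidHom.fst K Q) _ y, by rw [d_gmap, hy, map_zero], ?_⟩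
    refine prod_acyc_inj hQ _ (by rw [map_sub, d_gmap, d_gmap, hy, map_zero, map_zero, sub_zero]) ?_
    rw [map_sub, gmap_gmap (MonoidHom.inl K Q) (MonoidHom.fst K Q) (MonoidHom.id K) (fun _ => rfl),
      gmap_id _ (fun _ => rfl), sub_self]
    exact isB_zero

/-! ### The final group -/

lemma exists_perm_order (n : ℕ) (hn : 2 ≤ n) : ∃ σ : Equiv.Perm ℕ, orderOf σ = n := by
  refine ⟨Equiv.Perm.viaEmbeddingHom Fin.valEmbedding (finRotate n), ?_⟩
  rw [orderOf_injective _ (Equiv.Perm.viaEmbeddingHom_injective _)]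
  obtain ⟨k, rfl⟩ := Nat.exists_eq_add_of_le' hn
  rw [isCycle_finRotate.orderOf, support_finRotate]
  simp

/-- Product permutations. -/
def prP (K X : Type) [Group K] (Q : Subgroup (Equiv.Perm X)) : K × Q →* Equiv.Perm (K × X) where
  toFun g := Equiv.prodCongr (Equiv.mulLeft g.1) (g.2 : Equiv.Perm X)
  map_one' := by ext1 x; simp
  map_mul' a b := by
    ext1 x
    refine Prod.ext ?_ ?_
    · exact mul_assoc a.1 b.1 x.1
    · rfl

lemma prP_apply {K X : Type} [Group K] {Q : Subgroup (Equiv.Perm X)} (g : K × Q) (x : K × X) :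
    prP K X Q g x = (g.1 * x.1, (g.2 : Equiv.Perm X) x.2) := rfl

lemma prP_inj {K X : Type} [Nonempty X] [Group K] {Q : Subgroup (Equiv.Perm X)} :
    Function.Injective (prP K X Q) := by
  intro a b h
  have h1 : ∀ x, prP K X Q a x = prP K X Q b x := fun x => by rw [h]
  simp only [prP_apply, Prod.mk.injEq] at h1
  refine Prod.ext ?_ ?_
  · obtain ⟨x⟩ := ‹Nonempty X›
    simpa using (h1 (1, x)).1
  · apply Subtype.ext
    ext1 x
    exact (h1 (1, x)).2

lemma normal_gen_prP (K : Type) [Group K] (σ : Equiv.Perm ℕ) (hσ : σ ≠ 1) :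
    Subgroup.normalClosure {lev0 (K × PX ℕ) (prP K (PX ℕ) (Gam ℕ) (1, lev0 ℕ σ))} = ⊤ := by
  obtain ⟨x0, hx0⟩ : ∃ x, σ x ≠ x := by
    by_contra h
    push Not at h
    exact hσ (Equiv.ext h)
  let j : PX (K × PX ℕ) × ℤ ↪ PX (K × PX ℕ) :=
    { toFun := fun p => (((p.1.1.1.1, ((x0, 0), 0)),
        Encodable.encode (p.1.1.1.2, p.1.1.2, p.1.2, p.2)), 0)
      inj' := by
        rintro ⟨⟨⟨⟨a, b⟩, c⟩, f⟩, g⟩ ⟨⟨⟨⟨a', b'⟩, c'⟩, f'⟩, g'⟩ h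
        simp only [Prod.mk.injEq, Encodable.encode_inj, and_true] at h
        obtain ⟨rfl, rfl, rfl, rfl, rfl⟩ := h
        rfl }
  have hj : ∀ p, j p = (((p.1.1.1.1, ((x0, 0), 0)),
        Encodable.encode (p.1.1.1.2, p.1.1.2, p.1.2, p.2)), 0) := fun _ => rfl
  refine normal_gen _ j 0 (fun p => le_rfl) (fun p => ?_) (fun p q h => ?_)
  · rw [hj, lev0_apply]
  · rw [hj, lev0_apply, prP_apply, hj] at h
    simp only [lev0_apply, Prod.mk.injEq] at h
    exact hx0 h.1.1.2.1.1

theorem main_group (A : ℕ → Type) [∀ n, AddCommGroup (A n)] : ∃ (G : Type) (_ : Group G),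
    (∀ n : ℕ, 2 ≤ n → ∃ g : G, orderOf g = n ∧ Subgroup.normalClosure {g} = ⊤) ∧ Van G 1 ∧
    ∀ n, HRep G (n + 2) (A n) := by
  obtain ⟨K, _, hK⟩ := exists_wedge A
  let i : K × Gam ℕ →* Gam (K × PX ℕ) := (lev0 (K × PX ℕ)).comp (prP K (PX ℕ) (Gam ℕ))
  have hi : Function.Injective i := lev0_inj.comp prP_inj
  obtain ⟨G, _, jA, jB, h⟩ := exists_amalg i i hi hi
  refine ⟨G, inferInstance, ?_, h.van_one (acyc_gam _ 1) (acyc_gam _ 1), fun n =>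
    h.hrep (acyc_gam _) (acyc_gam _) ((hK n).prod (acyc_gam ℕ))⟩
  intro n hn
  obtain ⟨σ, hσ⟩ := exists_perm_order n hn
  have hσ1 : σ ≠ 1 := by
    rintro rfl
    rw [orderOf_one] at hσ
    omega
  have hgen := normal_gen_prP K σ hσ1
  set t := lev0 (K × PX ℕ) (prP K (PX ℕ) (Gam ℕ) (1, lev0 ℕ σ)) with ht
  refine ⟨jA t, ?_, ?_⟩
  · have h1 : orderOf (jA t) = orderOf σ := by
      have h0 : Function.Injective (MonoidHom.inr K (Gam ℕ)) := fun a b hab => congrArg Prod.snd hab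
      have : Function.Injective ((jA.comp i).comp ((MonoidHom.inr K (Gam ℕ)).comp (lev0 ℕ))) :=
        (h.jA_inj.comp hi).comp (h0.comp lev0_inj)
      exact orderOf_injective _ this σ
    rw [h1, hσ]
  · have hcl : ∀ (j : Gam (K × PX ℕ) →* G), j t = jA t → ∀ a, j a ∈ Subgroup.normalClosure {jA t} := by
      intro j hj a
      have h1 : Subgroup.normalClosure {t} ≤ (Subgroup.normalClosure {jA t}).comap j := by
        apply Subgroup.normalClosure_le_normal
        rw [Set.singleton_subset_iff, SetLike.mem_coe, Subgroup.mem_comap]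
        rw [hj]
        exact Subgroup.subset_normalClosure rfl
      rw [hgen] at h1
      exact h1 (Subgroup.mem_top a)
    exact h.gen _ (hcl jA rfl) (hcl jB (h.comm (1, lev0 ℕ σ)).symm)

end BDM

namespace BDM
open Finsupp CategoryTheory AlgebraicTopology Simplicial

section link
variable {G : Type} [Group G]

/-- The simplex of the nerve associated with a tuple. -/
def theta (n : ℕ) (v : Fin (n + 1) → G) : ComposableArrows (SingleObj G) n where
  obj _ := SingleObj.star G
  map {i j} _ := ((v j)⁻¹ * v i : G)
  map_id i := by
    change ((v i)⁻¹ * v i : G) = 1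
    simp
  map_comp {i j k} f g := by
    change ((v k)⁻¹ * v i : G) = ((v k)⁻¹ * v j) * ((v j)⁻¹ * v i)
    group

lemma theta_ext (n : ℕ) {F F' : ComposableArrows (SingleObj G) n}
    (h : ∀ (i j : Fin (n + 1)) (f : i ⟶ j), (F.map f : G) = (F'.map f : G)) : F = F' := by
  refine CategoryTheory.Functor.ext (fun _ => rfl) ?_
  intro i j f
  simp only [eqToHom_refl, Category.id_comp, Category.comp_id]
  exact h i j f

lemma theta_inv (n : ℕ) (g : G) (v : Fin (n + 1) → G) : theta n (fun i => g * v i) = theta n v := by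
  apply theta_ext
  intro i j f
  change ((g * v j)⁻¹ * (g * v i) : G) = (v j)⁻¹ * v i
  group

/-- Orbits to simplices. -/
def thetaQ (n : ℕ) (o : Orb G Unit (n + 1)) : ComposableArrows (SingleObj G) n :=
  Quotient.lift (fun p : (Fin (n + 1) → G) × Unit => theta n p.1) (by
    rintro ⟨v, x⟩ ⟨w, y⟩ ⟨g, hg⟩
    obtain ⟨h1, h2⟩ := Prod.mk.inj hg
    simp only at h1 ⊢
    rw [← h1]
    exact theta_inv n g w) o

lemma thetaQ_bij (n : ℕ) : Function.Bijective (thetaQ (G := G) n) := by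
  constructor
  · intro a b
    induction a using Quotient.inductionOn with | h p =>
    induction b using Quotient.inductionOn with | h q =>
    obtain ⟨v, x⟩ := p
    obtain ⟨w, y⟩ := q
    intro h
    change theta n v = theta n w at h
    apply Quotient.sound
    refine ⟨v 0 * (w 0)⁻¹, ?_⟩
    refine Prod.ext ?_ rfl
    funext i
    change v 0 * (w 0)⁻¹ * w i = v i
    have key : ∀ (F F' : ComposableArrows (SingleObj G) n), F = F' →
        ∀ f : (0 : Fin (n + 1)) ⟶ i, (F.map f : G) = (F'.map f : G) := by
      rintro F _ rfl f
      rfl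
    have h2 := key _ _ h (homOfLE (Fin.zero_le i))
    change ((v i)⁻¹ * v 0 : G) = (w i)⁻¹ * w 0 at h2
    have h3 : v 0 = v i * ((w i)⁻¹ * w 0) := by rw [← h2]; group
    rw [h3]; group
  · intro F
    let m : ∀ i : Fin (n + 1), G := fun i => F.map (homOfLE (Fin.zero_le i))
    refine ⟨Quotient.mk _ (fun i => (m i)⁻¹, ()), ?_⟩
    change theta n (fun i => (m i)⁻¹) = F
    apply theta_ext
    intro i j f
    change ((m j)⁻¹⁻¹ * (m i)⁻¹ : G) = F.map f
    have h : m j = (F.map f : G) * m i := by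
      have := F.map_comp (homOfLE (Fin.zero_le i)) f
      exact this
    rw [h]; group

/-- The comparison isomorphism. -/
noncomputable def cmp (G : Type) [Group G] (n : ℕ) :
    Ch G Unit (n + 1) ≃ₗ[ℤ] ((classifyingComplex G).X n) :=
  Finsupp.domLCongr (Equiv.ofBijective (thetaQ (G := G) n) (thetaQ_bij n))

lemma cmp_e (n : ℕ) (v : Fin (n + 1) → G) (x : Unit) :
    cmp G n (e v x) = (ModuleCat.freeMk (R := ℤ) (theta n v : (nerve (SingleObj G)) _⦋n⦌)) := by
  exact Finsupp.domLCongr_single (R := ℤ) (M := ℤ)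
    (Equiv.ofBijective (thetaQ (G := G) n) (thetaQ_bij n)) _ _

lemma delta_theta (n : ℕ) (i : Fin (n + 2)) (v : Fin (n + 2) → G) :
    (nerve (SingleObj G)).δ i (theta (n + 1) v : (nerve (SingleObj G)) _⦋n + 1⦌) =
      theta n (fun j => v (i.succAbove j)) := by
  rfl

lemma d_e_sum (n : ℕ) (v : Fin (n + 1) → G) (x : Unit) :
    d n (e v x) = ∑ i : Fin (n + 1), (-1 : ℤ) ^ (i : ℕ) • e (fun j => v (i.succAbove j)) x := by
  rw [d_e, bd_single_eq_sum]
  simp only [map_sum, map_smul, LinearMap.sum_apply, LinearMap.smul_apply, pr_single]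

lemma zsmul_hom_apply {X Y : ModuleCat.{0} ℤ} (a : ℤ) (f : X ⟶ Y) (x : X) :
    (a • f).hom x = a • f.hom x := by
  rw [ModuleCat.hom_zsmul]
  rfl

lemma exists_linear {M B : Type} [AddCommGroup M] [inst : Module ℤ M] [AddCommGroup B]
    (κ : M →+ B) : ∃ κ' : M →ₗ[ℤ] B, ∀ x, κ' x = κ x :=
  ⟨{ toFun := κ
     map_add' := κ.map_add
     map_smul' := fun a x => by simpa using map_intCast_smul κ ℤ ℤ a x }, fun _ => rfl⟩

lemma face_free (n : ℕ) (x : (nerve (SingleObj G)) _⦋n + 1⦌) :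
    ((classifyingComplex G).d (n + 1) n).hom (ModuleCat.freeMk (R := ℤ) x) =
      ∑ i : Fin (n + 2), (-1 : ℤ) ^ (i : ℕ) •
        (ModuleCat.freeMk (R := ℤ) ((nerve (SingleObj G)).δ i x)) := by
  unfold classifyingComplex
  rw [alternatingFaceMapComplex_obj_d]
  unfold AlternatingFaceMapComplex.objD
  rw [ModuleCat.hom_sum]
  erw [LinearMap.sum_apply]
  refine Finset.sum_congr rfl fun i _ => ?_
  refine (zsmul_hom_apply _ _ _).trans ?_
  congr 1
  exact ModuleCat.free_map_apply ((nerve (SingleObj G)).δ i) x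

lemma cmp_d (n : ℕ) (c : Ch G Unit (n + 2)) :
    ((classifyingComplex G).d (n + 1) n).hom (cmp G (n + 1) c) = cmp G n (d (n + 1) c) := by
  have : ((classifyingComplex G).d (n + 1) n).hom ∘ₗ (cmp G (n + 1)).toLinearMap =
      (cmp G n).toLinearMap ∘ₗ d (n + 1) := by
    apply ch_ext
    intro v x
    have h1 := congrArg ((classifyingComplex G).d (n + 1) n).hom (cmp_e (n + 1) v x)
    refine h1.trans ((face_free n _).trans ?_)
    have h2 := congrArg (cmp G n) (d_e_sum (n + 1) v x)
    refine Eq.trans ?_ h2.symm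
    rw [map_sum]
    refine Finset.sum_congr rfl fun i _ => ?_
    rw [map_zsmul, cmp_e]
    rfl
  exact LinearMap.congr_fun this c

lemma homology_of_linear {R : Type} [CommRing R] (S : ShortComplex (ModuleCat.{0} R)) {B : Type}
    [AddCommGroup B] [Module R B]
    (κ : LinearMap.ker S.g.hom →ₗ[R] B) (hs : Function.Surjective κ)
    (hk : ∀ z, κ z = 0 ↔ ∃ b, S.f.hom b = z.1) : Nonempty (S.homology ≃+ B) := by
  have hker : LinearMap.range S.moduleCatToCycles = LinearMap.ker κ := by
    ext z
    rw [LinearMap.mem_range, LinearMap.mem_ker, hk]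
    constructor
    · rintro ⟨b, rfl⟩
      exact ⟨b, rfl⟩
    · rintro ⟨b, hb⟩
      exact ⟨b, Subtype.ext hb⟩
  exact ⟨(S.moduleCatHomologyIso.toLinearEquiv.toAddEquiv.trans
    (Submodule.quotEquivOfEq _ _ hker).toAddEquiv).trans
    (κ.quotKerEquivOfSurjective hs).toAddEquiv⟩

lemma homology_of (S : ShortComplex (ModuleCat.{0} ℤ)) {B : Type} [AddCommGroup B]
    (κ : LinearMap.ker S.g.hom →+ B) (hs : Function.Surjective κ)
    (hk : ∀ z, κ z = 0 ↔ ∃ b, S.f.hom b = z.1) : Nonempty (S.homology ≃+ B) := by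
  obtain ⟨κ', hκ⟩ := exists_linear (inst := Submodule.module _) κ
  refine homology_of_linear S κ' (fun b => ?_) (fun z => ?_)
  · obtain ⟨z, hz⟩ := hs b
    exact ⟨z, (hκ z).trans hz⟩
  · rw [← hk, hκ]

lemma homology_transfer (S : ShortComplex (ModuleCat.{0} ℤ)) {B C₁ C₂ C₃ : Type} [AddCommGroup B]
    [AddCommGroup C₁] [AddCommGroup C₂] [AddCommGroup C₃]
    (f : C₁ →ₗ[ℤ] C₂) (g : C₂ →ₗ[ℤ] C₃)
    (e₁ : C₁ ≃ₗ[ℤ] S.X₁) (e₂ : C₂ ≃ₗ[ℤ] S.X₂) (e₃ : C₃ ≃ₗ[ℤ] S.X₃)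
    (hf : ∀ c, S.f.hom (e₁ c) = e₂ (f c)) (hg : ∀ c, S.g.hom (e₂ c) = e₃ (g c))
    (κ : LinearMap.ker g →+ B) (hs : Function.Surjective κ)
    (hk : ∀ z, κ z = 0 ↔ ∃ b, f b = z.1) : Nonempty (S.homology ≃+ B) := by
  have hmem : ∀ z : LinearMap.ker S.g.hom, e₂.symm z.1 ∈ LinearMap.ker g := by
    intro z
    rw [LinearMap.mem_ker]
    apply e₃.injective
    rw [← hg, map_zero, LinearEquiv.apply_symm_apply]
    exact z.2
  let τ : LinearMap.ker S.g.hom →+ LinearMap.ker g :=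
    { toFun := fun z => ⟨e₂.symm z.1, hmem z⟩
      map_zero' := Subtype.ext (map_zero e₂.symm)
      map_add' := fun a b => Subtype.ext (map_add e₂.symm a.1 b.1) }
  have hτ : Function.Surjective τ := by
    intro z
    refine ⟨⟨e₂ z.1, ?_⟩, ?_⟩
    · rw [LinearMap.mem_ker, hg, LinearMap.mem_ker.1 z.2, map_zero]
    · exact Subtype.ext (e₂.symm_apply_apply z.1)
  refine homology_of S (κ.comp τ) (hs.comp hτ) ?_
  intro z
  change κ (τ z) = 0 ↔ _
  rw [hk]
  constructor
  · rintro ⟨b, hb⟩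
    refine ⟨e₁ b, ?_⟩
    rw [hf, hb]
    exact e₂.apply_symm_apply z.1
  · rintro ⟨b, hb⟩
    refine ⟨e₁.symm b, ?_⟩
    apply e₂.injective
    rw [← hf, LinearEquiv.apply_symm_apply, hb]
    exact (e₂.apply_symm_apply z.1).symm

lemma grp_of_hrep {m : ℕ} {B : Type} [AddCommGroup B] (h : HRep G (m + 1) B) :
    Nonempty (grpHomology G (m + 1) ≃+ B) := by
  obtain ⟨κ, hs, hk⟩ := h
  have iso := (classifyingComplex G).homologyIsoSc' (m + 2) (m + 1) m (by simp) (by simp)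
  obtain ⟨f⟩ := homology_transfer ((classifyingComplex G).sc' (m + 2) (m + 1) m)
    (d (m + 2)) (d (m + 1)) (cmp G (m + 2)) (cmp G (m + 1)) (cmp G m)
    (cmp_d (m + 1)) (cmp_d m) κ hs hk
  exact ⟨iso.toLinearEquiv.toAddEquiv.trans f⟩

lemma grp_one_of_van (h : Van G 1) : Subsingleton (grpHomology G 1) := by
  have h1 : HRep G 1 PUnit.{1} := ⟨0, fun _ => ⟨0, rfl⟩, fun z => ⟨fun _ => h z.1 z.2, fun _ => rfl⟩⟩
  obtain ⟨f⟩ := grp_of_hrep h1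
  exact f.toEquiv.subsingleton

end link

end BDM

theorem homology_realization_BDM
    (A : ℕ → Type) [∀ n, AddCommGroup (A n)] :
    ∃ (G : Type) (_ : Group G),
      StronglyTorsionGenerated G ∧
      Subsingleton (grpHomology G 1) ∧
      ∀ n : ℕ, 2 ≤ n → Nonempty (grpHomology G n ≃+ A n) := by
  obtain ⟨G, hG, h1, h2, h3⟩ := BDM.main_group (fun n => A (n + 2))
  refine ⟨G, hG, h1, BDM.grp_one_of_van h2, ?_⟩
  intro n hn
  obtain ⟨k, rfl⟩ := Nat.exists_eq_add_of_le' hn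
  exact BDM.grp_of_hrep (h3 k)
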